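/- There is an absolute constant C > 0 such that for every sufficiently large q and every b ∈ ℤ_+ with b < q and gcd(b, q) = 1, there exist rationals b'/q' and b''/q'' (in lowest terms, with q', q'' positive integers) such that b/q = b'/q' + b''/q'', Ĉ(b'/q') ≤ C · log q, and q'' < √q. -/

import Mathlib

/-- Auxiliary continued fraction algorithm with fuel: for `x ∈ (0,1)`,
produces the list of partial quotients `[a₁, …, aₙ]` of `x = [0; a₁, …, aₙ]`. -/
def cfListAux : ℕ → ℚ → List ℕ
  | 0, _ => []
  | (n + 1), x => if x = 0 then [] else ⌊x⁻¹⌋.toNat :: cfListAux n (x⁻¹ - (⌊x⁻¹⌋ : ℚ))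

/-- The (canonical) list of partial quotients of a rational `x ∈ (0,1)`:
`x = [0; a₁, …, aₙ]` with each `aᵢ` a positive integer and `aₙ ≥ 2`.
The denominator of `x` is a valid fuel bound since denominators strictly decrease. -/
def cfList (x : ℚ) : List ℕ := cfListAux x.den x

/-- `S x` is the sum of the partial quotients of the rational `x ∈ (0,1)`. -/
def S (x : ℚ) : ℕ := (cfList x).sum

/-- `RA A` is the set of rationals in `(0,1)` all of whose partial quotients are `≤ A`. -/
def RA (A : ℕ) : Set ℚ := {x | 0 < x ∧ x < 1 ∧ ∀ a ∈ cfList x, a ≤ A}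

/-- `RepCost y n` : the rational `y` admits a representation as a finite signed sum
`y = Σ_α ε_α · x_α` with `ε_α ∈ {+1, -1}`, each `x_α = b_α/q_α ∈ (0,1)` in lowest terms,
and total partial-quotient cost `Σ_α S(x_α) = n`. -/
def RepCost (y : ℚ) (n : ℕ) : Prop :=
  ∃ (k : ℕ) (ε : Fin k → ℤ) (x : Fin k → ℚ),
    (∀ i, ε i = 1 ∨ ε i = -1) ∧ (∀ i, 0 < x i ∧ x i < 1) ∧
    y = ∑ i, (ε i : ℚ) * x i ∧ n = ∑ i, S (x i)

/-- `CostLE y t` : the minimal representation cost `Ĉ(y)` is at most `t`. -/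
def CostLE (y : ℚ) (t : ℝ) : Prop := ∃ n : ℕ, RepCost y n ∧ (n : ℝ) ≤ t

/-! ## Sums of partial quotients along words in the modular group -/

lemma den_fract_inv_lt {x : ℚ} (h0 : 0 < x) (h1 : x < 1) :
    (x⁻¹ - (⌊x⁻¹⌋ : ℚ)).den < x.den := by
  have hd : (x⁻¹ - (⌊x⁻¹⌋ : ℚ)).den = x⁻¹.den := by
    rw [show x⁻¹ - (⌊x⁻¹⌋ : ℚ) = x⁻¹ - ((⌊x⁻¹⌋ : ℤ) : ℚ) from rfl, Rat.sub_intCast_den]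
  have hnum : 0 < x.num := Rat.num_pos.mpr h0
  rw [hd, Rat.den_inv_of_ne_zero h0.ne']
  have := Rat.num_lt_denom_iff.mpr h1
  omega

lemma cfListAux_zero (n : ℕ) : cfListAux n 0 = [] := by
  cases n <;> simp [cfListAux]

lemma cfListAux_eq_of_le (n : ℕ) : ∀ x : ℚ, 0 ≤ x → x < 1 → x.den ≤ n →
    cfListAux n x = cfListAux x.den x := by
  induction n using Nat.strong_induction_on with
  | _ n ih =>
    intro x h0 h1 hn
    rcases h0.eq_or_lt with rfl | h0
    · simp [cfListAux_zero]
    have hlt := den_fract_inv_lt h0 h1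
    have hf0 : 0 ≤ x⁻¹ - (⌊x⁻¹⌋ : ℚ) := Int.fract_nonneg x⁻¹
    have hf1 : x⁻¹ - (⌊x⁻¹⌋ : ℚ) < 1 := Int.fract_lt_one x⁻¹
    obtain ⟨d, hd⟩ : ∃ d, x.den = d + 1 := ⟨x.den - 1, by have := x.den_pos; omega⟩
    obtain ⟨m, rfl⟩ : ∃ m, n = m + 1 := ⟨n - 1, by omega⟩
    rw [hd]
    simp only [cfListAux, h0.ne', if_false]
    rw [ih m (by omega) _ hf0 hf1 (by omega)]
    by_cases hm : d = m
    · rw [hm, ih m (by omega) _ hf0 hf1 (by omega)]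
    · rw [ih d (by omega) _ hf0 hf1 (by omega)]

lemma S_zero : S 0 = 0 := by simp [S, cfList, cfListAux_zero]

lemma S_eq {x : ℚ} (h0 : 0 < x) (h1 : x < 1) :
    S x = ⌊x⁻¹⌋.toNat + S (Int.fract x⁻¹) := by
  have hlt := den_fract_inv_lt h0 h1
  obtain ⟨d, hd⟩ : ∃ d, x.den = d + 1 := ⟨x.den - 1, by have := x.den_pos; omega⟩
  have : cfList x = ⌊x⁻¹⌋.toNat :: cfList (Int.fract x⁻¹) := by
    rw [cfList, hd]
    simp only [cfListAux, h0.ne', if_false]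
    rw [cfListAux_eq_of_le d (x⁻¹ - (⌊x⁻¹⌋ : ℚ)) (Int.fract_nonneg x⁻¹) (Int.fract_lt_one x⁻¹)
      (by omega)]
    rfl
  rw [S, this]
  simp [S]

/-- The absolute value of the integer part plus the sum of the partial quotients. -/
def quotientSum (x : ℚ) : ℕ := ⌊x⌋.natAbs + S (Int.fract x)

lemma quotientSum_zero : quotientSum 0 = 0 := by simp [quotientSum, S_zero]

lemma quotientSum_inv_of_lt_one {x : ℚ} (h0 : 0 < x) (h1 : x < 1) :
    quotientSum x⁻¹ = quotientSum x := by
  have hf : ⌊x⌋ = 0 := by rw [Int.floor_eq_zero_iff]; exact ⟨h0.le, h1⟩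
  have hfr : Int.fract x = x := Int.fract_eq_self.mpr ⟨h0.le, h1⟩
  have hpos : 0 ≤ ⌊x⁻¹⌋ := Int.floor_nonneg.mpr (inv_nonneg.mpr h0.le)
  rw [quotientSum, quotientSum, hf, hfr, S_eq h0 h1]
  simp
  omega

lemma quotientSum_inv_of_pos {x : ℚ} (h0 : 0 < x) : quotientSum x⁻¹ = quotientSum x := by
  rcases lt_trichotomy x 1 with h | h | h
  · exact quotientSum_inv_of_lt_one h0 h
  · simp [h]
  · have := quotientSum_inv_of_lt_one (inv_pos.mpr h0) (inv_lt_one_of_one_lt₀ h)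
    rw [inv_inv] at this
    exact this.symm

lemma S_one_sub_of_lt_half {x : ℚ} (h0 : 0 < x) (h1 : x < 1 / 2) : S (1 - x) = S x := by
  have hx1 : x < 1 := by linarith
  set y := x⁻¹ with hy
  have hxy : x = y⁻¹ := by simp [hy]
  have hy2 : 2 < y := by rw [hy]; exact (lt_inv_comm₀ (by norm_num) h0).mpr (by linarith)
  have hinv : (1 - x)⁻¹ = 1 + 1 / (y - 1) := by
    rw [hxy]; have : y - 1 ≠ 0 := by linarith
    have h2 : y ≠ 0 := by linarith
    have : 1 - y⁻¹ ≠ 0 := by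
      intro h; have : y⁻¹ = 1 := by linarith
      rw [inv_eq_one] at this; linarith
    field_simp
    ring
  have hz0 : 0 < 1 / (y - 1) := by apply one_div_pos.mpr; linarith
  have hz1 : 1 / (y - 1) < 1 := by rw [div_lt_one] <;> linarith
  have hfl : ⌊(1 - x)⁻¹⌋ = 1 := by
    rw [hinv, Int.floor_eq_iff]; push_cast; constructor <;> linarith
  have hfr : Int.fract (1 - x)⁻¹ = 1 / (y - 1) := by
    rw [Int.fract, hfl, hinv]; push_cast; ring
  rw [S_eq (by linarith) (by linarith), hfl, hfr, S_eq hz0 hz1, S_eq h0 hx1, ← hy]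
  have : (1 / (y - 1))⁻¹ = y - 1 := by simp
  rw [this, Int.floor_sub_one, Int.fract_sub_one]
  have : 2 ≤ ⌊y⌋ := Int.le_floor.mpr (by push_cast; linarith)
  omega

lemma S_one_sub {x : ℚ} (h0 : 0 < x) (h1 : x < 1) : S (1 - x) = S x := by
  rcases lt_trichotomy x (1 / 2) with h | h | h
  · exact S_one_sub_of_lt_half h0 h
  · rw [h]; norm_num
  · have := S_one_sub_of_lt_half (x := 1 - x) (by linarith) (by linarith)
    rw [← this]; congr 1; ring

lemma quotientSum_neg_le (x : ℚ) : quotientSum (-x) ≤ quotientSum x + 1 := by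
  by_cases h : Int.fract x = 0
  · have hx : (⌊x⌋ : ℚ) = x := by have := Int.floor_add_fract x; linarith
    have h1 : -x = ((-⌊x⌋ : ℤ) : ℚ) := by push_cast; rw [hx]
    rw [quotientSum, quotientSum, h, h1, Int.floor_intCast, Int.fract_intCast]
    omega
  · have hpos : 0 < Int.fract x := lt_of_le_of_ne (Int.fract_nonneg x) (Ne.symm h)
    have hfl : ⌊-x⌋ = -⌊x⌋ - 1 := by
      rw [Int.floor_eq_iff]
      have h1 := Int.floor_add_fract x
      have h2 := Int.fract_lt_one x
      push_cast
      constructor <;> linarith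
    have hfr : Int.fract (-x) = 1 - Int.fract x := Int.fract_neg h
    rw [quotientSum, quotientSum, hfr, S_one_sub hpos (Int.fract_lt_one x), hfl]
    omega

lemma quotientSum_neg_inv_le (x : ℚ) : quotientSum (-x⁻¹) ≤ quotientSum x + 2 := by
  rcases lt_trichotomy x 0 with h | h | h
  · rw [← inv_neg, quotientSum_inv_of_pos (by linarith)]
    have := quotientSum_neg_le x
    omega
  · simp [h, quotientSum_zero]
  · have := quotientSum_neg_le x⁻¹
    rw [quotientSum_inv_of_pos h] at this
    omega

lemma quotientSum_add_one_le (x : ℚ) : quotientSum (x + 1) ≤ quotientSum x + 1 := by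
  rw [quotientSum, quotientSum, Int.floor_add_one, Int.fract_add_one]
  omega

lemma quotientSum_sub_one_le (x : ℚ) : quotientSum (x - 1) ≤ quotientSum x + 1 := by
  rw [quotientSum, quotientSum, Int.floor_sub_one, Int.fract_sub_one]
  omega

section ModularGroup

open Matrix MatrixGroups

/-- `g` is a product of at most `L` of the standard generators and their inverses. -/
def IsShort (L : ℕ) (g : SL(2, ℤ)) : Prop :=
  ∃ l : List SL(2, ℤ), l.length ≤ L ∧
    (∀ s ∈ l, s = ModularGroup.S ∨ s = ModularGroup.S⁻¹ ∨ s = ModularGroup.T ∨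
      s = ModularGroup.T⁻¹) ∧ l.prod = g

lemma IsShort.mono {L L' : ℕ} {g : SL(2, ℤ)} (h : IsShort L g) (hL : L ≤ L') : IsShort L' g := by
  obtain ⟨l, h1, h2⟩ := h
  exact ⟨l, h1.trans hL, h2⟩

lemma IsShort.mul {L L' : ℕ} {g h : SL(2, ℤ)} (hg : IsShort L g) (hh : IsShort L' h) :
    IsShort (L + L') (g * h) := by
  obtain ⟨l, h1, h2, rfl⟩ := hg
  obtain ⟨l', h1', h2', rfl⟩ := hh
  refine ⟨l ++ l', by simp; omega, ?_, by simp⟩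
  intro s hs
  rcases List.mem_append.mp hs with h | h
  · exact h2 s h
  · exact h2' s h

lemma IsShort.inv {L : ℕ} {g : SL(2, ℤ)} (hg : IsShort L g) : IsShort L g⁻¹ := by
  obtain ⟨l, h1, h2, rfl⟩ := hg
  refine ⟨(l.map (·⁻¹)).reverse, by simpa using h1, ?_, (List.prod_inv_reverse l).symm⟩
  intro s hs
  simp only [List.mem_reverse, List.mem_map] at hs
  obtain ⟨t, ht, rfl⟩ := hs
  rcases h2 t ht with rfl | rfl | rfl | rfl <;> simp

lemma isShort_S : IsShort 1 ModularGroup.S := ⟨[ModularGroup.S], by simp⟩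

lemma isShort_T : IsShort 1 ModularGroup.T := ⟨[ModularGroup.T], by simp⟩

lemma isShort_one (L : ℕ) : IsShort L 1 := ⟨[], by simp⟩

lemma exists_isShort (g : SL(2, ℤ)) : ∃ L, IsShort L g := by
  have hg : g ∈ Subgroup.closure {ModularGroup.S, ModularGroup.T} := by
    rw [SpecialLinearGroup.SL2Z_generators]; trivial
  induction hg using Subgroup.closure_induction with
  | mem x hx =>
    rcases hx with rfl | rfl
    · exact ⟨1, isShort_S⟩
    · exact ⟨1, isShort_T⟩
  | one => exact ⟨0, isShort_one 0⟩
  | mul x y _ _ hx hy =>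
    obtain ⟨a, ha⟩ := hx
    obtain ⟨b, hb⟩ := hy
    exact ⟨a + b, ha.mul hb⟩
  | inv x _ hx =>
    obtain ⟨a, ha⟩ := hx
    exact ⟨a, ha.inv⟩

lemma SL2_inv_apply (g : SL(2, ℤ)) : g⁻¹ 0 0 = g 1 1 ∧ g⁻¹ 0 1 = -g 0 1 ∧ g⁻¹ 1 0 = -g 1 0 ∧
    g⁻¹ 1 1 = g 0 0 := by
  simp [Matrix.SpecialLinearGroup.coe_inv, Matrix.adjugate_fin_two]

lemma SL2_mul_apply (g h : SL(2, ℤ)) (i j : Fin 2) :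
    (g * h) i j = g i 0 * h 0 j + g i 1 * h 1 j := by
  simp [Matrix.mul_apply, Fin.sum_univ_two]

lemma IsShort.quotientSum_le {L : ℕ} {g : SL(2, ℤ)} (hg : IsShort L g) :
    quotientSum ((g 0 0 : ℚ) / (g 1 0 : ℚ)) ≤ 2 * L := by
  obtain ⟨l, h1, h2, rfl⟩ := hg
  suffices h : quotientSum ((l.prod 0 0 : ℚ) / (l.prod 1 0 : ℚ)) ≤ 2 * l.length by omega
  clear h1
  induction l with
  | nil => simp [quotientSum_zero]
  | cons s l ih =>
    have ih := ih (fun t ht => h2 t (List.mem_cons_of_mem _ ht))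
    rw [List.prod_cons, List.length_cons]
    set g := l.prod
    rw [SL2_mul_apply, SL2_mul_apply]
    have hs := h2 s List.mem_cons_self
    have key := quotientSum_neg_inv_le ((g 0 0 : ℚ) / (g 1 0 : ℚ))
    have keyT := quotientSum_add_one_le ((g 0 0 : ℚ) / (g 1 0 : ℚ))
    have keyT' := quotientSum_sub_one_le ((g 0 0 : ℚ) / (g 1 0 : ℚ))
    rcases hs with rfl | rfl | rfl | rfl
    · simp only [ModularGroup.S]
      rw [inv_div] at key
      simp [neg_div]
      omega
    · obtain ⟨i0, i1, i2, i3⟩ := SL2_inv_apply ModularGroup.S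
      rw [i0, i1, i2, i3]
      rw [inv_div] at key
      simp [ModularGroup.S, div_neg]
      omega
    · simp [ModularGroup.T]
      by_cases hc : (g 1 0) = 0
      · simp [hc, quotientSum_zero]
      · rw [add_div, div_self (by exact_mod_cast hc)]; omega
    · obtain ⟨i0, i1, i2, i3⟩ := SL2_inv_apply ModularGroup.T
      rw [i0, i1, i2, i3]
      simp [ModularGroup.T]
      by_cases hc : (g 1 0) = 0
      · simp [hc, quotientSum_zero]
      · rw [← sub_eq_add_neg, sub_div, div_self (by exact_mod_cast hc)]; omega

/-! ## The cost of a rational modulo integers -/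

/-- `x` is congruent modulo `ℤ` to a rational admitting a representation of cost at most `n`. -/
def ModCost (x : ℚ) (n : ℕ) : Prop := ∃ (z : ℤ) (k : ℕ), k ≤ n ∧ RepCost (x - z) k

lemma RepCost.add {x y : ℚ} {m n : ℕ} (hx : RepCost x m) (hy : RepCost y n) :
    RepCost (x + y) (m + n) := by
  obtain ⟨k, ε, u, h1, h2, rfl, rfl⟩ := hx
  obtain ⟨l, δ, w, h3, h4, rfl, rfl⟩ := hy
  refine ⟨k + l, Fin.append ε δ, Fin.append u w, ?_, ?_, ?_, ?_⟩
  · intro i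
    refine Fin.addCases (fun j => ?_) (fun j => ?_) i
    · simpa using h1 j
    · simpa using h3 j
  · intro i
    refine Fin.addCases (fun j => ?_) (fun j => ?_) i
    · simpa using h2 j
    · simpa using h4 j
  · simp [Fin.sum_univ_add]
  · simp [Fin.sum_univ_add]

lemma RepCost.neg {x : ℚ} {m : ℕ} (hx : RepCost x m) : RepCost (-x) m := by
  obtain ⟨k, ε, u, h1, h2, rfl, rfl⟩ := hx
  refine ⟨k, fun i => -ε i, u, ?_, h2, by simp, rfl⟩
  intro i
  rcases h1 i with h | h <;> simp [h]

lemma ModCost.mono {x : ℚ} {m n : ℕ} (h : ModCost x m) (hmn : m ≤ n) : ModCost x n := by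
  obtain ⟨z, k, hk, h⟩ := h
  exact ⟨z, k, hk.trans hmn, h⟩

lemma ModCost.add {x y : ℚ} {m n : ℕ} (hx : ModCost x m) (hy : ModCost y n) :
    ModCost (x + y) (m + n) := by
  obtain ⟨z, k, hk, h⟩ := hx
  obtain ⟨z', k', hk', h'⟩ := hy
  refine ⟨z + z', k + k', by omega, ?_⟩
  convert h.add h' using 1
  push_cast; ring

lemma ModCost.neg {x : ℚ} {m : ℕ} (hx : ModCost x m) : ModCost (-x) m := by
  obtain ⟨z, k, hk, h⟩ := hx
  refine ⟨-z, k, hk, ?_⟩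
  convert h.neg using 1
  push_cast; ring

lemma ModCost.sub {x y : ℚ} {m n : ℕ} (hx : ModCost x m) (hy : ModCost y n) :
    ModCost (x - y) (m + n) := by
  rw [sub_eq_add_neg]; exact hx.add hy.neg

lemma modCost_intCast (z : ℤ) (n : ℕ) : ModCost z n :=
  ⟨z, 0, n.zero_le, 0, Fin.elim0, Fin.elim0, fun i => i.elim0, fun i => i.elim0, by simp, by simp⟩

lemma modCost_S_fract (x : ℚ) : ModCost x (S (Int.fract x)) := by
  by_cases h : Int.fract x = 0
  · have hx : (⌊x⌋ : ℚ) = x := by have := Int.floor_add_fract x; linarith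
    rw [← hx]; exact modCost_intCast _ _
  · have hpos : 0 < Int.fract x := lt_of_le_of_ne (Int.fract_nonneg x) (Ne.symm h)
    refine ⟨⌊x⌋, _, le_rfl, 1, fun _ => 1, fun _ => Int.fract x, by simp,
      fun _ => ⟨hpos, Int.fract_lt_one x⟩, ?_, by simp⟩
    simp [Int.self_sub_floor]

lemma modCost_quotientSum (x : ℚ) : ModCost x (quotientSum x) :=
  (modCost_S_fract x).mono (Nat.le_add_left _ _)

/-- `a` is the lower left entry of a product of at most `L` generators with lower right entry
`N`. -/
def IsCheapNumerator (L : ℕ) (N a : ℤ) : Prop := ∃ g : SL(2, ℤ), IsShort L g ∧ g 1 0 = a ∧ g 1 1 = N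

lemma IsCheapNumerator.modCost_div {L : ℕ} {N a : ℤ} (h : IsCheapNumerator L N a) :
    ModCost ((a : ℚ) / N) (2 * (L + 1)) := by
  obtain ⟨g, hg, rfl, rfl⟩ := h
  have := (isShort_S.mul hg.inv).quotientSum_le
  obtain ⟨i0, i1, i2, i3⟩ := SL2_inv_apply g
  rw [SL2_mul_apply, SL2_mul_apply, i0, i2] at this
  simp [ModularGroup.S] at this
  exact (modCost_quotientSum _).mono (by omega)

/-- The folding identity: reciprocals of differences of cheap numerators are cheap. -/
lemma IsCheapNumerator.modCost_one_div {L : ℕ} {N a b : ℤ} (ha : IsCheapNumerator L N a)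
    (hb : IsCheapNumerator L N b) (hN : N ≠ 0) (hab : a ≠ b) :
    ModCost (1 / ((N : ℚ) * (a - b))) (6 * L + 2) := by
  obtain ⟨g, hg, rfl, hgN⟩ := ha
  obtain ⟨h, hh, rfl, rfl⟩ := hb
  have h1 := (hg.mul hh.inv).quotientSum_le
  have h2 := (hg.mul isShort_S).quotientSum_le
  obtain ⟨i0, i1, i2, i3⟩ := SL2_inv_apply h
  rw [SL2_mul_apply, SL2_mul_apply, i0, i2] at h1
  rw [SL2_mul_apply, SL2_mul_apply] at h2
  simp [ModularGroup.S] at h1 h2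
  have hdet := g.det_coe
  rw [Matrix.det_fin_two] at hdet
  rw [hgN] at h1 h2 hdet
  have key := ((modCost_quotientSum _).mono h1).sub ((modCost_quotientSum _).mono h2)
  refine ModCost.mono ?_ (show 2 * (L + L) + 2 * (L + 1) ≤ 6 * L + 2 by omega)
  convert key using 1
  have hdet' : (g 0 0 : ℚ) * h 1 1 - g 0 1 * g 1 0 = 1 := by exact_mod_cast hdet
  have hN' : (h 1 1 : ℚ) ≠ 0 := by exact_mod_cast hN
  have hab' : (g 1 0 : ℚ) - h 1 0 ≠ 0 := by rw [sub_ne_zero]; exact_mod_cast hab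
  have hden : (g 1 0 : ℚ) * h 1 1 + -(h 1 1 * h 1 0) = h 1 1 * (g 1 0 - h 1 0) := by ring
  rw [hden]
  field_simp
  linarith

/-! ## Many coprime pairs, and well separated matrices with prescribed bottom row -/

lemma sum_inv_sq_le (m : ℕ) (hm : 3 ≤ m) :
    ∑ g ∈ Finset.Icc 2 m, (1 : ℝ) / (g : ℝ) ^ 2 ≤ 7 / 10 - 1 / m := by
  induction m, hm using Nat.le_induction with
  | base => norm_num [Finset.sum_Icc_succ_top]
  | succ m hm ih =>
    rw [Finset.sum_Icc_succ_top (by omega)]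
    have hm' : (0 : ℝ) < m := by positivity
    have : (1 : ℝ) / ((m + 1 : ℕ) : ℝ) ^ 2 ≤ 1 / m - 1 / ((m + 1 : ℕ) : ℝ) := by
      push_cast
      rw [div_sub_div _ _ (by positivity) (by positivity), div_le_div_iff₀ (by positivity) (by positivity)]
      nlinarith
    linarith

lemma card_filter_dvd_Ioc_le (k g : ℕ) (hg : 0 < g) :
    (((Finset.Ioc k (2 * k)).filter (g ∣ ·)).card : ℝ) ≤ k / g + 1 := by
  have h1 : ((Finset.Ioc k (2 * k)).filter (g ∣ ·)).card ≤ k / g + 1 := by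
    rw [show 2 * k = k + k by ring]
    calc _ ≤ (Finset.Ioc (k / g) ((k + k) / g)).card := by
          refine Finset.card_le_card_of_injOn (· / g) ?_ ?_
          · intro x hx
            simp only [Finset.coe_filter, Finset.mem_Ioc, Set.mem_ofPred_eq] at hx
            obtain ⟨⟨hx1, hx2⟩, y, rfl⟩ := hx
            simp only [Finset.coe_Ioc, Set.mem_Ioc]
            rw [Nat.mul_div_cancel_left _ hg, Nat.div_lt_iff_lt_mul hg, Nat.le_div_iff_mul_le hg]
            constructor <;> linarith
          · intro x hx y hy hxy
            simp only [Finset.coe_filter, Finset.mem_Ioc, Set.mem_ofPred_eq] at hx hy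
            obtain ⟨⟨hx1, hx2⟩, x, rfl⟩ := hx
            obtain ⟨⟨hx1, hx2⟩, y, rfl⟩ := hy
            simp only [Nat.mul_div_cancel_left _ hg] at hxy
            rw [hxy]
      _ ≤ _ := by
          rw [Nat.card_Ioc]
          have : (k + k) / g ≤ k / g + k / g + 1 := by
            have h1 := Nat.div_add_mod k g
            have h2 := Nat.mod_lt k hg
            have : k + k < g * (k / g + k / g + 2) := by
              nlinarith
            have := (Nat.div_lt_iff_lt_mul hg).mpr
              (by linarith [mul_comm g (k / g + k / g + 2)] : k + k < (k / g + k / g + 2) * g)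
            exact Nat.lt_succ_iff.mp this
          rw [Nat.sub_le_iff_le_add]
          linarith
  have h2 : ((k / g : ℕ) : ℝ) ≤ (k : ℝ) / g := Nat.cast_div_le
  have h3 : (((Finset.Ioc k (2 * k)).filter (g ∣ ·)).card : ℝ) ≤ ((k / g + 1 : ℕ) : ℝ) := by
    exact_mod_cast h1
  push_cast at h3
  linarith

/-- The coprime pairs in the box `(k, 2 * k]²`. -/
def coprimePairs (k : ℕ) : Finset (ℕ × ℕ) :=
  (Finset.Ioc k (2 * k) ×ˢ Finset.Ioc k (2 * k)).filter fun x => x.1.Coprime x.2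

lemma card_coprimePairs_ge {k : ℕ} (hk : 200 ≤ k) :
    (k : ℝ) ^ 2 / 8 ≤ (coprimePairs k).card := by
  set I := Finset.Ioc k (2 * k) with hI
  have hcover : I ×ˢ I ⊆ coprimePairs k ∪ (I.image fun x => (x, x)) ∪
      (Finset.Icc 2 k).biUnion fun g => (I.filter (g ∣ ·)) ×ˢ (I.filter (g ∣ ·)) := by
    rintro ⟨x, y⟩ hxy
    obtain ⟨hx, hy⟩ := Finset.mem_product.mp hxy
    simp only at hx hy
    simp only [Finset.mem_union, coprimePairs, Finset.mem_filter, ← hI, hxy, true_and,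
      Finset.mem_image, Finset.mem_biUnion, Finset.mem_product]
    by_cases h1 : x.Coprime y
    · left; left; exact h1
    by_cases h2 : x = y
    · left; right; exact ⟨x, hx, by rw [h2]⟩
    right
    rw [hI, Finset.mem_Ioc] at hx hy
    have hg0 : 0 < x.gcd y := Nat.gcd_pos_of_pos_left _ (by omega)
    refine ⟨x.gcd y, ?_, ⟨by rw [hI, Finset.mem_Ioc]; exact hx, Nat.gcd_dvd_left x y⟩,
      ⟨by rw [hI, Finset.mem_Ioc]; exact hy, Nat.gcd_dvd_right x y⟩⟩
    rw [Finset.mem_Icc]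
    refine ⟨by rw [Nat.Coprime] at h1; omega, ?_⟩
    rcases lt_or_gt_of_ne h2 with h | h
    · have := Nat.le_of_dvd (by omega) (Nat.dvd_sub (Nat.gcd_dvd_right x y) (Nat.gcd_dvd_left x y))
      omega
    · have := Nat.le_of_dvd (by omega) (Nat.dvd_sub (Nat.gcd_dvd_left x y) (Nat.gcd_dvd_right x y))
      omega
  have h1 := Finset.card_le_card hcover
  have hIc : I.card = k := by rw [hI, Nat.card_Ioc]; omega
  have h2 : ((I ×ˢ I).card : ℝ) = (k : ℝ) ^ 2 := by rw [Finset.card_product, hIc]; push_cast; ring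
  have h3 : (I.image fun x => (x, x)).card ≤ k := Finset.card_image_le.trans hIc.le
  have hk0 : (200 : ℝ) ≤ k := by exact_mod_cast hk
  have h4 : ((((Finset.Icc 2 k).biUnion fun g => (I.filter (g ∣ ·)) ×ˢ (I.filter (g ∣ ·))).card : ℕ) : ℝ)
      ≤ 77 / 100 * (k : ℝ) ^ 2 + 11 * k := by
    calc _ ≤ ((∑ g ∈ Finset.Icc 2 k, ((I.filter (g ∣ ·)) ×ˢ (I.filter (g ∣ ·))).card : ℕ) : ℝ) := by
          exact_mod_cast Finset.card_biUnion_le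
      _ = ∑ g ∈ Finset.Icc 2 k, ((I.filter (g ∣ ·)).card : ℝ) ^ 2 := by
          push_cast
          exact Finset.sum_congr rfl fun g _ => by rw [Finset.card_product]; push_cast; ring
      _ ≤ ∑ g ∈ Finset.Icc 2 k, (11 / 10 * (k : ℝ) ^ 2 * (1 / (g : ℝ) ^ 2) + 11) := by
          refine Finset.sum_le_sum fun g hg => ?_
          have hg2 : 0 < g := by rw [Finset.mem_Icc] at hg; omega
          have := card_filter_dvd_Ioc_le k g hg2
          have h5 : ((I.filter (g ∣ ·)).card : ℝ) ^ 2 ≤ ((k : ℝ) / g + 1) ^ 2 := by gcongr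
          have h6 : 11 / 10 * (k : ℝ) ^ 2 * (1 / (g : ℝ) ^ 2) = 11 / 10 * ((k : ℝ) / g) ^ 2 := by
            field_simp
          rw [h6]
          nlinarith [sq_nonneg ((k : ℝ) / g - 10)]
      _ = 11 / 10 * (k : ℝ) ^ 2 * (∑ g ∈ Finset.Icc 2 k, 1 / (g : ℝ) ^ 2) + (k - 1) * 11 := by
          rw [Finset.sum_add_distrib, ← Finset.mul_sum, Finset.sum_const, Nat.card_Icc,
            show k + 1 - 2 = k - 1 by omega, nsmul_eq_mul, Nat.cast_sub (by omega)]
          simp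
      _ ≤ 11 / 10 * (k : ℝ) ^ 2 * (7 / 10 - 1 / k) + (k - 1) * 11 := by
          gcongr
          exact sum_inv_sq_le k (by omega)
      _ ≤ _ := by
          have : (0 : ℝ) ≤ 11 / 10 * (k : ℝ) ^ 2 * (1 / k) := by positivity
          nlinarith
  have h5 := (Finset.card_union_le (coprimePairs k ∪ (I.image fun x => (x, x)))
    ((Finset.Icc 2 k).biUnion fun g => (I.filter (g ∣ ·)) ×ˢ (I.filter (g ∣ ·))))
  have h6 := Finset.card_union_le (coprimePairs k) (I.image fun x => (x, x))
  have h7 : ((I ×ˢ I).card : ℝ) ≤ (coprimePairs k).card + k +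
      (((Finset.Icc 2 k).biUnion fun g => (I.filter (g ∣ ·)) ×ˢ (I.filter (g ∣ ·))).card : ℕ) := by
    exact_mod_cast (by omega)
  rw [h2] at h7
  nlinarith

lemma SL2_det (g : SL(2, ℤ)) : g 0 0 * g 1 1 - g 0 1 * g 1 0 = 1 := by
  have := g.det_coe
  rwa [Matrix.det_fin_two] at this

/-- A matrix of determinant one with bottom row in `(k, 2 * k]²` and reduced top row. -/
structure IsBlock (k : ℕ) (g : SL(2, ℤ)) : Prop where
  b_nonneg : 0 ≤ g 0 1
  b_lt : g 0 1 < g 1 1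
  a_pos : 0 < g 0 0
  a_le : g 0 0 ≤ g 1 0
  lt_c : (k : ℤ) < g 1 0
  c_le : g 1 0 ≤ 2 * k
  lt_d : (k : ℤ) < g 1 1
  d_le : g 1 1 ≤ 2 * k

lemma exists_isBlock {k : ℕ} {x : ℕ × ℕ} (hx : x ∈ coprimePairs k) :
    ∃ g : SL(2, ℤ), IsBlock k g ∧ g 1 0 = x.1 ∧ g 1 1 = x.2 := by
  obtain ⟨c, d⟩ := x
  simp only [coprimePairs, Finset.mem_filter, Finset.mem_product, Finset.mem_Ioc] at hx
  obtain ⟨⟨⟨hc1, hc2⟩, hd1, hd2⟩, hcop⟩ := hx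
  obtain ⟨u, v, huv⟩ := Nat.isCoprime_iff_coprime.mpr hcop
  have hd0 : (0 : ℤ) < d := by omega
  set b := (-u) % (d : ℤ) with hb
  have hb0 : 0 ≤ b := Int.emod_nonneg _ hd0.ne'
  have hb1 : b < d := Int.emod_lt_of_pos _ hd0
  have hbq : b = -u - d * ((-u) / d) := by have := Int.emod_add_mul_ediv (-u) d; linarith
  set a := v - c * ((-u) / d) with ha
  have hdet : a * d - b * c = 1 := by rw [hbq, ha]; linarith
  have hc0 : (0 : ℤ) < c := by omega
  refine ⟨⟨!![a, b; c, d], by rw [Matrix.det_fin_two_of]; exact hdet⟩, ?_, by simp, by simp⟩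
  have ha0 : 0 < a := by
    by_contra h
    nlinarith [mul_nonneg hb0 hc0.le]
  have hac : a ≤ c := by
    by_contra h
    nlinarith
  constructor <;> simp <;> omega

lemma exists_blocks (k : ℕ) : ∃ Ω : Finset SL(2, ℤ), (∀ g ∈ Ω, IsBlock k g) ∧
    Ω.card = (coprimePairs k).card := by
  classical
  choose! f hf using fun (x : ℕ × ℕ) (hx : x ∈ coprimePairs k) => exists_isBlock hx
  refine ⟨(coprimePairs k).image f, ?_, Finset.card_image_of_injOn ?_⟩
  · intro g hg
    obtain ⟨x, hx, rfl⟩ := Finset.mem_image.mp hg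
    exact (hf x hx).1
  · intro x hx y hy hxy
    have h1 := (hf x hx).2
    have h2 := (hf y hy).2
    rw [hxy] at h1
    ext
    · exact_mod_cast h1.1.symm.trans h2.1
    · exact_mod_cast h1.2.symm.trans h2.2

lemma eq_and_eq_of_mul_eq {a b c d : ℤ} (hab : IsCoprime a b) (hcd : IsCoprime c d) (hb : 0 < b)
    (hd : 0 < d) (h : a * d = c * b) : a = c ∧ b = d := by
  have h1 : b ∣ d := hab.symm.dvd_of_dvd_mul_left ⟨c, by rw [h]; ring⟩
  have h2 : d ∣ b := hcd.symm.dvd_of_dvd_mul_left ⟨a, by rw [← h]; ring⟩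
  have h3 : b = d := Int.dvd_antisymm hb.le hd.le h1 h2
  subst h3
  exact ⟨mul_right_cancel₀ hb.ne' h, rfl⟩

lemma isCoprime_right_column (g : SL(2, ℤ)) : IsCoprime (g 0 1) (g 1 1) :=
  ⟨-g 1 0, g 0 0, by linarith [SL2_det g]⟩

lemma isCoprime_bottom_row (g : SL(2, ℤ)) : IsCoprime (g 1 0) (g 1 1) :=
  ⟨-g 0 1, g 0 0, by linarith [SL2_det g]⟩

lemma SL2_ext {g h : SL(2, ℤ)} (h00 : g 0 0 = h 0 0) (h01 : g 0 1 = h 0 1) (h10 : g 1 0 = h 1 0)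
    (h11 : g 1 1 = h 1 1) : g = h := by
  ext i j
  fin_cases i <;> fin_cases j <;> assumption

lemma IsBlock.eq_of_le {k : ℕ} {g h : SL(2, ℤ)} (hg : IsBlock k g) (hh : IsBlock k h) {x y : ℤ}
    (hy : 0 < y) (hle : g 0 1 * h 1 1 ≤ h 0 1 * g 1 1) (h1 : h 0 1 * y < x * h 1 1)
    (h2 : x * g 1 0 < g 0 0 * y) : g = h := by
  have dg := SL2_det g
  have dh := SL2_det h
  have := hg.lt_c
  have := hg.lt_d
  have := hg.c_le
  have := hg.d_le
  have := hh.lt_d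
  have := hh.d_le
  have := hh.lt_c
  have := hh.c_le
  have h3 : h 0 1 * g 1 0 < g 0 0 * h 1 1 := by
    have hc : 0 < g 1 0 := by omega
    have hd : 0 < h 1 1 := by omega
    have e1 := mul_lt_mul_of_pos_right h1 hc
    have e2 := mul_lt_mul_of_pos_right h2 hd
    have : y * (h 0 1 * g 1 0) < y * (g 0 0 * h 1 1) := by linarith
    exact lt_of_mul_lt_mul_left this hy.le
  rcases hle.eq_or_lt with heq | hlt
  · obtain ⟨e1, e2⟩ := eq_and_eq_of_mul_eq (isCoprime_right_column g) (isCoprime_right_column h)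
      (by omega) (by omega) heq
    rw [← e1, ← e2] at dh
    have hdvd : g 1 1 ∣ g 1 0 - h 1 0 := by
      refine (isCoprime_right_column g).symm.dvd_of_dvd_mul_left (y := g 0 1) ⟨g 0 0 - h 0 0, ?_⟩
      linarith
    have e3 : g 1 0 - h 1 0 = 0 := by
      refine Int.eq_zero_of_abs_lt_dvd hdvd ?_
      rw [abs_lt]; constructor <;> omega
    have e4 : g 0 0 * g 1 1 = h 0 0 * g 1 1 := by
      have : g 1 0 = h 1 0 := by omega
      rw [← this] at dh; linarith
    exact SL2_ext (mul_right_cancel₀ (by omega) e4) e1 (by omega) e2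
  · exfalso
    have e : h 1 1 = g 1 1 * (g 0 0 * h 1 1 - h 0 1 * g 1 0) +
        g 1 0 * (h 0 1 * g 1 1 - g 0 1 * h 1 1) := by
      linear_combination (- h 1 1) * dg
    nlinarith

lemma IsBlock.eq_of_mul_column {k : ℕ} {g h : SL(2, ℤ)} (hg : IsBlock k g) (hh : IsBlock k h)
    {u v u' v' : ℤ} (hu : 0 < u) (hv : 0 < v) (hu' : 0 < u') (hv' : 0 < v')
    (h0 : g 0 0 * u + g 0 1 * v = h 0 0 * u' + h 0 1 * v')
    (h1 : g 1 0 * u + g 1 1 * v = h 1 0 * u' + h 1 1 * v') : g = h := by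
  have dg := SL2_det g
  have dh := SL2_det h
  have cg := hg.lt_c
  have ch := hh.lt_c
  have eg := hg.lt_d
  have eh := hh.lt_d
  have hy : 0 < g 1 0 * u + g 1 1 * v := by
    have := mul_pos (show 0 < g 1 0 by omega) hu
    have := mul_pos (show 0 < g 1 1 by omega) hv
    linarith
  have ag : g 0 1 * (g 1 0 * u + g 1 1 * v) < (g 0 0 * u + g 0 1 * v) * g 1 1 := by
    nlinarith
  have ah : h 0 1 * (h 1 0 * u' + h 1 1 * v') < (h 0 0 * u' + h 0 1 * v') * h 1 1 := by
    nlinarith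
  have bg : (g 0 0 * u + g 0 1 * v) * g 1 0 < g 0 0 * (g 1 0 * u + g 1 1 * v) := by
    nlinarith
  have bh : (h 0 0 * u' + h 0 1 * v') * h 1 0 < h 0 0 * (h 1 0 * u' + h 1 1 * v') := by
    nlinarith
  rcases le_total (g 0 1 * h 1 1) (h 0 1 * g 1 1) with h | h
  · exact hg.eq_of_le hh hy h (by rw [h0, h1]; exact ah) bg
  · exact (hh.eq_of_le hg (by rw [← h1]; exact hy) h (by rw [← h0, ← h1]; exact ag) bh).symm

/-! ## Words in the blocks -/

open Classical in
/-- The products of `n` elements of `Ω`, followed by the translation `T`. -/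
noncomputable def wordSet (Ω : Finset SL(2, ℤ)) : ℕ → Finset SL(2, ℤ)
  | 0 => {ModularGroup.T}
  | n + 1 => (Ω ×ˢ wordSet Ω n).image fun x => x.1 * x.2

/-- Size information on the entries of a word of length `n`. -/
structure IsWord (k n : ℕ) (g : SL(2, ℤ)) : Prop where
  a_nonneg : 0 ≤ g 0 0
  c_nonneg : 0 ≤ g 1 0
  b_pos : 0 < g 0 1
  b_le : g 0 1 ≤ g 1 1
  a_le : g 0 0 ≤ g 0 1
  c_le : g 1 0 ≤ g 1 1
  le_d : (k : ℤ) ^ n ≤ g 1 1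
  d_le : g 1 1 ≤ (4 * k : ℤ) ^ n

lemma IsWord.d_pos {k n : ℕ} {g : SL(2, ℤ)} (h : IsWord k n g) : 0 < g 1 1 :=
  h.b_pos.trans_le h.b_le

lemma isWord_T (k : ℕ) : IsWord k 0 ModularGroup.T := by
  constructor <;> simp [ModularGroup.T]

lemma IsBlock.mul_isWord {k n : ℕ} {w g : SL(2, ℤ)} (hw : IsBlock k w) (hg : IsWord k n g) :
    IsWord k (n + 1) (w * g) := by
  obtain ⟨w1, w2, w3, w4, w5, w6, w7, w8⟩ := hw
  have hd := hg.d_pos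
  obtain ⟨g1, g2, g3, g4, g5, g6, g7, g8⟩ := hg
  have hk : (0 : ℤ) ≤ k := by positivity
  constructor <;> simp only [SL2_mul_apply]
  · positivity
  · have : 0 ≤ w 1 0 := by omega
    have : 0 ≤ w 1 1 := by omega
    positivity
  · positivity
  · gcongr
  · gcongr
  · have : 0 ≤ w 1 0 := by omega
    have : 0 ≤ w 1 1 := by omega
    gcongr
  · have : 0 ≤ w 1 0 := by omega
    have h1 : 0 ≤ w 1 0 * g 0 1 := by positivity
    have h2 : (k : ℤ) * k ^ n ≤ w 1 1 * g 1 1 := mul_le_mul w7.le g7 (by positivity) (by omega)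
    rw [pow_succ]; linarith
  · have h1 : w 1 0 * g 0 1 ≤ 2 * k * g 1 1 := mul_le_mul w6 g4 g3.le (by positivity)
    have h2 : w 1 1 * g 1 1 ≤ 2 * k * g 1 1 := mul_le_mul w8 le_rfl hd.le (by positivity)
    have h3 : (4 * k : ℤ) * g 1 1 ≤ 4 * k * (4 * k) ^ n := by gcongr
    rw [pow_succ]; linarith

section Words

variable {k L : ℕ} {Ω : Finset SL(2, ℤ)}

lemma isWord_of_mem_wordSet (hΩ : ∀ g ∈ Ω, IsBlock k g) {n : ℕ} :
    ∀ g ∈ wordSet Ω n, IsWord k n g := by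
  induction n with
  | zero => intro g hg; rw [wordSet, Finset.mem_singleton] at hg; rw [hg]; exact isWord_T k
  | succ n ih =>
    intro g hg
    rw [wordSet, Finset.mem_image] at hg
    obtain ⟨⟨w, h⟩, hx, rfl⟩ := hg
    obtain ⟨h1, h2⟩ := Finset.mem_product.mp hx
    exact (hΩ w h1).mul_isWord (ih h h2)

lemma isShort_of_mem_wordSet (hΩ : ∀ g ∈ Ω, IsShort L g) {n : ℕ} :
    ∀ g ∈ wordSet Ω n, IsShort (n * L + 1) g := by
  induction n with
  | zero =>
    intro g hg
    rw [wordSet, Finset.mem_singleton] at hg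
    rw [hg]; simpa using isShort_T
  | succ n ih =>
    intro g hg
    rw [wordSet, Finset.mem_image] at hg
    obtain ⟨⟨w, h⟩, hx, rfl⟩ := hg
    obtain ⟨h1, h2⟩ := Finset.mem_product.mp hx
    exact ((hΩ w h1).mul (ih h h2)).mono (by ring_nf; omega)

lemma block_and_word_eq (hΩ : ∀ g ∈ Ω, IsBlock k g) {n : ℕ} {w w' g g' : SL(2, ℤ)} (hw : w ∈ Ω)
    (hw' : w' ∈ Ω) (hg : g ∈ wordSet Ω n) (hg' : g' ∈ wordSet Ω n)
    (h0 : (w * g) 0 1 = (w' * g') 0 1) (h1 : (w * g) 1 1 = (w' * g') 1 1) :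
    w = w' ∧ g 0 1 = g' 0 1 ∧ g 1 1 = g' 1 1 := by
  have k1 := isWord_of_mem_wordSet hΩ g hg
  have k2 := isWord_of_mem_wordSet hΩ g' hg'
  rw [SL2_mul_apply, SL2_mul_apply] at h0 h1
  have hww : w = w' := (hΩ w hw).eq_of_mul_column (hΩ w' hw') k1.b_pos k1.d_pos k2.b_pos k2.d_pos h0 h1
  subst hww
  have dw := SL2_det w
  refine ⟨rfl, ?_, ?_⟩
  · linear_combination w 1 1 * h0 - w 0 1 * h1 - (g 0 1 - g' 0 1) * dw
  · linear_combination w 0 0 * h1 - w 1 0 * h0 - (g 1 1 - g' 1 1) * dw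

lemma eq_of_right_column_eq (hΩ : ∀ g ∈ Ω, IsBlock k g) {n : ℕ} : ∀ g ∈ wordSet Ω n,
    ∀ h ∈ wordSet Ω n, g 0 1 = h 0 1 → g 1 1 = h 1 1 → g = h := by
  induction n with
  | zero =>
    intro g hg h hh _ _
    rw [wordSet, Finset.mem_singleton] at hg hh
    rw [hg, hh]
  | succ n ih =>
    intro g hg h hh h0 h1
    rw [wordSet, Finset.mem_image] at hg hh
    obtain ⟨⟨w, g⟩, hx, rfl⟩ := hg
    obtain ⟨⟨w', g'⟩, hx', rfl⟩ := hh
    obtain ⟨a1, a2⟩ := Finset.mem_product.mp hx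
    obtain ⟨b1, b2⟩ := Finset.mem_product.mp hx'
    obtain ⟨e1, e2, e3⟩ := block_and_word_eq hΩ a1 b1 a2 b2 h0 h1
    simp only at e1 e2 e3 ⊢
    rw [e1, ih g a2 g' b2 e2 e3]

lemma card_wordSet (hΩ : ∀ g ∈ Ω, IsBlock k g) (n : ℕ) : (wordSet Ω n).card = Ω.card ^ n := by
  induction n with
  | zero => simp [wordSet]
  | succ n ih =>
    rw [wordSet, Finset.card_image_of_injOn, Finset.card_product, ih, pow_succ, mul_comm]
    rintro ⟨w, g⟩ hx ⟨w', g'⟩ hx' h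
    obtain ⟨a1, a2⟩ := Finset.mem_product.mp hx
    obtain ⟨b1, b2⟩ := Finset.mem_product.mp hx'
    simp only at h
    obtain ⟨e1, e2, e3⟩ := block_and_word_eq hΩ a1 b1 a2 b2 (by rw [h]) (by rw [h])
    simp only at e1 e2 e3
    rw [e1, eq_of_right_column_eq hΩ g a2 g' b2 e2 e3]

end Words

lemma IsWord.eq_of_bottom_row_eq {k n : ℕ} {g h : SL(2, ℤ)} (hg : IsWord k n g)
    (hh : IsWord k n h) (h0 : g 1 0 = h 1 0) (h1 : g 1 1 = h 1 1) : g = h := by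
  have dg := SL2_det g
  have dh := SL2_det h
  have hd := hg.d_pos
  have b1 := hg.b_pos
  have b2 := hg.b_le
  have b3 := hh.b_pos
  have b4 := hh.b_le
  rw [← h0, ← h1] at dh
  have hdvd : g 1 1 ∣ g 0 1 - h 0 1 := by
    refine (isCoprime_bottom_row g).symm.dvd_of_dvd_mul_left (y := g 1 0) ⟨g 0 0 - h 0 0, ?_⟩
    linarith
  have e : g 0 1 - h 0 1 = 0 := by
    refine Int.eq_zero_of_abs_lt_dvd hdvd ?_
    rw [abs_lt]; constructor <;> omega
  have e' : g 0 1 = h 0 1 := by omega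
  refine SL2_ext (mul_right_cancel₀ hd.ne' ?_) e' h0 h1
  rw [← e'] at dh; linarith

/-- Few words have a given fraction close to the quotient of their bottom row. -/
lemma card_words_near_le {k n : ℕ} (F : Finset SL(2, ℤ)) (hF : ∀ g ∈ F, IsWord k n g) {a N : ℤ}
    (hN : 0 < N) (hnear : ∀ g ∈ F, |a * g 1 1 - N * g 1 0| ≤ (4 * k : ℤ) ^ n) :
    (F.card : ℝ) ≤ 2 * 4 ^ n * ((4 * k : ℝ) ^ n) ^ 2 / N + 2 := by
  set X : ℝ := (4 * k : ℝ) ^ n with hX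
  have hNr : (0 : ℝ) < N := by exact_mod_cast hN
  set δ : ℝ := 4 ^ n / N with hδ
  have hδ0 : 0 ≤ δ := by positivity
  have hmaps : ∀ g ∈ F, ⌊X ^ 2 * ((g 1 0 : ℝ) / g 1 1)⌋ ∈
      Finset.Icc ⌊X ^ 2 * ((a : ℝ) / N - δ)⌋ ⌊X ^ 2 * ((a : ℝ) / N + δ)⌋ := by
    intro g hg
    have hd : (0 : ℝ) < g 1 1 := by exact_mod_cast (hF g hg).d_pos
    have h1 : |(a : ℝ) * g 1 1 - N * g 1 0| ≤ X := by
      have := hnear g hg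
      rw [hX]
      exact_mod_cast this
    have hkd : (k : ℝ) ^ n ≤ g 1 1 := by exact_mod_cast (hF g hg).le_d
    have h2 : |(g 1 0 : ℝ) / g 1 1 - a / N| ≤ δ := by
      have e : (g 1 0 : ℝ) / g 1 1 - a / N = -((a : ℝ) * g 1 1 - N * g 1 0) / (g 1 1 * N) := by
        field_simp; ring
      rw [e, abs_div, abs_neg, abs_of_pos (by positivity : (0 : ℝ) < g 1 1 * N), hδ,
        div_le_div_iff₀ (by positivity) hNr]
      have : X ≤ 4 ^ n * g 1 1 := by rw [hX, mul_pow]; gcongr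
      calc _ ≤ X * N := by gcongr
        _ ≤ 4 ^ n * g 1 1 * N := by gcongr
        _ = _ := by ring
    rw [abs_le] at h2
    rw [Finset.mem_Icc]
    constructor
    · exact Int.floor_le_floor (mul_le_mul_of_nonneg_left (by linarith) (by positivity))
    · exact Int.floor_le_floor (mul_le_mul_of_nonneg_left (by linarith) (by positivity))
  have hinj : Set.InjOn (fun g : SL(2, ℤ) => ⌊X ^ 2 * ((g 1 0 : ℝ) / g 1 1)⌋) F := by
    intro g hg h hh hgh
    have kg := hF g hg
    have kh := hF h hh
    have hd : (0 : ℝ) < g 1 1 := by exact_mod_cast kg.d_pos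
    have hd' : (0 : ℝ) < h 1 1 := by exact_mod_cast kh.d_pos
    have hdX : (g 1 1 : ℝ) ≤ X := by rw [hX]; exact_mod_cast kg.d_le
    have hdX' : (h 1 1 : ℝ) ≤ X := by rw [hX]; exact_mod_cast kh.d_le
    have h1 := Int.abs_sub_lt_one_of_floor_eq_floor hgh
    have e : X ^ 2 * ((g 1 0 : ℝ) / g 1 1) - X ^ 2 * ((h 1 0 : ℝ) / h 1 1) =
        X ^ 2 * (((g 1 0 * h 1 1 - h 1 0 * g 1 1 : ℤ) : ℝ) / (g 1 1 * h 1 1)) := by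
      push_cast; field_simp
    rw [e, abs_mul, abs_div, abs_of_nonneg (by positivity : (0 : ℝ) ≤ X ^ 2),
      abs_of_pos (by positivity : (0 : ℝ) < g 1 1 * h 1 1), ← mul_div_assoc,
      div_lt_one (by positivity)] at h1
    have h2 : (g 1 1 * h 1 1 : ℝ) ≤ X ^ 2 := by rw [sq]; gcongr
    have h3 : |((g 1 0 * h 1 1 - h 1 0 * g 1 1 : ℤ) : ℝ)| < 1 := by
      by_contra hcon
      push Not at hcon
      nlinarith [mul_pos hd hd']
    have h4 : g 1 0 * h 1 1 - h 1 0 * g 1 1 = 0 := by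
      rw [← Int.abs_lt_one_iff]; exact_mod_cast h3
    obtain ⟨e1, e2⟩ := eq_and_eq_of_mul_eq (isCoprime_bottom_row g) (isCoprime_bottom_row h)
      kg.d_pos kh.d_pos (by linarith)
    exact kg.eq_of_bottom_row_eq kh e1 e2
  have hcard := Finset.card_le_card_of_injOn _ hmaps hinj
  rw [Int.card_Icc] at hcard
  have hfl : ⌊X ^ 2 * ((a : ℝ) / N - δ)⌋ ≤ ⌊X ^ 2 * ((a : ℝ) / N + δ)⌋ :=
    Int.floor_le_floor (mul_le_mul_of_nonneg_left (by linarith) (by positivity))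
  have h5 : (F.card : ℤ) ≤ ⌊X ^ 2 * ((a : ℝ) / N + δ)⌋ + 1 - ⌊X ^ 2 * ((a : ℝ) / N - δ)⌋ := by
    omega
  have h6 : (F.card : ℝ) ≤ ⌊X ^ 2 * ((a : ℝ) / N + δ)⌋ + 1 - ⌊X ^ 2 * ((a : ℝ) / N - δ)⌋ := by
    exact_mod_cast h5
  have h7 := Int.floor_le (X ^ 2 * ((a : ℝ) / N + δ))
  have h8 := Int.lt_floor_add_one (X ^ 2 * ((a : ℝ) / N - δ))
  have h9 : 2 * 4 ^ n * X ^ 2 / N = 2 * (X ^ 2 * δ) := by rw [hδ]; ring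
  rw [h9]
  linarith

/-! ## A dense set of cheap numerators with a common denominator -/

open Classical in
/-- The point of the projective line over `ZMod Q` given by the right column. -/
noncomputable def projClass (p Q : ℕ) (g : SL(2, ℤ)) : ZMod Q ⊕ ZMod Q :=
  if (p : ℤ) ∣ g 1 1 then .inr ((g 1 1 : ZMod Q) * (g 0 1 : ZMod Q)⁻¹)
  else .inl ((g 0 1 : ZMod Q) * (g 1 1 : ZMod Q)⁻¹)

lemma isUnit_intCast_of_not_dvd {p κ : ℕ} (hp : p.Prime) {x : ℤ} (hx : ¬ (p : ℤ) ∣ x) :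
    IsUnit (x : ZMod (p ^ κ)) := by
  have h : IsCoprime ((p : ℤ) ^ κ) x :=
    ((Nat.prime_iff_prime_int.mp hp).irreducible.coprime_iff_not_dvd.mpr hx).pow_left
  obtain ⟨u, v, huv⟩ := h
  have := congrArg (Int.cast : ℤ → ZMod (p ^ κ)) huv
  push_cast at this
  have hz : (p : ZMod (p ^ κ)) ^ κ = 0 := by
    rw [← Nat.cast_pow]; exact ZMod.natCast_self _
  rw [hz, mul_zero, zero_add] at this
  exact IsUnit.of_mul_eq_one_right _ this

lemma dvd_of_projClass_eq {p κ : ℕ} (hp : p.Prime) {g h : SL(2, ℤ)}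
    (hgh : projClass p (p ^ κ) g = projClass p (p ^ κ) h) :
    ((p ^ κ : ℕ) : ℤ) ∣ g 1 1 * h 0 1 - g 0 1 * h 1 1 := by
  rw [← ZMod.intCast_zmod_eq_zero_iff_dvd]
  push_cast
  have key : ∀ {x y z w : ZMod (p ^ κ)}, IsUnit y → IsUnit w → x * y⁻¹ = z * w⁻¹ →
      x * w = z * y := by
    intro x y z w hy hw h
    have e1 := ZMod.mul_inv_of_unit y hy
    have e2 := ZMod.mul_inv_of_unit w hw
    linear_combination (-x * w) * e1 + (y * w) * h + z * y * e2
  have hb : ∀ g : SL(2, ℤ), (p : ℤ) ∣ g 1 1 → IsUnit (g 0 1 : ZMod (p ^ κ)) := by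
    intro g hg
    refine isUnit_intCast_of_not_dvd hp fun h => ?_
    have := (isCoprime_right_column g).isUnit_of_dvd' h hg
    exact (Nat.prime_iff_prime_int.mp hp).not_isUnit this
  unfold projClass at hgh
  split_ifs at hgh with h1 h2 h2
  · have := key (hb g h1) (hb h h2) (Sum.inr.inj hgh)
    linear_combination this
  · have := key (isUnit_intCast_of_not_dvd hp h1) (isUnit_intCast_of_not_dvd hp h2)
      (Sum.inl.inj hgh)
    linear_combination -this

lemma exists_representatives {α γ : Type*} [Nonempty α] (V : Finset α) (χ : α → γ) :
    ∃ r : γ → α, ∀ x ∈ V, r (χ x) ∈ V ∧ χ (r (χ x)) = χ x := by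
  classical
  refine ⟨fun c => if h : ∃ y ∈ V, χ y = c then h.choose else Classical.arbitrary α, ?_⟩
  intro x hx
  have h : ∃ y ∈ V, χ y = χ x := ⟨x, hx, rfl⟩
  simp only [dif_pos h]
  exact h.choose_spec

lemma IsShort.isCheapNumerator {L : ℕ} {g h : SL(2, ℤ)} (hg : IsShort L g) (hh : IsShort L h) :
    IsCheapNumerator (1 + (L + L)) (g 1 1 * h 0 1 - g 0 1 * h 1 1)
        (g 1 1 * h 0 0 - g 0 1 * h 1 0) ∧
      IsCheapNumerator (1 + (L + L)) (-(g 1 1 * h 0 1 - g 0 1 * h 1 1))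
        (-(g 1 1 * h 0 0 - g 0 1 * h 1 0)) := by
  obtain ⟨i0, i1, i2, i3⟩ := SL2_inv_apply g
  obtain ⟨j0, j1, j2, j3⟩ := SL2_inv_apply ModularGroup.S
  constructor
  · refine ⟨ModularGroup.S * (g⁻¹ * h), isShort_S.mul (hg.inv.mul hh), ?_, ?_⟩
    · simp only [SL2_mul_apply, i0, i1, i2, i3]
      simp [ModularGroup.S]; ring
    · simp only [SL2_mul_apply, i0, i1, i2, i3]
      simp [ModularGroup.S]; ring
  · refine ⟨ModularGroup.S⁻¹ * (g⁻¹ * h), isShort_S.inv.mul (hg.inv.mul hh), ?_, ?_⟩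
    · simp only [SL2_mul_apply, i0, i1, i2, i3, j2, j3]
      simp [ModularGroup.S]; ring
    · simp only [SL2_mul_apply, i0, i1, i2, i3, j2, j3]
      simp [ModularGroup.S]; ring

set_option maxHeartbeats 1000000 in
lemma exists_cheap_of_words {k n l p κ : ℕ} (hp : p.Prime) (V : Finset SL(2, ℤ))
    (hV : ∀ g ∈ V, IsWord k n g) (hs : ∀ g ∈ V, IsShort l g)
    (hinj : ∀ g ∈ V, ∀ h ∈ V, g 0 1 = h 0 1 → g 1 1 = h 1 1 → g = h)
    (hcard : 4 * p ^ κ ≤ V.card) (h4 : (4 : ℤ) ^ n ≤ (p : ℤ) ^ κ) :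
    ∃ (N : ℤ) (A : Finset ℤ), 0 < N ∧ (p : ℤ) ^ κ ∣ N ∧ N ≤ ((4 * k : ℤ) ^ n) ^ 2 ∧
      (V.card : ℝ) * ((p : ℝ) ^ κ) ^ 2 ≤ 8 * 4 ^ n * (((4 * k : ℝ) ^ n) ^ 2) ^ 2 * A.card ∧
      ∀ a ∈ A, -N ≤ a ∧ a ≤ 2 * N ∧ IsCheapNumerator (1 + (l + l)) N a := by
  classical
  set Q := p ^ κ with hQ
  have hQ0 : 0 < Q := pow_pos hp.pos κ
  have : NeZero Q := ⟨hQ0.ne'⟩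
  obtain ⟨r, hr⟩ := exists_representatives V (projClass p Q)
  set V' := V.filter fun g => r (projClass p Q g) ≠ g with hV'
  have hV'sub : ∀ g ∈ V', g ∈ V := fun g hg => (Finset.mem_filter.mp hg).1
  have hreps : (V.filter fun g => r (projClass p Q g) = g).card ≤ 2 * Q := by
    calc _ ≤ (Finset.univ : Finset (ZMod Q ⊕ ZMod Q)).card := by
          refine Finset.card_le_card_of_injOn (projClass p Q) (by simp) ?_
          intro x hx y hy hxy
          rw [← (Finset.mem_filter.mp hx).2, ← (Finset.mem_filter.mp hy).2, hxy]
      _ = 2 * Q := by simp [Fintype.card_sum, ZMod.card]; ring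
  have hV'card : V.card ≤ 2 * V'.card := by
    have := Finset.card_filter_add_card_filter_not (s := V) (fun g => r (projClass p Q g) = g)
    have h2 : V'.card = (V.filter fun g => ¬ r (projClass p Q g) = g).card := rfl
    omega
  set m : SL(2, ℤ) → ℤ := fun g => (r (projClass p Q g)) 1 1 * g 0 1 -
    (r (projClass p Q g)) 0 1 * g 1 1 with hm
  set b : SL(2, ℤ) → ℤ := fun g => (r (projClass p Q g)) 1 1 * g 0 0 -
    (r (projClass p Q g)) 0 1 * g 1 0 with hb
  have hm0 : ∀ g ∈ V', m g ≠ 0 := by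
    intro g hg hmg
    obtain ⟨hgV, hne⟩ := Finset.mem_filter.mp hg
    obtain ⟨h1, h2⟩ := hr g hgV
    obtain ⟨e1, e2⟩ := eq_and_eq_of_mul_eq (isCoprime_right_column _) (isCoprime_right_column g)
      (hV _ h1).d_pos (hV g hgV).d_pos
      (show (r (projClass p Q g)) 0 1 * g 1 1 = g 0 1 * (r (projClass p Q g)) 1 1 by
        simp only [hm] at hmg; linarith)
    exact hne (hinj _ h1 g hgV e1 e2)
  set X : ℤ := (4 * k : ℤ) ^ n with hX
  have hmX : ∀ g ∈ V', |m g| ≤ X ^ 2 := by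
    intro g hg
    obtain ⟨hgV, hne⟩ := Finset.mem_filter.mp hg
    obtain ⟨h1, h2⟩ := hr g hgV
    have k1 := hV _ h1
    have k2 := hV g hgV
    have := k1.d_pos; have := k1.b_pos; have := k1.d_le
    have := k2.d_pos; have := k2.b_pos; have := k2.d_le
    have k1b := k1.b_le.trans k1.d_le
    have k2b := k2.b_le.trans k2.d_le
    rw [abs_le]
    have e1 : (r (projClass p Q g)) 1 1 * g 0 1 ≤ X * X := by gcongr
    have e2 : (r (projClass p Q g)) 0 1 * g 1 1 ≤ X * X := by gcongr
    have e3 : 0 ≤ (r (projClass p Q g)) 1 1 * g 0 1 := by positivity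
    have e4 : 0 ≤ (r (projClass p Q g)) 0 1 * g 1 1 := by positivity
    simp only [hm]
    constructor <;> linarith
  have hmQ : ∀ g ∈ V', (Q : ℤ) ∣ m g := fun g hg =>
    dvd_of_projClass_eq hp (hr g (hV'sub g hg)).2
  have hQz : (0 : ℤ) < Q := by exact_mod_cast hQ0
  set J : Finset ℤ := Finset.Icc 1 (X ^ 2 / Q) with hJ
  have hmaps : ∀ g ∈ V', |m g| / Q ∈ J := by
    intro g hg
    rw [hJ, Finset.mem_Icc]
    refine ⟨?_, Int.ediv_le_ediv hQz (hmX g hg)⟩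
    rw [Int.le_ediv_iff_mul_le hQz, one_mul]
    exact Int.le_of_dvd (abs_pos.mpr (hm0 g hg)) ((dvd_abs _ _).mpr (hmQ g hg))
  have hVpos : 0 < V'.card := by omega
  have hV'ne : V'.Nonempty := Finset.card_pos.mp hVpos
  have hJne : J.Nonempty := by
    obtain ⟨g, hg⟩ := hV'ne
    exact ⟨_, hmaps g hg⟩
  have hJ1 : 1 ≤ X ^ 2 / Q := by
    obtain ⟨j, hj⟩ := hJne
    rw [hJ, Finset.mem_Icc] at hj; omega
  have hJcard : (J.card : ℝ) ≤ (X : ℝ) ^ 2 / Q := by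
    have h1 : (J.card : ℤ) = X ^ 2 / Q := by rw [hJ, Int.card_Icc]; omega
    have h2 : ((X ^ 2 / Q : ℤ) : ℝ) * Q ≤ (X : ℝ) ^ 2 := by
      have h3 : X ^ 2 / (Q : ℤ) * Q ≤ X ^ 2 := Int.ediv_mul_le _ hQz.ne'
      exact_mod_cast h3
    rw [le_div_iff₀ (by exact_mod_cast hQ0)]
    have h3 : (J.card : ℝ) = ((X ^ 2 / Q : ℤ) : ℝ) := by exact_mod_cast h1
    rw [h3]; exact h2
  obtain ⟨j, hj, hfib⟩ := Finset.exists_le_card_fiber_of_nsmul_le_card_of_maps_to (b := (V'.card : ℝ) / J.card)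
    hmaps hJne (by
      have : (0 : ℝ) < J.card := by exact_mod_cast hJne.card_pos
      rw [nsmul_eq_mul]; field_simp; exact le_rfl)
  set F := V'.filter fun g => |m g| / Q = j with hF
  set N : ℤ := j * Q with hN
  have hj1 : 1 ≤ j := (Finset.mem_Icc.mp hj).1
  have hN0 : 0 < N := by positivity
  have hNF : ∀ g ∈ F, |m g| = N := by
    intro g hg
    obtain ⟨h1, h2⟩ := Finset.mem_filter.mp hg
    rw [hN, ← h2, Int.ediv_mul_cancel ((dvd_abs _ _).mpr (hmQ g h1))]
  set a : SL(2, ℤ) → ℤ := fun g => if 0 < m g then b g else -b g with ha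
  have hFV : ∀ g ∈ F, g ∈ V := fun g hg => hV'sub g (Finset.mem_filter.mp hg).1
  have hdet : ∀ g, b g * g 1 1 - m g * g 1 0 = (r (projClass p Q g)) 1 1 := by
    intro g
    simp only [hb, hm]
    linear_combination (r (projClass p Q g)) 1 1 * SL2_det g
  have hnear : ∀ g ∈ F, |a g * g 1 1 - N * g 1 0| ≤ X := by
    intro g hg
    have h1 := hNF g hg
    have k1 := hV _ (hr g (hFV g hg)).1
    have : 0 < (r (projClass p Q g)) 1 1 := k1.d_pos
    simp only [ha]
    rw [← h1]
    split_ifs with h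
    · rw [abs_of_pos h, hdet, abs_of_pos this]; exact k1.d_le
    · rw [abs_of_nonpos (not_lt.mp h),
        show -b g * g 1 1 - -m g * g 1 0 = -(b g * g 1 1 - m g * g 1 0) by ring, abs_neg, hdet,
        abs_of_pos this]
      exact k1.d_le
  have hNQ : (Q : ℤ) ≤ N := by rw [hN]; nlinarith
  have hQR : (0 : ℝ) < Q := by exact_mod_cast hQ0
  have hNR : (Q : ℝ) ≤ N := by exact_mod_cast hNQ
  have hXR : ((X : ℤ) : ℝ) = (4 * k : ℝ) ^ n := by rw [hX]; push_cast; rfl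
  have hXQ : (1 : ℝ) ≤ (X : ℝ) ^ 2 / Q := by
    refine le_trans ?_ hJcard
    exact_mod_cast hJne.card_pos
  have hFcard : (F.card : ℝ) ≤ (4 * 4 ^ n * (X : ℝ) ^ 2 / Q) * (F.image a).card := by
    have h1 := Finset.card_eq_sum_card_image a F
    calc (F.card : ℝ) = ∑ x ∈ F.image a, ((F.filter fun g => a g = x).card : ℝ) := by
          exact_mod_cast h1
      _ ≤ ∑ x ∈ F.image a, 4 * 4 ^ n * (X : ℝ) ^ 2 / Q := by
          refine Finset.sum_le_sum fun x hx => ?_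
          have h2 := card_words_near_le (k := k) (n := n) (F.filter fun g => a g = x)
            (fun g hg => hV g (hFV g (Finset.mem_filter.mp hg).1)) (a := x) hN0 (by
              intro g hg
              obtain ⟨h3, h4⟩ := Finset.mem_filter.mp hg
              rw [← h4]; exact hnear g h3)
          rw [← hXR] at h2
          refine h2.trans ?_
          have h4n : (1 : ℝ) ≤ 4 ^ n := one_le_pow₀ (by norm_num)
          have e1 : 2 * 4 ^ n * (X : ℝ) ^ 2 / N ≤ 2 * 4 ^ n * (X : ℝ) ^ 2 / Q := by gcongr
          have e2 : 4 * 4 ^ n * (X : ℝ) ^ 2 / Q = 2 * 4 ^ n * (X : ℝ) ^ 2 / Q +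
            2 * (4 ^ n * ((X : ℝ) ^ 2 / Q)) := by ring
          have e3 : 1 ≤ 4 ^ n * ((X : ℝ) ^ 2 / Q) := one_le_mul_of_one_le_of_one_le h4n hXQ
          rw [e2]; linarith
      _ = _ := by rw [Finset.sum_const, nsmul_eq_mul, mul_comm]
  refine ⟨N, F.image a, hN0, ?_, ?_, ?_, ?_⟩
  · rw [hN]; exact ⟨j, by rw [hQ]; push_cast; ring⟩
  · rw [hN]
    have := (Finset.mem_Icc.mp hj).2
    calc j * (Q : ℤ) ≤ X ^ 2 / Q * Q := by gcongr
      _ ≤ _ := Int.ediv_mul_le _ hQz.ne'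
  · have hJ0 : (0 : ℝ) < J.card := by exact_mod_cast hJne.card_pos
    rw [div_le_iff₀ hJ0] at hfib
    have h5 : (V.card : ℝ) ≤ 2 * V'.card := by exact_mod_cast hV'card
    rw [← hXR]
    have hQc : ((p : ℝ) ^ κ) = Q := by rw [hQ]; push_cast; rfl
    rw [hQc]
    have h6 : (V'.card : ℝ) ≤ (4 * 4 ^ n * (X : ℝ) ^ 2 / Q) * (F.image a).card * ((X : ℝ) ^ 2 / Q) := by
      calc (V'.card : ℝ) ≤ F.card * J.card := hfib
        _ ≤ _ := by gcongr
    have h7 : ∀ x y z : ℝ, (4 * z * x / Q) * y * (x / Q) * (Q : ℝ) ^ 2 = 4 * z * x ^ 2 * y := by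
      intro x y z; field_simp
    calc (V.card : ℝ) * (Q : ℝ) ^ 2 ≤ 2 * V'.card * (Q : ℝ) ^ 2 := by gcongr
      _ ≤ 2 * ((4 * 4 ^ n * (X : ℝ) ^ 2 / Q) * (F.image a).card * ((X : ℝ) ^ 2 / Q)) * (Q : ℝ) ^ 2 := by
          gcongr
      _ = _ := by rw [mul_assoc, h7]; ring
  · intro x hx
    obtain ⟨g, hg, rfl⟩ := Finset.mem_image.mp hx
    have h1 := hnear g hg
    have kg := hV g (hFV g hg)
    have hXd : X ≤ N * g 1 1 := by
      calc X = 4 ^ n * (k : ℤ) ^ n := by rw [hX, mul_pow]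
        _ ≤ N * g 1 1 := by
          refine mul_le_mul (h4.trans ?_) kg.le_d (by positivity) hN0.le
          rw [hQ] at hNQ; push_cast at hNQ; exact hNQ
    have hd := kg.d_pos
    have hc0 := kg.c_nonneg
    have hcd := kg.c_le
    rw [abs_le] at h1
    refine ⟨?_, ?_, ?_⟩
    · have e : 0 ≤ N * g 1 0 := by positivity
      by_contra hcon
      nlinarith
    · have e : N * g 1 0 ≤ N * g 1 1 := by gcongr
      by_contra hcon
      nlinarith
    · obtain ⟨c1, c2⟩ := (hs _ (hr g (hFV g hg)).1).isCheapNumerator (hs g (hFV g hg))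
      have h2 := hNF g hg
      simp only [ha]
      split_ifs with h
      · rw [abs_of_pos h] at h2
        rw [← h2]; exact c1
      · rw [abs_of_nonpos (not_lt.mp h)] at h2
        rw [← h2]; exact c2

lemma exists_isShort_of_finset (Ω : Finset SL(2, ℤ)) : ∃ L, ∀ g ∈ Ω, IsShort L g := by
  choose f hf using exists_isShort
  exact ⟨Ω.sup f, fun g hg => (hf g).mono (Finset.le_sup hg)⟩

theorem exists_dense_cheap_numerators (t : ℕ) : ∃ C : ℝ, 1 ≤ C ∧ ∀ p κ : ℕ, p.Prime → 16 ≤ p ^ κ →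
    ∃ (G : ℝ) (N : ℤ) (L : ℕ) (A : Finset ℤ), 1 ≤ G ∧ G ^ t ≤ 4 * (p : ℝ) ^ κ ∧ 0 < N ∧
      (p : ℤ) ^ κ ∣ N ∧ (N : ℝ) ≤ C * G * (p : ℝ) ^ κ ∧ (p : ℝ) ^ κ ≤ C * G * A.card ∧
      (L : ℝ) ≤ C * (Real.log ((p : ℝ) ^ κ) + 1) ∧
      ∀ a ∈ A, -N ≤ a ∧ a ≤ 2 * N ∧ IsCheapNumerator L N a := by
  set k : ℕ := 8 * 65536 ^ (t + 1) with hk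
  have hk1 : 8 * 65536 ≤ k := by
    rw [hk, pow_succ]
    have : 1 ≤ 65536 ^ t := Nat.one_le_pow _ _ (by norm_num)
    omega
  obtain ⟨Ω, hΩ, hΩc⟩ := exists_blocks k
  obtain ⟨l, hl⟩ := exists_isShort_of_finset Ω
  set w : ℝ := (Ω.card : ℝ) with hw
  have hkw : (k : ℝ) ^ 2 / 8 ≤ w := by
    rw [hw, hΩc]; exact card_coprimePairs_ge (by omega)
  have hkR : (8 * 65536 : ℝ) ≤ k := by exact_mod_cast hk1
  have hwt : (65536 : ℝ) ^ (t + 1) ≤ w := by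
    have : (k : ℝ) = 8 * 65536 ^ (t + 1) := by rw [hk]; push_cast; rfl
    nlinarith
  have hw1 : (65536 : ℝ) ≤ w := by nlinarith
  have hwt' : (65536 : ℝ) ^ t ≤ w :=
    (pow_le_pow_right₀ (by norm_num) (Nat.le_succ t)).trans hwt
  refine ⟨32 * 65536 * w + 3 + 6 * l, by have : (0 : ℝ) ≤ l := by positivity
                                         linarith, ?_⟩
  intro p κ hp hQ16
  set Q : ℝ := (p : ℝ) ^ κ with hQ
  have hQ16' : (16 : ℝ) ≤ Q := by rw [hQ]; exact_mod_cast hQ16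
  have hex : ∃ n, 4 * Q ≤ w ^ n := by
    obtain ⟨n, hn⟩ := pow_unbounded_of_one_lt (4 * Q) (by linarith : (1 : ℝ) < w)
    exact ⟨n, hn.le⟩
  classical
  obtain ⟨n, hn, hmin⟩ : ∃ n, 4 * Q ≤ w ^ (n + 1) ∧ w ^ n < 4 * Q := by
    have h0 := Nat.find_spec hex
    have h1 : Nat.find hex ≠ 0 := by
      intro h; rw [h, pow_zero] at h0; linarith
    obtain ⟨n, hn⟩ := Nat.exists_eq_succ_of_ne_zero h1
    refine ⟨n, by rw [← Nat.succ_eq_add_one, ← hn]; exact h0, ?_⟩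
    have := Nat.find_min hex (m := n) (by omega)
    linarith
  set V := wordSet Ω (n + 1) with hV
  have hVc : (V.card : ℝ) = w ^ (n + 1) := by
    rw [hV, card_wordSet hΩ, hw]; push_cast; rfl
  have h4 : (4 : ℝ) ^ (n + 1) ≤ Q := by
    have h1 : (4 : ℝ) ^ n * 16 ^ n ≤ w ^ n := by
      rw [← mul_pow]; exact pow_le_pow_left₀ (by norm_num) (by linarith) n
    rcases Nat.eq_zero_or_pos n with h | h
    · rw [h]; norm_num; linarith
    · have h2 : (16 : ℝ) ≤ 16 ^ n := le_self_pow₀ (by norm_num) (by omega)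
      have h3 : (0 : ℝ) < 4 ^ n := by positivity
      rw [pow_succ]
      nlinarith
  obtain ⟨N, A, hN0, hNQ, hNX, hA, hA'⟩ := exists_cheap_of_words (l := (n + 1) * l + 1) hp V
    (isWord_of_mem_wordSet hΩ) (isShort_of_mem_wordSet hl) (eq_of_right_column_eq hΩ)
    (by
      have : (4 * Q : ℝ) ≤ V.card := by rw [hVc]; exact hn
      rw [hQ] at this; exact_mod_cast this)
    (by rw [hQ] at h4; exact_mod_cast h4)
  have hG : (1 : ℝ) ≤ 65536 ^ n := one_le_pow₀ (by norm_num)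
  have hl0 : (0 : ℝ) ≤ l := by positivity
  have hX2 : ((4 * k : ℝ) ^ (n + 1)) ^ 2 ≤ 128 ^ (n + 1) * w ^ (n + 1) := by
    rw [← pow_mul, mul_comm (n + 1) 2, pow_mul, ← mul_pow]
    exact pow_le_pow_left₀ (by positivity) (by nlinarith) _
  have hwn : w ^ (n + 1) ≤ w * (4 * Q) := by
    rw [pow_succ, mul_comm]; gcongr
  refine ⟨65536 ^ n, N, _, A, hG, ?_, hN0, hNQ, ?_, ?_, ?_, hA'⟩
  · calc ((65536 : ℝ) ^ n) ^ t = (65536 ^ t) ^ n := by rw [← pow_mul, mul_comm, pow_mul]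
      _ ≤ w ^ n := by gcongr
      _ ≤ 4 * Q := hmin.le
  · have h1 : (N : ℝ) ≤ ((4 * k : ℝ) ^ (n + 1)) ^ 2 := by exact_mod_cast hNX
    have h2 : (128 : ℝ) ^ n ≤ 65536 ^ n := by gcongr; norm_num
    calc (N : ℝ) ≤ 128 ^ (n + 1) * w ^ (n + 1) := h1.trans hX2
      _ ≤ 128 ^ (n + 1) * (w * (4 * Q)) := by gcongr
      _ = 512 * w * 128 ^ n * Q := by ring
      _ ≤ (32 * 65536 * w + 3 + 6 * l) * 65536 ^ n * Q := by
          gcongr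
          linarith
  · have hw0 : 0 < w ^ (n + 1) := by positivity
    have h1 : w ^ (n + 1) * Q ^ 2 ≤ w ^ (n + 1) * (8 * 65536 ^ (n + 1) * w ^ (n + 1) * A.card) := by
      calc w ^ (n + 1) * Q ^ 2 ≤ 8 * 4 ^ (n + 1) * (((4 * k : ℝ) ^ (n + 1)) ^ 2) ^ 2 * A.card := by
            rw [← hVc]; exact hA
        _ ≤ 8 * 4 ^ (n + 1) * (128 ^ (n + 1) * w ^ (n + 1)) ^ 2 * A.card := by gcongr
        _ = _ := by
          rw [show (65536 : ℝ) = 4 * 128 ^ 2 by norm_num, mul_pow (4 : ℝ), ← pow_mul (128 : ℝ),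
            mul_comm 2, pow_mul (128 : ℝ)]
          ring
    have h2 := le_of_mul_le_mul_left h1 hw0
    have h3 : Q * Q ≤ Q * (32 * 65536 * w * 65536 ^ n * A.card) := by
      calc Q * Q = Q ^ 2 := by ring
        _ ≤ 8 * 65536 ^ (n + 1) * w ^ (n + 1) * A.card := h2
        _ ≤ 8 * 65536 ^ (n + 1) * (w * (4 * Q)) * A.card := by gcongr
        _ = _ := by ring
    calc Q ≤ 32 * 65536 * w * 65536 ^ n * A.card := le_of_mul_le_mul_left h3 (by linarith)
      _ ≤ _ := by gcongr; linarith
  · have h1 : (n : ℝ) * Real.log 2 ≤ Real.log 4 + Real.log Q := by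
      rw [← Real.log_mul (by norm_num) (by linarith), ← Real.log_pow]
      refine Real.log_le_log (by positivity) ?_
      exact (pow_le_pow_left₀ (by norm_num) (by linarith) n).trans hmin.le
    have h2 : Real.log 4 = 2 * Real.log 2 := by
      rw [show (4 : ℝ) = 2 ^ 2 by norm_num, Real.log_pow]; norm_num
    have h3 := Real.log_two_gt_d9
    have hlq : 0 ≤ Real.log Q := Real.log_nonneg (by linarith)
    have h5 : (n : ℝ) ≤ 2 + 2 * Real.log Q := by
      rw [h2] at h1
      by_contra hcon
      push Not at hcon
      nlinarith
    have h6 : (l : ℝ) * n ≤ l * (2 + 2 * Real.log Q) := by gcongr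
    push_cast
    nlinarith [mul_nonneg hl0 hlq]

end ModularGroup

/-! ## Fourier analysis modulo `M` -/

section Fourier

open ZMod ComplexConjugate

variable {M : ℕ} [NeZero M]

lemma sum_stdAddChar_mul (b : ZMod M) :
    ∑ x : ZMod M, stdAddChar (x * b) = if b = 0 then (M : ℂ) else 0 := by
  rw [AddChar.sum_mulShift b (isPrimitive_stdAddChar M), ZMod.card]
  push_cast; rfl

lemma conj_stdAddChar (x : ZMod M) : conj (stdAddChar x) = stdAddChar (-x) :=
  (AddChar.map_neg_eq_conj _ _).symm

lemma norm_stdAddChar (x : ZMod M) : ‖stdAddChar x‖ = 1 := AddChar.norm_apply _ _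

lemma parseval_weighted {ι : Type*} (I : Finset ι) (c : ι → ℂ) (f : ι → ZMod M) :
    ∑ ξ : ZMod M, ((‖∑ i ∈ I, c i * stdAddChar (ξ * f i)‖ ^ 2 : ℝ) : ℂ) =
      M * ∑ x ∈ I ×ˢ I, if f x.1 = f x.2 then c x.1 * conj (c x.2) else 0 := by
  have h1 : ∀ ξ : ZMod M, ((‖∑ i ∈ I, c i * stdAddChar (ξ * f i)‖ ^ 2 : ℝ) : ℂ) =
      ∑ x ∈ I ×ˢ I, c x.1 * conj (c x.2) * stdAddChar (ξ * (f x.1 - f x.2)) := by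
    intro ξ
    push_cast
    rw [← Complex.mul_conj', map_sum, Finset.sum_mul_sum, Finset.sum_product]
    refine Finset.sum_congr rfl fun i _ => Finset.sum_congr rfl fun j _ => ?_
    rw [map_mul (starRingEnd ℂ), conj_stdAddChar, mul_sub, sub_eq_add_neg, AddChar.map_add_eq_mul]
    ring
  rw [Finset.sum_congr rfl fun ξ _ => h1 ξ, Finset.sum_comm, Finset.mul_sum]
  refine Finset.sum_congr rfl fun x _ => ?_
  rw [← Finset.mul_sum, sum_stdAddChar_mul]
  simp only [sub_eq_zero]
  split_ifs
  · ring
  · simp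

lemma parseval {ι : Type*} (I : Finset ι) (f : ι → ZMod M) :
    ∑ ξ : ZMod M, ‖∑ i ∈ I, stdAddChar (ξ * f i)‖ ^ 2 =
      M * (((I ×ˢ I).filter fun x => f x.1 = f x.2).card : ℝ) := by
  have := parseval_weighted I (fun _ => 1) f
  simp only [one_mul, map_one, mul_one, Finset.sum_ite, Finset.sum_const_zero, add_zero,
    Finset.sum_const, nsmul_eq_mul] at this
  exact_mod_cast this

lemma norm_sum_stdAddChar_sq {β : Type*} (B : Finset β) (u : β → ZMod M) (ξ : ZMod M) :
    ((‖∑ b ∈ B, stdAddChar (ξ * u b)‖ ^ 2 : ℝ) : ℂ) =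
      ∑ b ∈ B, ∑ b' ∈ B, stdAddChar (ξ * (u b - u b')) := by
  push_cast
  rw [← Complex.mul_conj', map_sum, Finset.sum_mul_sum]
  refine Finset.sum_congr rfl fun i _ => Finset.sum_congr rfl fun j _ => ?_
  rw [conj_stdAddChar, mul_sub, sub_eq_add_neg, AddChar.map_add_eq_mul]

/-- A criterion for a mixed additive equation to be solvable. -/
lemma exists_solution {ι κ α : Type*} (I : Finset ι) (K : Finset κ) (A : Finset α)
    (f : ι → ZMod M) (g : κ → ZMod M) (h : α → ZMod M) (τ : ZMod M) (Low : Set (ZMod M))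
    (h0 : (0 : ZMod M) ∈ Low) (hI : I.Nonempty) (hK : K.Nonempty)
    (hLow : ∀ ξ ∈ Low, ∀ i ∈ I, ξ * (f i - τ) = 0) {ε : ℝ} (hε0 : 0 ≤ ε)
    (hε : ∀ ξ ∉ Low, ‖∑ i ∈ I, stdAddChar (ξ * f i)‖ *
      ‖∑ k ∈ K, stdAddChar (ξ * g k)‖ ^ 2 ≤ ε * (I.card * (K.card : ℝ) ^ 2))
    (hlt : ε * (M * (((A ×ˢ A).filter fun x => h x.1 = h x.2).card : ℝ)) < (A.card : ℝ) ^ 2) :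
    ∃ i ∈ I, ∃ k ∈ K, ∃ k' ∈ K, ∃ a ∈ A, ∃ a' ∈ A,
      f i + g k - g k' + h a - h a' = τ := by
  classical
  by_contra hcon
  push Not at hcon
  set E : ZMod M → ℂ := fun ξ => ∑ i ∈ I, stdAddChar (ξ * (f i - τ)) with hE
  set F : ZMod M → ℝ := fun ξ => ‖∑ k ∈ K, stdAddChar (ξ * g k)‖ ^ 2 with hF
  set H : ZMod M → ℝ := fun ξ => ‖∑ a ∈ A, stdAddChar (ξ * h a)‖ ^ 2 with hH
  have hzero : ∑ ξ : ZMod M, E ξ * F ξ * H ξ = 0 := by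
    have h1 : ∀ ξ, E ξ * F ξ * H ξ = ∑ i ∈ I, ∑ k ∈ K, ∑ k' ∈ K, ∑ a ∈ A, ∑ a' ∈ A,
        stdAddChar (ξ * (f i + g k - g k' + h a - h a' - τ)) := by
      intro ξ
      simp only [hE, hF, hH]
      rw [norm_sum_stdAddChar_sq, norm_sum_stdAddChar_sq]
      rw [Finset.sum_mul, Finset.sum_mul]
      refine Finset.sum_congr rfl fun i _ => ?_
      rw [mul_assoc, Finset.sum_mul, Finset.mul_sum]
      refine Finset.sum_congr rfl fun k _ => ?_
      rw [Finset.sum_mul, Finset.mul_sum]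
      refine Finset.sum_congr rfl fun k' _ => ?_
      rw [Finset.mul_sum, Finset.mul_sum]
      refine Finset.sum_congr rfl fun a _ => ?_
      rw [Finset.mul_sum, Finset.mul_sum]
      refine Finset.sum_congr rfl fun a' _ => ?_
      rw [← AddChar.map_add_eq_mul, ← AddChar.map_add_eq_mul]
      congr 1; ring
    rw [Finset.sum_congr rfl fun ξ _ => h1 ξ, Finset.sum_comm]
    refine Finset.sum_eq_zero fun i hi => ?_
    rw [Finset.sum_comm]
    refine Finset.sum_eq_zero fun k hk => ?_
    rw [Finset.sum_comm]
    refine Finset.sum_eq_zero fun k' hk' => ?_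
    rw [Finset.sum_comm]
    refine Finset.sum_eq_zero fun a ha => ?_
    rw [Finset.sum_comm]
    refine Finset.sum_eq_zero fun a' ha' => ?_
    rw [sum_stdAddChar_mul, if_neg]
    rw [sub_eq_zero]
    exact hcon i hi k hk k' hk' a ha a' ha'
  have hI0 : (0 : ℝ) < I.card := by exact_mod_cast hI.card_pos
  have hK0 : (0 : ℝ) < K.card := by exact_mod_cast hK.card_pos
  have hElow : ∀ ξ ∈ Low, E ξ = I.card := by
    intro ξ hξ
    simp only [hE]
    rw [Finset.sum_congr rfl fun i hi => by rw [hLow ξ hξ i hi, AddChar.map_zero_eq_one]]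
    simp
  have hEnorm : ∀ ξ, ‖E ξ‖ = ‖∑ i ∈ I, stdAddChar (ξ * f i)‖ := by
    intro ξ
    have : E ξ = (∑ i ∈ I, stdAddChar (ξ * f i)) * stdAddChar (-(ξ * τ)) := by
      simp only [hE]
      rw [Finset.sum_mul]
      refine Finset.sum_congr rfl fun i _ => ?_
      rw [← AddChar.map_add_eq_mul]; congr 1; ring
    rw [this, norm_mul, norm_stdAddChar, mul_one]
  set c : ℝ := I.card * (K.card : ℝ) ^ 2 with hc
  have hc0 : 0 < c := by positivity
  have hF0 : F 0 = (K.card : ℝ) ^ 2 := by simp [hF]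
  have hH0 : H 0 = (A.card : ℝ) ^ 2 := by simp [hH]
  have hterm : ∀ ξ, (if ξ = 0 then c * (A.card : ℝ) ^ 2 else 0) - ε * c * H ξ ≤
      (E ξ * F ξ * H ξ).re := by
    intro ξ
    have hFn : 0 ≤ F ξ := by positivity
    have hHn : 0 ≤ H ξ := by positivity
    have hm : 0 ≤ ε * c * H ξ := by positivity
    by_cases hξ : ξ ∈ Low
    · have e1 : (E ξ * F ξ * H ξ).re = I.card * F ξ * H ξ := by
        rw [hElow ξ hξ]; norm_cast
      rw [e1]
      split_ifs with h
      · rw [h, hF0, hH0, ← hc]; rw [h, hH0] at hm; linarith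
      · have : 0 ≤ I.card * F ξ * H ξ := by positivity
        linarith
    · have hne : ξ ≠ 0 := fun h => hξ (h ▸ h0)
      rw [if_neg hne]
      have e1 := Complex.abs_re_le_norm (E ξ * F ξ * H ξ)
      have e2 : ‖E ξ * F ξ * H ξ‖ = ‖E ξ‖ * F ξ * H ξ := by
        rw [norm_mul, norm_mul, Complex.norm_real, Complex.norm_real, Real.norm_of_nonneg hFn,
          Real.norm_of_nonneg hHn]
      have e3 : ‖E ξ‖ * F ξ ≤ ε * c := by
        rw [hEnorm]
        exact hε ξ hξ
      have e4 : ‖E ξ‖ * F ξ * H ξ ≤ ε * c * H ξ := by gcongr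
      have := (abs_le.mp e1).1
      linarith
  have hsum := Finset.sum_le_sum fun ξ (_ : ξ ∈ Finset.univ) => hterm ξ
  rw [← Complex.re_sum, hzero, Finset.sum_sub_distrib, Finset.sum_ite_eq' Finset.univ,
    if_pos (Finset.mem_univ _), ← Finset.mul_sum, parseval] at hsum
  simp only [Complex.zero_re] at hsum
  have hA0 : 0 ≤ (M * (((A ×ˢ A).filter fun x => h x.1 = h x.2).card : ℝ)) := by positivity
  nlinarith

end Fourier

/-! ## Kloosterman sums to prime power moduli -/

section Kloosterman

open ZMod ComplexConjugate

variable {M : ℕ} [NeZero M]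

/-- The Kloosterman sum `∑ ψ(s u⁻¹ + h u)` over the units modulo `M`. -/
noncomputable def kloosterman (s h : ZMod M) : ℂ :=
  ∑ u : (ZMod M)ˣ, stdAddChar (s * (u⁻¹).val + h * u.val)

lemma kloosterman_scale (s h : ZMod M) (c : (ZMod M)ˣ) :
    kloosterman (s * c.val) (h * (c⁻¹).val) = kloosterman s h := by
  unfold kloosterman
  refine (Fintype.sum_equiv (Equiv.mulLeft c) _ _ fun u => ?_).symm
  congr 1
  simp only [Equiv.coe_mulLeft, mul_inv_rev, Units.val_mul]
  have h1 : (c : ZMod M) * (c⁻¹).val = 1 := Units.mul_inv c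
  linear_combination (-(s * (u⁻¹).val) - h * u.val) * h1

lemma parseval_two {ι : Type*} (I : Finset ι) (f g : ι → ZMod M) :
    ∑ s : ZMod M, ∑ h : ZMod M, ‖∑ i ∈ I, stdAddChar (s * g i + h * f i)‖ ^ 2 =
      (M : ℝ) ^ 2 * (((I ×ˢ I).filter fun x => f x.1 = f x.2 ∧ g x.1 = g x.2).card : ℝ) := by
  have h1 : ∀ s : ZMod M, ∑ h : ZMod M,
      ((‖∑ i ∈ I, stdAddChar (s * g i + h * f i)‖ ^ 2 : ℝ) : ℂ) =
      M * ∑ x ∈ I ×ˢ I, if f x.1 = f x.2 then stdAddChar (s * (g x.1 - g x.2)) else 0 := by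
    intro s
    have := parseval_weighted I (fun i => stdAddChar (s * g i)) f
    simp only [← AddChar.map_add_eq_mul, conj_stdAddChar] at this
    rw [this]
    congr 1
    refine Finset.sum_congr rfl fun x _ => ?_
    congr 2
    ring
  have h2 : ∑ s : ZMod M, ∑ h : ZMod M,
      ((‖∑ i ∈ I, stdAddChar (s * g i + h * f i)‖ ^ 2 : ℝ) : ℂ) =
      (M : ℂ) ^ 2 * (((I ×ˢ I).filter fun x => f x.1 = f x.2 ∧ g x.1 = g x.2).card : ℂ) := by
    rw [Finset.sum_congr rfl fun s _ => h1 s, ← Finset.mul_sum, Finset.sum_comm]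
    have h3 : ∀ x ∈ I ×ˢ I, (∑ s : ZMod M,
        if f x.1 = f x.2 then stdAddChar (s * (g x.1 - g x.2)) else 0) =
        if f x.1 = f x.2 ∧ g x.1 = g x.2 then (M : ℂ) else 0 := by
      intro x _
      by_cases hf : f x.1 = f x.2
      · simp only [hf, if_true, true_and, sum_stdAddChar_mul, sub_eq_zero]
      · simp [hf]
    rw [Finset.sum_congr rfl h3, Finset.sum_ite]
    simp only [Finset.sum_const, nsmul_eq_mul]
    ring
  exact_mod_cast h2

lemma kloosterman_sq (s h : ZMod M) : kloosterman s h ^ 2 =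
    ∑ x : (ZMod M)ˣ × (ZMod M)ˣ, stdAddChar (s * ((x.1⁻¹).val + (x.2⁻¹).val) +
      h * (x.1.val + x.2.val)) := by
  rw [sq]
  unfold kloosterman
  rw [Finset.sum_mul_sum, ← Finset.univ_product_univ, Finset.sum_product]
  refine Finset.sum_congr rfl fun i _ => Finset.sum_congr rfl fun j _ => ?_
  rw [← AddChar.map_add_eq_mul]
  congr 1
  ring

/-- The fourth moment of Kloosterman sums is controlled by the number of zeros of
`(x + y) (x - 1) (y - 1)`. -/
lemma kloosterman_fourth_moment_le (s h : ZMod M) (hs : IsUnit s) :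
    ‖kloosterman s h‖ ^ 4 ≤ (M : ℝ) ^ 2 * ((Finset.univ.filter fun z : ZMod M × ZMod M =>
      (z.1 + z.2) * (z.1 - 1) * (z.2 - 1) = 0).card : ℝ) := by
  classical
  set Z := Finset.univ.filter fun z : ZMod M × ZMod M => (z.1 + z.2) * (z.1 - 1) * (z.2 - 1) = 0
    with hZ
  set U := (ZMod M)ˣ
  set W := ((Finset.univ : Finset (U × U)) ×ˢ (Finset.univ : Finset (U × U))).filter fun x =>
      (x.1.1.val + x.1.2.val = x.2.1.val + x.2.2.val) ∧
      ((x.1.1⁻¹).val + (x.1.2⁻¹).val = (x.2.1⁻¹).val + (x.2.2⁻¹).val) with hW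
  have hmom : ∑ s : ZMod M, ∑ h : ZMod M, ‖kloosterman s h‖ ^ 4 = (M : ℝ) ^ 2 * (W.card : ℝ) := by
    have := parseval_two (Finset.univ : Finset (U × U)) (fun x => x.1.val + x.2.val)
      (fun x => (x.1⁻¹).val + (x.2⁻¹).val)
    rw [← hW] at this
    rw [← this]
    refine Finset.sum_congr rfl fun s _ => Finset.sum_congr rfl fun h _ => ?_
    rw [← kloosterman_sq, norm_pow, ← pow_mul]
  have hWcard : W.card ≤ Fintype.card U * Z.card := by
    rw [← Finset.card_univ, ← Finset.card_product]
    refine Finset.card_le_card_of_injOn (fun x => (x.2.2, (x.1.1.val * (x.2.2⁻¹).val : ZMod M),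
      (x.1.2.val * (x.2.2⁻¹).val : ZMod M))) ?_ ?_
    · rintro ⟨⟨x1, x2⟩, ⟨x3, x4⟩⟩ hx
      simp only [hW, Finset.coe_filter, Set.mem_ofPred_eq] at hx
      obtain ⟨-, h1, h2⟩ := hx
      simp only [Finset.coe_product, Set.mem_prod, Finset.coe_univ, Set.mem_univ, true_and, hZ,
        Finset.coe_filter, Finset.mem_univ, Set.mem_ofPred_eq]
      have i1 := Units.mul_inv x1
      have i2 := Units.mul_inv x2
      have i3 := Units.mul_inv x3
      have i4 := Units.mul_inv x4
      generalize ((x1⁻¹).val) = w1 at *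
      generalize (x2⁻¹).val = w2 at *
      generalize (x3⁻¹).val = w3 at *
      generalize (x4⁻¹).val = w4 at *
      generalize (x1 : ZMod M) = x1 at *
      generalize (x2 : ZMod M) = x2 at *
      generalize (x3 : ZMod M) = x3 at *
      generalize (x4 : ZMod M) = x4 at *
      have k1 : (x1 + x2) * (x3 * x4 - x1 * x2) = 0 := by
        have e1 : (w1 + w2) * (x1 * x2) = x1 + x2 := by
          linear_combination x2 * i1 + x1 * i2
        have e2 : (w3 + w4) * (x3 * x4) = x3 + x4 := by
          linear_combination x4 * i3 + x3 * i4
        have e3 : (x1 + x2) * (x3 * x4) = (w1 + w2) * (x1 * x2) * (x3 * x4) := by rw [e1]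
        have e4 : (x3 + x4) * (x1 * x2) = (w3 + w4) * (x3 * x4) * (x1 * x2) := by rw [e2]
        rw [h2] at e3
        rw [← h1] at e4
        linear_combination e3 - e4
      have k2 : (x1 + x2) * (x4 - x1) * (x4 - x2) = 0 := by
        have : x3 = x1 + x2 - x4 := by linear_combination -h1
        rw [this] at k1
        linear_combination -k1
      have : (x1 * w4 + x2 * w4) * (x1 * w4 - x4 * w4) * (x2 * w4 - x4 * w4) = 0 := by
        linear_combination w4 ^ 3 * k2
      rwa [i4] at this
    · rintro ⟨⟨x1, x2⟩, ⟨x3, x4⟩⟩ hx ⟨⟨y1, y2⟩, ⟨y3, y4⟩⟩ hy hxy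
      simp only [hW, Finset.coe_filter, Set.mem_ofPred_eq] at hx hy
      simp only [Prod.mk.injEq] at hxy
      obtain ⟨h4, h1, h2⟩ := hxy
      subst h4
      have h1' : x1 = y1 := by
        ext; exact (Units.mul_left_inj _).mp h1
      have h2' : x2 = y2 := by
        ext; exact (Units.mul_left_inj _).mp h2
      subst h1' h2'
      have h3 : x3 = y3 := by
        ext
        have := hx.2.1.symm.trans hy.2.1
        exact add_right_cancel this
      rw [h3]
  have hlow : (Fintype.card U : ℝ) * ‖kloosterman s h‖ ^ 4 ≤
      ∑ s : ZMod M, ∑ h : ZMod M, ‖kloosterman s h‖ ^ 4 := by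
    have e1 : (Fintype.card U : ℝ) * ‖kloosterman s h‖ ^ 4 =
        ∑ c : U, ‖kloosterman (s * c.val) (h * (c⁻¹).val)‖ ^ 4 := by
      simp_rw [U, kloosterman_scale]
      simp
    rw [e1, ← Fintype.sum_prod_type']
    have hinj : Function.Injective fun c : U => ((s * c.val : ZMod M), (h * (c⁻¹).val : ZMod M)) := by
      intro c c' hcc
      simp only [Prod.mk.injEq] at hcc
      ext
      exact hs.mul_left_cancel hcc.1
    have e2 : ∑ c : U, ‖kloosterman (s * c.val) (h * (c⁻¹).val)‖ ^ 4 =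
        ∑ z ∈ Finset.univ.map ⟨_, hinj⟩, ‖kloosterman z.1 z.2‖ ^ 4 := by
      rw [Finset.sum_map]; rfl
    rw [e2]
    exact Finset.sum_le_sum_of_subset_of_nonneg (Finset.subset_univ _) fun _ _ _ => by positivity
  have hU : (0 : ℝ) < Fintype.card U := by exact_mod_cast Fintype.card_pos
  have hWr : (W.card : ℝ) ≤ Fintype.card U * Z.card := by exact_mod_cast hWcard
  rw [hmom] at hlow
  have : (Fintype.card U : ℝ) * ‖kloosterman s h‖ ^ 4 ≤
      Fintype.card U * ((M : ℝ) ^ 2 * Z.card) := by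
    calc _ ≤ _ := hlow
      _ ≤ (M : ℝ) ^ 2 * (Fintype.card U * Z.card) := by gcongr
      _ = _ := by ring
  exact le_of_mul_le_mul_left this hU

lemma pow_dvd_of_dvd_mul_mul {p i t a b c : ℕ} (hp : p.Prime) (ht : 3 * t ≤ i + 2)
    (h : p ^ i ∣ a * b * c) : p ^ t ∣ a ∨ p ^ t ∣ b ∨ p ^ t ∣ c := by
  have := Fact.mk hp
  by_contra hcon
  push Not at hcon
  obtain ⟨h1, h2, h3⟩ := hcon
  have a0 : a ≠ 0 := fun h => h1 (h ▸ dvd_zero _)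
  have b0 : b ≠ 0 := fun h => h2 (h ▸ dvd_zero _)
  have c0 : c ≠ 0 := fun h => h3 (h ▸ dvd_zero _)
  rw [padicValNat_dvd_iff_le (by assumption)] at h1 h2 h3
  rw [padicValNat_dvd_iff_le (by positivity), padicValNat.mul (by positivity) (by positivity),
    padicValNat.mul a0 b0] at h
  omega

lemma card_multiples_le {p i t : ℕ} (hp : p.Prime) (hti : t ≤ i) [NeZero (p ^ i)] :
    (Finset.univ.filter fun z : ZMod (p ^ i) => p ^ t ∣ z.val).card ≤ p ^ (i - t) := by
  classical
  have hpt : 0 < p ^ t := pow_pos hp.pos _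
  have : (Finset.univ.filter fun z : ZMod (p ^ i) => p ^ t ∣ z.val) ⊆
      (Finset.range (p ^ (i - t))).image fun w => ((p ^ t * w : ℕ) : ZMod (p ^ i)) := by
    intro z hz
    obtain ⟨w, hw⟩ := (Finset.mem_filter.mp hz).2
    refine Finset.mem_image.mpr ⟨w, ?_, ?_⟩
    · rw [Finset.mem_range]
      have h1 := ZMod.val_lt z
      rw [hw, ← Nat.sub_add_cancel hti, pow_add, mul_comm] at h1
      simpa using lt_of_mul_lt_mul_right h1 hpt.le
    · rw [← hw, ZMod.natCast_zmod_val]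
  calc _ ≤ _ := Finset.card_le_card this
    _ ≤ _ := Finset.card_image_le
    _ = _ := Finset.card_range _

lemma card_zeros_mul_le {p i t : ℕ} (hp : p.Prime) (ht : 3 * t ≤ i + 2) (hti : t ≤ i)
    [NeZero (p ^ i)] :
    (Finset.univ.filter fun z : ZMod (p ^ i) × ZMod (p ^ i) =>
      (z.1 + z.2) * (z.1 - 1) * (z.2 - 1) = 0).card * p ^ t ≤ 3 * (p ^ i) ^ 2 := by
  classical
  set T := Finset.univ.filter fun z : ZMod (p ^ i) => p ^ t ∣ z.val with hT
  set P := (Finset.univ : Finset (ZMod (p ^ i))) ×ˢ T with hP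
  have hsub : (Finset.univ.filter fun z : ZMod (p ^ i) × ZMod (p ^ i) =>
      (z.1 + z.2) * (z.1 - 1) * (z.2 - 1) = 0) ⊆
      (P.image fun w => (w.2 - w.1, w.1)) ∪ (P.image fun w => (w.2 + 1, w.1)) ∪
        (P.image fun w => (w.1, w.2 + 1)) := by
    rintro ⟨x, y⟩ hz
    simp only [Finset.mem_filter, Finset.mem_univ, true_and] at hz
    have h1 : p ^ i ∣ (x + y).val * (x - 1).val * (y - 1).val := by
      rw [← ZMod.natCast_eq_zero_iff]
      push_cast [ZMod.natCast_zmod_val]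
      exact hz
    simp only [Finset.mem_union, Finset.mem_image, hP, hT, Finset.mem_product, Finset.mem_univ,
      true_and, Finset.mem_filter, Prod.mk.injEq, Prod.exists]
    rcases pow_dvd_of_dvd_mul_mul hp ht h1 with h | h | h
    · exact Or.inl (Or.inl ⟨y, x + y, h, by ring, rfl⟩)
    · exact Or.inl (Or.inr ⟨y, x - 1, h, by ring, rfl⟩)
    · exact Or.inr ⟨x, y - 1, h, rfl, by ring⟩
  have hPc : P.card ≤ p ^ i * p ^ (i - t) := by
    rw [hP, Finset.card_product, Finset.card_univ, ZMod.card]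
    exact Nat.mul_le_mul_left _ (card_multiples_le hp hti)
  have h2 := Finset.card_le_card hsub
  have h3 := Finset.card_union_le ((P.image fun w => (w.2 - w.1, w.1)) ∪
    (P.image fun w => (w.2 + 1, w.1))) (P.image fun w => (w.1, w.2 + 1))
  have h4 := Finset.card_union_le (P.image fun w => (w.2 - w.1, w.1))
    (P.image fun w => (w.2 + 1, w.1))
  have h5 := Finset.card_image_le (s := P) (f := fun w => (w.2 - w.1, w.1))
  have h6 := Finset.card_image_le (s := P) (f := fun w => (w.2 + 1, w.1))
  have h7 := Finset.card_image_le (s := P) (f := fun w => (w.1, w.2 + 1))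
  calc _ ≤ (3 * (p ^ i * p ^ (i - t))) * p ^ t := Nat.mul_le_mul_right _ (by omega)
    _ = 3 * (p ^ i * (p ^ (i - t) * p ^ t)) := by ring
    _ = _ := by rw [← pow_add, Nat.sub_add_cancel hti]; ring

theorem norm_kloosterman_pow_le {p i : ℕ} (hp : p.Prime) (hi : 1 ≤ i) [NeZero (p ^ i)]
    {s : ZMod (p ^ i)} (hs : IsUnit s) (h : ZMod (p ^ i)) :
    ‖kloosterman s h‖ ^ 12 ≤ 27 * ((p : ℝ) ^ i) ^ 11 := by
  obtain ⟨t, ht⟩ : ∃ t, t = (i + 2) / 3 := ⟨_, rfl⟩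
  have h1 := kloosterman_fourth_moment_le s h hs
  have h2 := card_zeros_mul_le (t := t) hp (by omega) (by omega : t ≤ i)
  generalize (Finset.univ.filter fun z : ZMod (p ^ i) × ZMod (p ^ i) =>
      (z.1 + z.2) * (z.1 - 1) * (z.2 - 1) = 0).card = Z at h1 h2
  have h3 : (Z : ℝ) * (p : ℝ) ^ t ≤ 3 * ((p : ℝ) ^ i) ^ 2 := by exact_mod_cast h2
  have hp1 : (1 : ℝ) ≤ p := by exact_mod_cast hp.one_lt.le
  set d : ℝ := (p : ℝ) ^ i with hd
  have hd0 : 0 < d := by positivity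
  push_cast at h1
  rw [← hd] at h1
  have h4 : ‖kloosterman s h‖ ^ 4 * (p : ℝ) ^ t ≤ 3 * d ^ 4 := by
    calc _ ≤ d ^ 2 * Z * (p : ℝ) ^ t := by gcongr
      _ = d ^ 2 * (Z * (p : ℝ) ^ t) := by ring
      _ ≤ d ^ 2 * (3 * d ^ 2) := by gcongr
      _ = _ := by ring
  have h5 : d ≤ ((p : ℝ) ^ t) ^ 3 := by
    rw [← pow_mul, hd]
    exact pow_le_pow_right₀ hp1 (by omega)
  have h6 := pow_le_pow_left₀ (by positivity) h4 3
  have h7 : ‖kloosterman s h‖ ^ 12 * d ≤ 27 * d ^ 11 * d := by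
    calc _ ≤ ‖kloosterman s h‖ ^ 12 * ((p : ℝ) ^ t) ^ 3 := by gcongr
      _ = (‖kloosterman s h‖ ^ 4 * (p : ℝ) ^ t) ^ 3 := by ring
      _ ≤ _ := h6
      _ = _ := by ring
  exact le_of_mul_le_mul_right h7 hd0

end Kloosterman

/-! ## Exponential sums over reciprocals of differences -/

section Bilinear

open ZMod ComplexConjugate

lemma stdAddChar_pow_mul {p : ℕ} (hp : p.Prime) (i v : ℕ) [NeZero (p ^ i)] [NeZero (p ^ (i + v))]
    (z : ℤ) : stdAddChar (((p : ℤ) ^ v * z : ℤ) : ZMod (p ^ (i + v))) =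
      stdAddChar (z : ZMod (p ^ i)) := by
  have hp0 : (p : ℂ) ≠ 0 := by exact_mod_cast hp.ne_zero
  rw [stdAddChar_coe, stdAddChar_coe]
  congr 1
  push_cast
  rw [pow_add]
  field_simp

lemma intCast_eq_pow_mul_iff {p : ℕ} (hp : p.Prime) (i v : ℕ) (n w : ℤ) :
    ((n : ZMod (p ^ (i + v))) = (((p : ℤ) ^ v * w : ℤ) : ZMod (p ^ (i + v)))) ↔
      (p : ℤ) ^ v ∣ n ∧ ((n / (p : ℤ) ^ v : ℤ) : ZMod (p ^ i)) = (w : ZMod (p ^ i)) := by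
  have hp0 : (p : ℤ) ^ v ≠ 0 := pow_ne_zero _ (by exact_mod_cast hp.ne_zero)
  rw [eq_comm, ZMod.intCast_eq_intCast_iff_dvd_sub, eq_comm, ZMod.intCast_eq_intCast_iff_dvd_sub]
  push_cast
  rw [pow_add, mul_comm ((p : ℤ) ^ i)]
  constructor
  · intro h
    have h1 : (p : ℤ) ^ v ∣ n := by
      have := (Dvd.intro _ rfl).trans h
      exact (dvd_sub_left (Dvd.intro _ rfl)).mp this
    obtain ⟨e, rfl⟩ := h1
    refine ⟨Dvd.intro _ rfl, ?_⟩
    rw [Int.mul_ediv_cancel_left _ hp0]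
    rw [← mul_sub] at h
    exact (mul_dvd_mul_iff_left hp0).mp h
  · rintro ⟨⟨e, rfl⟩, h⟩
    rw [Int.mul_ediv_cancel_left _ hp0] at h
    rw [← mul_sub]
    exact mul_dvd_mul_left _ h

lemma pow_succ_dvd_iff {p : ℕ} (hp : p.Prime) {v : ℕ} {n : ℤ} (h : (p : ℤ) ^ v ∣ n) :
    (p : ℤ) ^ (v + 1) ∣ n ↔ (p : ℤ) ∣ n / (p : ℤ) ^ v := by
  have hp0 : (p : ℤ) ^ v ≠ 0 := pow_ne_zero _ (by exact_mod_cast hp.ne_zero)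
  obtain ⟨e, rfl⟩ := h
  rw [Int.mul_ediv_cancel_left _ hp0, pow_succ, mul_dvd_mul_iff_left hp0]

lemma not_dvd_of_isUnit_intCast {p i : ℕ} (hp : p.Prime) (hi : 1 ≤ i) {x : ℤ}
    (hx : IsUnit (x : ZMod (p ^ i))) : ¬ (p : ℤ) ∣ x := by
  intro h
  have := Fact.mk hp
  have h1 : IsUnit (x : ZMod p) := by
    have := hx.map (ZMod.castHom (dvd_pow_self p (by omega : i ≠ 0)) (ZMod p))
    simpa using this
  rw [(ZMod.intCast_zmod_eq_zero_iff_dvd x p).mpr h] at h1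
  exact not_isUnit_zero h1

/-- The pairs whose difference has `p`-adic valuation exactly `v`. -/
def valPairs (p v : ℕ) (B₁ B₂ : Finset ℤ) : Finset (ℤ × ℤ) :=
  (B₁ ×ˢ B₂).filter fun x => (p : ℤ) ^ v ∣ x.1 - x.2 ∧ ¬ (p : ℤ) ^ (v + 1) ∣ x.1 - x.2

lemma sum_units_ite {p i v : ℕ} (hp : p.Prime) (hi : 1 ≤ i) [NeZero (p ^ i)] (s : ZMod (p ^ i))
    (n : ℤ) : (∑ u : (ZMod (p ^ i))ˣ, if (n : ZMod (p ^ (i + v))) =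
        (((p : ℤ) ^ v * (u.val.val : ℤ) : ℤ) : ZMod (p ^ (i + v)))
        then stdAddChar (s * (u⁻¹).val) else 0) =
      if (p : ℤ) ^ v ∣ n ∧ ¬ (p : ℤ) ^ (v + 1) ∣ n
        then stdAddChar (s * ((n / (p : ℤ) ^ v : ℤ) : ZMod (p ^ i))⁻¹) else 0 := by
  simp only [intCast_eq_pow_mul_iff hp, Int.cast_natCast, ZMod.natCast_zmod_val]
  by_cases h1 : (p : ℤ) ^ v ∣ n
  · by_cases h2 : (p : ℤ) ^ (v + 1) ∣ n
    · rw [if_neg (by tauto)]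
      refine Finset.sum_eq_zero fun u _ => if_neg fun h => ?_
      have h3 : IsUnit ((n / (p : ℤ) ^ v : ℤ) : ZMod (p ^ i)) := h.2 ▸ u.isUnit
      exact not_dvd_of_isUnit_intCast hp hi h3 ((pow_succ_dvd_iff hp h1).mp h2)
    · rw [if_pos ⟨h1, h2⟩]
      rw [pow_succ_dvd_iff hp h1] at h2
      obtain ⟨w, hw⟩ := isUnit_intCast_of_not_dvd (κ := i) hp h2
      rw [Finset.sum_eq_single w]
      · rw [if_pos ⟨h1, hw.symm⟩, ← hw, ZMod.inv_coe_unit]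
      · intro u _ hu
        refine if_neg fun h => hu ?_
        ext
        rw [hw, h.2]
      · simp
  · rw [if_neg (by tauto)]
    exact Finset.sum_eq_zero fun u _ => if_neg (by tauto)

lemma card_coincidences_le (B : Finset ℤ) (x : ℤ) (E D : ℕ) (hD : 0 < D)
    (hB : B ⊆ Finset.Ico x (x + E)) :
    (((B ×ˢ B).filter fun z => (z.1 : ZMod D) = (z.2 : ZMod D)).card : ℝ) ≤
      E * ((E : ℝ) / D + 1) := by
  have hBc : B.card ≤ E := by
    have := Finset.card_le_card hB
    rwa [Int.card_Ico, add_sub_cancel_left, Int.toNat_natCast] at this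
  have hfib : ∀ a ∈ B, ((B.filter fun b : ℤ => (a : ZMod D) = (b : ZMod D)).card : ℝ) ≤
      (E : ℝ) / D + 1 := by
    intro a _
    have hsub : (B.filter fun b : ℤ => (a : ZMod D) = (b : ZMod D)) ⊆
        (Finset.Ico x (x + E)).filter (· ≡ a [ZMOD D]) := by
      intro b hb
      rw [Finset.mem_filter] at hb ⊢
      exact ⟨hB hb.1, ((ZMod.intCast_eq_intCast_iff _ _ _).mp hb.2).symm⟩
    have h1 := Finset.card_le_card hsub
    have h2 := Int.Ico_filter_modEq_card x (x + E) (by exact_mod_cast hD : (0 : ℤ) < D) a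
    have hDq : (0 : ℚ) < D := by exact_mod_cast hD
    have h3 : ((((Finset.Ico x (x + E)).filter (· ≡ a [ZMOD D])).card : ℤ) : ℚ) ≤
        (E : ℚ) / D + 1 := by
      rw [h2]
      push_cast
      refine max_le ?_ (by positivity)
      have h4 := Int.ceil_lt_add_one (((x : ℚ) + E - a) / D)
      have h5 := Int.le_ceil (((x : ℚ) - a) / D)
      have h6 : ((x : ℚ) + E - a) / D = (x - a) / D + E / D := by ring
      linarith
    have h4 : ((((Finset.Ico x (x + E)).filter (· ≡ a [ZMOD D])).card : ℤ) : ℝ) ≤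
        (E : ℝ) / D + 1 := by
      have := (Rat.cast_le (K := ℝ)).mpr h3
      simpa only [Rat.cast_add, Rat.cast_div, Rat.cast_natCast, Rat.cast_intCast, Rat.cast_one]
        using this
    refine le_trans ?_ h4
    exact_mod_cast h1
  have h1 : ((B ×ˢ B).filter fun z => (z.1 : ZMod D) = (z.2 : ZMod D)).card =
      ∑ a ∈ B, (B.filter fun b : ℤ => (a : ZMod D) = (b : ZMod D)).card := by
    simp only [Finset.card_filter]
    rw [Finset.sum_product]
  rw [h1]
  push_cast
  calc _ ≤ ∑ a ∈ B, ((E : ℝ) / D + 1) := Finset.sum_le_sum hfib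
    _ = B.card * ((E : ℝ) / D + 1) := by rw [Finset.sum_const, nsmul_eq_mul]
    _ ≤ _ := by gcongr

theorem norm_sum_valPairs_le {p i v : ℕ} (hp : p.Prime) (hi : 1 ≤ i) [NeZero (p ^ i)]
    {s : ZMod (p ^ i)} (hs : IsUnit s) (B₁ B₂ : Finset ℤ) (x₁ x₂ : ℤ) (E : ℕ)
    (hB₁ : B₁ ⊆ Finset.Ico x₁ (x₁ + E)) (hB₂ : B₂ ⊆ Finset.Ico x₂ (x₂ + E)) {κ : ℝ}
    (hκ0 : 0 ≤ κ) (hκ : 27 * ((p : ℝ) ^ i) ^ 11 ≤ κ ^ 12) :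
    ‖∑ z ∈ valPairs p v B₁ B₂,
      stdAddChar (s * (((z.1 - z.2) / (p : ℤ) ^ v : ℤ) : ZMod (p ^ i))⁻¹)‖ ≤
      κ * (E * ((E : ℝ) / (p : ℝ) ^ i + 1)) := by
  classical
  have hpp := hp.pos
  have hneD : NeZero (p ^ (i + v)) := ⟨(pow_pos hpp _).ne'⟩
  set D := p ^ (i + v) with hD
  have hD0 : 0 < D := pow_pos hpp _
  have hK : ∀ h : ZMod (p ^ i), ‖kloosterman s h‖ ≤ κ := fun h =>
    le_of_pow_le_pow_left₀ (by norm_num) hκ0 ((norm_kloosterman_pow_le hp hi hs h).trans hκ)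
  set A₁ : ZMod D → ℂ := fun h => ∑ a ∈ B₁, stdAddChar (h * (a : ZMod D)) with hA₁
  set A₂ : ZMod D → ℂ := fun h => ∑ a ∈ B₂, stdAddChar (h * (-(a : ZMod D))) with hA₂
  have hmain : (D : ℂ) * ∑ z ∈ valPairs p v B₁ B₂,
      stdAddChar (s * (((z.1 - z.2) / (p : ℤ) ^ v : ℤ) : ZMod (p ^ i))⁻¹) =
      ∑ h : ZMod D, A₁ h * A₂ h * kloosterman s (-((h.val : ℤ) : ZMod (p ^ i))) := by
    have h1 : ∀ h : ZMod D, A₁ h * A₂ h * kloosterman s (-((h.val : ℤ) : ZMod (p ^ i))) =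
        ∑ z ∈ B₁ ×ˢ B₂, ∑ u : (ZMod (p ^ i))ˣ, stdAddChar (s * (u⁻¹).val) *
          stdAddChar (h * (((z.1 - z.2 : ℤ) : ZMod D) -
            (((p : ℤ) ^ v * (u.val.val : ℤ) : ℤ) : ZMod D))) := by
      intro h
      simp only [hA₁, hA₂]
      rw [Finset.sum_mul_sum, Finset.sum_product, Finset.sum_mul]
      refine Finset.sum_congr rfl fun a _ => ?_
      rw [Finset.sum_mul]
      refine Finset.sum_congr rfl fun a' _ => ?_
      unfold kloosterman
      rw [Finset.mul_sum]
      refine Finset.sum_congr rfl fun u _ => ?_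
      have e1 : stdAddChar (((p : ℤ) ^ v * (-((h.val : ℤ) * (u.val.val : ℤ))) : ℤ) : ZMod D) =
          stdAddChar ((-((h.val : ℤ) * (u.val.val : ℤ)) : ℤ) : ZMod (p ^ i)) :=
        stdAddChar_pow_mul hp i v _
      have e2 : (((p : ℤ) ^ v * (-((h.val : ℤ) * (u.val.val : ℤ))) : ℤ) : ZMod D) =
          -(h * (((p : ℤ) ^ v * (u.val.val : ℤ) : ℤ) : ZMod D)) := by
        push_cast [ZMod.natCast_zmod_val]
        ring
      have e3 : ((-((h.val : ℤ) * (u.val.val : ℤ)) : ℤ) : ZMod (p ^ i)) =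
          -((h.val : ℤ) : ZMod (p ^ i)) * u.val := by
        push_cast [ZMod.natCast_zmod_val]
        ring
      rw [e2, e3] at e1
      rw [AddChar.map_add_eq_mul, ← e1]
      rw [mul_left_comm, ← AddChar.map_add_eq_mul, ← AddChar.map_add_eq_mul]
      congr 2
      push_cast
      ring
    rw [Finset.sum_congr rfl fun h _ => h1 h, Finset.sum_comm, valPairs, Finset.sum_filter,
      Finset.mul_sum]
    refine Finset.sum_congr rfl fun z _ => ?_
    rw [← sum_units_ite hp hi, Finset.sum_comm, Finset.mul_sum]
    refine Finset.sum_congr rfl fun u _ => ?_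
    rw [← Finset.mul_sum, sum_stdAddChar_mul, ← hD]
    simp only [sub_eq_zero]
    split_ifs
    · ring
    · simp
  have hn₁ := parseval (M := D) B₁ fun a => (a : ZMod D)
  have hn₂ := parseval (M := D) B₂ fun a => -(a : ZMod D)
  simp only [neg_inj] at hn₂
  have hc₁ := card_coincidences_le B₁ x₁ E D hD0 hB₁
  have hc₂ := card_coincidences_le B₂ x₂ E D hD0 hB₂
  set X : ℝ := E * ((E : ℝ) / D + 1) with hX
  have hDr : (0 : ℝ) < D := by exact_mod_cast hD0
  have hX0 : 0 ≤ X := by positivity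
  have hb₁ : ∑ h : ZMod D, ‖A₁ h‖ ^ 2 ≤ D * X := by
    rw [hn₁]; gcongr
  have hb₂ : ∑ h : ZMod D, ‖A₂ h‖ ^ 2 ≤ D * X := by
    rw [hn₂]; gcongr
  have hCS : ∑ h : ZMod D, ‖A₁ h‖ * ‖A₂ h‖ ≤ D * X := by
    have : ∀ h : ZMod D, ‖A₁ h‖ * ‖A₂ h‖ ≤ (‖A₁ h‖ ^ 2 + ‖A₂ h‖ ^ 2) / 2 := fun h => by
      nlinarith [sq_nonneg (‖A₁ h‖ - ‖A₂ h‖)]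
    calc _ ≤ ∑ h : ZMod D, (‖A₁ h‖ ^ 2 + ‖A₂ h‖ ^ 2) / 2 :=
          Finset.sum_le_sum fun h _ => this h
      _ = (∑ h : ZMod D, ‖A₁ h‖ ^ 2 + ∑ h : ZMod D, ‖A₂ h‖ ^ 2) / 2 := by
          rw [← Finset.sum_div, Finset.sum_add_distrib]
      _ ≤ _ := by linarith
  have hfin : (D : ℝ) * ‖∑ z ∈ valPairs p v B₁ B₂,
      stdAddChar (s * (((z.1 - z.2) / (p : ℤ) ^ v : ℤ) : ZMod (p ^ i))⁻¹)‖ ≤ D * (κ * X) := by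
    calc _ = ‖(D : ℂ) * ∑ z ∈ valPairs p v B₁ B₂,
          stdAddChar (s * (((z.1 - z.2) / (p : ℤ) ^ v : ℤ) : ZMod (p ^ i))⁻¹)‖ := by
          rw [norm_mul, Complex.norm_natCast]
      _ ≤ ∑ h : ZMod D, ‖A₁ h * A₂ h * kloosterman s (-((h.val : ℤ) : ZMod (p ^ i)))‖ := by
          rw [hmain]; exact norm_sum_le _ _
      _ ≤ ∑ h : ZMod D, ‖A₁ h‖ * ‖A₂ h‖ * κ := by
          refine Finset.sum_le_sum fun h _ => ?_
          rw [norm_mul, norm_mul]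
          gcongr
          exact hK _
      _ = (∑ h : ZMod D, ‖A₁ h‖ * ‖A₂ h‖) * κ := by rw [Finset.sum_mul]
      _ ≤ D * X * κ := by gcongr
      _ = _ := by ring
  refine (le_of_mul_le_mul_left hfin hDr).trans ?_
  have hle : (p : ℝ) ^ i ≤ D := by
    rw [hD]; push_cast
    exact pow_le_pow_right₀ (by exact_mod_cast hpp) (by omega)
  have hpi : (0 : ℝ) < (p : ℝ) ^ i := by positivity
  rw [hX]
  gcongr

end Bilinear

/-! ## Additive characters of prime power modulus evaluated at reciprocals -/

section Reciprocals

open ZMod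

lemma map_inv_of_isUnit {m n : ℕ} (f : ZMod m →+* ZMod n) {a : ZMod m} (ha : IsUnit a) :
    f a⁻¹ = (f a)⁻¹ := by
  obtain ⟨u, rfl⟩ := ha
  have h : f u = (Units.map (f : ZMod m →* ZMod n) u : ZMod n) := rfl
  rw [h, ZMod.inv_coe_unit, ZMod.inv_coe_unit, ← map_inv]
  rfl

/-- A nonzero frequency modulo `p ^ m` comes from a unit frequency modulo some `p ^ i`. -/
lemma exists_conductor {p m j : ℕ} (hp : p.Prime) [NeZero (p ^ m)] {ξ : ZMod (p ^ m)}
    (hξ : ξ * (p : ZMod (p ^ m)) ^ j ≠ 0) :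
    ∃ i, j + 1 ≤ i ∧ i ≤ m ∧ ∃ (_ : NeZero (p ^ i)) (s : ZMod (p ^ i)), IsUnit s ∧
      ∃ f : ZMod (p ^ m) →+* ZMod (p ^ i), ∀ y, stdAddChar (ξ * y) = stdAddChar (s * f y) := by
  have hval : ξ.val ≠ 0 := by
    intro h
    rw [ZMod.val_eq_zero] at h
    exact hξ (by rw [h, zero_mul])
  obtain ⟨w, r, hr, hwr⟩ := Nat.exists_eq_pow_mul_and_not_dvd hval p hp.ne_one
  have hcast : ξ = (p : ZMod (p ^ m)) ^ w * (r : ZMod (p ^ m)) := by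
    rw [← ZMod.natCast_zmod_val ξ, hwr]; push_cast; rfl
  have hzero : ∀ n, m ≤ n → (p : ZMod (p ^ m)) ^ n = 0 := by
    intro n hn
    rw [← Nat.cast_pow, ZMod.natCast_eq_zero_iff]
    exact pow_dvd_pow _ hn
  have hwj : w + j < m := by
    by_contra hcon
    apply hξ
    rw [hcast, mul_right_comm, ← pow_add, hzero _ (by omega), zero_mul]
  obtain ⟨i, rfl⟩ : ∃ i, m = i + w := ⟨m - w, by omega⟩
  have hne : NeZero (p ^ i) := ⟨(pow_pos hp.pos _).ne'⟩
  refine ⟨i, by omega, by omega, hne, ((r : ℤ) : ZMod (p ^ i)),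
    isUnit_intCast_of_not_dvd hp (by exact_mod_cast hr),
    ZMod.castHom (pow_dvd_pow p (Nat.le_add_right i w)) _, fun y => ?_⟩
  have h1 := stdAddChar_pow_mul hp i w ((r : ℤ) * (y.val : ℤ))
  have h2 : (((p : ℤ) ^ w * ((r : ℤ) * (y.val : ℤ)) : ℤ) : ZMod (p ^ (i + w))) = ξ * y := by
    rw [hcast]; push_cast [ZMod.natCast_zmod_val]; ring
  have h3 : (((r : ℤ) * (y.val : ℤ) : ℤ) : ZMod (p ^ i)) =
      ((r : ℤ) : ZMod (p ^ i)) * ZMod.castHom (pow_dvd_pow p (Nat.le_add_right i w)) _ y := by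
    have : ZMod.castHom (pow_dvd_pow p (Nat.le_add_right i w)) (ZMod (p ^ i)) y =
        ((y.val : ℕ) : ZMod (p ^ i)) := by
      conv_lhs => rw [← ZMod.natCast_zmod_val y]
      rw [map_natCast]
    rw [this]; push_cast; ring
  rw [h2, h3] at h1
  exact h1

/-- The inverse modulo `p ^ m` of the prime-to-`p` part of a difference. -/
def recipDiff (p v m : ℕ) (z : ℤ × ℤ) : ZMod (p ^ m) :=
  (((z.1 - z.2) / (p : ℤ) ^ v : ℤ) : ZMod (p ^ m))⁻¹

lemma not_dvd_of_mem_valPairs {p v : ℕ} (hp : p.Prime) {B₁ B₂ : Finset ℤ} {z : ℤ × ℤ}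
    (hz : z ∈ valPairs p v B₁ B₂) : ¬ (p : ℤ) ∣ (z.1 - z.2) / (p : ℤ) ^ v := by
  obtain ⟨-, h1, h2⟩ := Finset.mem_filter.mp hz
  rwa [← pow_succ_dvd_iff hp h1]

lemma mul_recipDiff {p v m : ℕ} (hp : p.Prime) {B₁ B₂ : Finset ℤ} {z : ℤ × ℤ}
    (hz : z ∈ valPairs p v B₁ B₂) :
    (((z.1 - z.2) / (p : ℤ) ^ v : ℤ) : ZMod (p ^ m)) * recipDiff p v m z = 1 :=
  ZMod.mul_inv_of_unit _ (isUnit_intCast_of_not_dvd hp (not_dvd_of_mem_valPairs hp hz))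

/-- Cancellation in exponential sums over reciprocals of differences. -/
theorem norm_sum_recipDiff_le {p m j : ℕ} (hp : p.Prime) [NeZero (p ^ m)] {ξ : ZMod (p ^ m)}
    (hξ : ξ * (p : ZMod (p ^ m)) ^ j ≠ 0) :
    ∃ i, j + 1 ≤ i ∧ i ≤ m ∧ ∀ (v : ℕ) (B₁ B₂ : Finset ℤ) (x₁ x₂ : ℤ) (E : ℕ) (δ : ℝ),
      B₁ ⊆ Finset.Ico x₁ (x₁ + E) → B₂ ⊆ Finset.Ico x₂ (x₂ + E) → 0 < δ → δ ^ 12 = (p : ℝ) ^ i →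
      ‖∑ z ∈ valPairs p v B₁ B₂, stdAddChar (ξ * recipDiff p v m z)‖ ≤
        2 * δ ^ 11 * (E * ((E : ℝ) / δ ^ 12 + 1)) := by
  obtain ⟨i, hji, him, hne, s, hs, f, hf⟩ := exists_conductor hp hξ
  refine ⟨i, hji, him, fun v B₁ B₂ x₁ x₂ E δ hB₁ hB₂ hδ hδi => ?_⟩
  have h1 : ∑ z ∈ valPairs p v B₁ B₂, stdAddChar (ξ * recipDiff p v m z) =
      ∑ z ∈ valPairs p v B₁ B₂,
        stdAddChar (s * (((z.1 - z.2) / (p : ℤ) ^ v : ℤ) : ZMod (p ^ i))⁻¹) := by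
    refine Finset.sum_congr rfl fun z hz => ?_
    rw [hf, recipDiff, map_inv_of_isUnit f
      (isUnit_intCast_of_not_dvd hp (not_dvd_of_mem_valPairs hp hz)), map_intCast]
  rw [h1, hδi]
  refine norm_sum_valPairs_le hp (by omega) hs B₁ B₂ x₁ x₂ E hB₁ hB₂ (by positivity) ?_
  rw [← hδi]
  have : 0 < δ ^ 132 := by positivity
  nlinarith

end Reciprocals

/-! ## Locating structured pairs in a dense set of integers -/

section Structure

lemma exists_dense_subinterval (S : Finset ℤ) (x₀ : ℤ) (T E : ℕ) (hE : 0 < E)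
    (hS : S ⊆ Finset.Ico x₀ (x₀ + T)) :
    ∃ x : ℤ, S.card * E ≤ (S.filter (· ∈ Finset.Ico x (x + E))).card * (T + E) := by
  by_contra hcon
  push Not at hcon
  have hE' : (0 : ℤ) < E := by exact_mod_cast hE
  have hmap : ∀ a ∈ S, ((a - x₀) / E).toNat ∈ Finset.range (T / E + 1) := by
    intro a ha
    obtain ⟨h1, h2⟩ := Finset.mem_Ico.mp (hS ha)
    rw [Finset.mem_range, Nat.lt_succ_iff]
    have : (a - x₀) / (E : ℤ) ≤ (T : ℤ) / E := Int.ediv_le_ediv hE' (by linarith)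
    rw [Int.toNat_le, Int.natCast_ediv]
    exact this
  have hcard := Finset.card_eq_sum_card_fiberwise (f := fun a : ℤ => ((a - x₀) / E).toNat) hmap
  have hfib : ∀ n ∈ Finset.range (T / E + 1),
      (S.filter fun a : ℤ => ((a - x₀) / E).toNat = n).card * (T + E) < S.card * E := by
    intro n _
    refine lt_of_le_of_lt ?_ (hcon (x₀ + E * n))
    refine Nat.mul_le_mul_right _ (Finset.card_le_card fun a ha => ?_)
    obtain ⟨haS, han⟩ := Finset.mem_filter.mp ha
    obtain ⟨h1, h2⟩ := Finset.mem_Ico.mp (hS haS)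
    refine Finset.mem_filter.mpr ⟨haS, Finset.mem_Ico.mpr ?_⟩
    have h3 : (0 : ℤ) ≤ (a - x₀) / E := Int.ediv_nonneg (by linarith) hE'.le
    have h4 : (a - x₀) / E = n := by omega
    have h5 := Int.emod_add_mul_ediv (a - x₀) E
    have h6 := Int.emod_nonneg (a - x₀) hE'.ne'
    have h7 := Int.emod_lt_of_pos (a - x₀) hE'
    rw [h4] at h5
    constructor <;> linarith
  have hsum := Finset.sum_lt_sum_of_nonempty (by simp) hfib
  rw [← Finset.sum_mul, ← hcard, Finset.sum_const, Finset.card_range, smul_eq_mul] at hsum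
  have h8 : (T / E + 1) * E ≤ T + E := by
    rw [add_mul, one_mul]; exact Nat.add_le_add_right (Nat.div_mul_le_self T E) _
  nlinarith

lemma card_le_two_mul_card_popular (B : Finset ℤ) (P : ℕ) (hP : 0 < P) :
    B.card ≤ 2 * (B.filter fun a : ℤ =>
      B.card ≤ 2 * P * (B.filter fun b : ℤ => (b : ZMod P) = (a : ZMod P)).card).card := by
  classical
  have : NeZero P := ⟨hP.ne'⟩
  set R := B.filter fun a : ℤ =>
      ¬ B.card ≤ 2 * P * (B.filter fun b : ℤ => (b : ZMod P) = (a : ZMod P)).card with hR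
  have h1 : R.card = ∑ c : ZMod P, (R.filter fun a : ℤ => (a : ZMod P) = c).card :=
    Finset.card_eq_sum_card_fiberwise fun _ _ => Finset.mem_coe.mpr (Finset.mem_univ _)
  have h2 : ∀ c : ZMod P, 2 * P * (R.filter fun a : ℤ => (a : ZMod P) = c).card ≤ B.card := by
    intro c
    rcases (R.filter fun a : ℤ => (a : ZMod P) = c).eq_empty_or_nonempty with h | ⟨a, ha⟩
    · rw [h]; simp
    · obtain ⟨haR, rfl⟩ := Finset.mem_filter.mp ha
      have h3 := (Finset.mem_filter.mp haR).2
      push Not at h3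
      refine le_trans (Nat.mul_le_mul_left _ (Finset.card_le_card ?_)) h3.le
      exact Finset.filter_subset_filter _ (Finset.filter_subset _ _)
  have h3 : 2 * P * R.card ≤ P * B.card := by
    rw [h1, Finset.mul_sum]
    calc _ ≤ ∑ c : ZMod P, B.card := Finset.sum_le_sum fun c _ => h2 c
      _ = _ := by simp
  have h4 : 2 * R.card ≤ B.card := by
    refine le_of_mul_le_mul_left (a := P) ?_ hP
    linarith
  have h5 := Finset.card_filter_add_card_filter_not (s := B) (fun a : ℤ =>
      B.card ≤ 2 * P * (B.filter fun b : ℤ => (b : ZMod P) = (a : ZMod P)).card)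
  rw [← hR] at h5
  omega

lemma succ_pow_four_le_two_pow {n : ℕ} (hn : 20 ≤ n) : (n + 1) ^ 4 ≤ 2 ^ n := by
  induction n, hn using Nat.le_induction with
  | base => norm_num
  | succ n hn ih =>
    rw [pow_succ 2]
    obtain ⟨m, rfl⟩ := Nat.exists_eq_add_of_le hn
    nlinarith [sq_nonneg m, pow_pos (by omega : 0 < m + 1) 3, pow_pos (by omega : 0 < m + 1) 4]

lemma exists_popular_valuation {p : ℕ} (hp : p.Prime) {θ : ℝ} (hθ : 2000 ≤ θ) (B : Finset ℤ)
    (y : ℤ) (E : ℕ) (hB : B ⊆ Finset.Ico y (y + E)) (hE : θ ^ 4 ≤ E)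
    (hcard : (E : ℝ) ≤ 20 * θ * B.card) :
    ∃ v, (p : ℝ) ^ v ≤ θ ^ 4 ∧ (E : ℝ) ^ 2 ≤ θ ^ 4 * (valPairs p v B B).card := by
  classical
  have hp2 : (2 : ℝ) ≤ p := by exact_mod_cast hp.two_le
  have hex : ∃ V : ℕ, θ ^ 4 < (p : ℝ) ^ V := pow_unbounded_of_one_lt _ (by linarith)
  obtain ⟨n, hn1, hn2⟩ : ∃ n : ℕ, (p : ℝ) ^ n ≤ θ ^ 4 ∧ θ ^ 4 < (p : ℝ) ^ (n + 1) := by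
    have h0 : Nat.find hex ≠ 0 := by
      intro h
      have := Nat.find_spec hex
      rw [h, pow_zero] at this
      have : (1 : ℝ) ≤ θ ^ 4 := one_le_pow₀ (by linarith)
      linarith
    obtain ⟨n, hn⟩ := Nat.exists_eq_succ_of_ne_zero h0
    refine ⟨n, not_lt.mp (Nat.find_min hex (by omega)), ?_⟩
    have := Nat.find_spec hex
    rwa [hn] at this
  have hnθ : (n : ℝ) + 1 ≤ θ := by
    by_contra hcon
    push Not at hcon
    have h20 : 20 ≤ n := by
      have : (20 : ℝ) ≤ n := by linarith
      exact_mod_cast this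
    have h1 : ((n : ℝ) + 1) ^ 4 ≤ 2 ^ n := by exact_mod_cast succ_pow_four_le_two_pow h20
    have h2 : (2 : ℝ) ^ n ≤ (p : ℝ) ^ n := by gcongr
    have h3 : θ ^ 4 < ((n : ℝ) + 1) ^ 4 := pow_lt_pow_left₀ hcon (by linarith) (by norm_num)
    linarith
  by_contra hcon
  push Not at hcon
  set C := (B ×ˢ B).filter fun z => (z.1 : ZMod (p ^ (n + 1))) = (z.2 : ZMod (p ^ (n + 1)))
    with hC
  have hcover : B ×ˢ B ⊆ C ∪ (Finset.range (n + 1)).biUnion fun v => valPairs p v B B := by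
    intro z hz
    rw [Finset.mem_union, Finset.mem_biUnion]
    by_cases hd : (p : ℤ) ^ (n + 1) ∣ z.1 - z.2
    · left
      refine Finset.mem_filter.mpr ⟨hz, ?_⟩
      rw [eq_comm, ZMod.intCast_eq_intCast_iff_dvd_sub]
      exact_mod_cast hd
    · right
      have hex' : ∃ w : ℕ, ¬ (p : ℤ) ^ w ∣ z.1 - z.2 := ⟨_, hd⟩
      have h0 : Nat.find hex' ≠ 0 := by
        intro h
        have := Nat.find_spec hex'
        rw [h, pow_zero] at this
        exact this (one_dvd _)
      obtain ⟨w, hw⟩ := Nat.exists_eq_succ_of_ne_zero h0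
      have h1 : Nat.find hex' ≤ n + 1 := Nat.find_min' hex' hd
      refine ⟨w, Finset.mem_range.mpr (by omega), Finset.mem_filter.mpr ⟨hz, ?_, ?_⟩⟩
      · exact not_not.mp (Nat.find_min hex' (by omega))
      · have := Nat.find_spec hex'
        rwa [hw] at this
  have hθ0 : 0 < θ := by linarith
  have hE0 : (0 : ℝ) < E := lt_of_lt_of_le (by positivity) hE
  have h1 : (B.card : ℝ) ^ 2 ≤ C.card + ∑ v ∈ Finset.range (n + 1), ((valPairs p v B B).card : ℝ) := by
    have := (Finset.card_le_card hcover).trans (Finset.card_union_le _ _)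
    have h2 := Finset.card_biUnion_le (s := Finset.range (n + 1)) (t := fun v => valPairs p v B B)
    rw [Finset.card_product] at this
    have h3 : B.card ^ 2 ≤ C.card + ∑ v ∈ Finset.range (n + 1), (valPairs p v B B).card := by
      rw [sq]; omega
    exact_mod_cast h3
  have h2 : (C.card : ℝ) ≤ 2 * E ^ 2 / θ ^ 4 := by
    have h3 := card_coincidences_le B y E (p ^ (n + 1)) (pow_pos hp.pos _) hB
    push_cast at h3
    calc _ ≤ _ := h3
      _ ≤ (E : ℝ) * (E / θ ^ 4 + E / θ ^ 4) := by
          gcongr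
          rwa [one_le_div (by positivity)]
      _ = _ := by ring
  have h3 : ∑ v ∈ Finset.range (n + 1), ((valPairs p v B B).card : ℝ) ≤
      θ * (E ^ 2 / θ ^ 4) := by
    calc _ ≤ ∑ v ∈ Finset.range (n + 1), ((E : ℝ) ^ 2 / θ ^ 4) := by
          refine Finset.sum_le_sum fun v hv => ?_
          have hvn : (p : ℝ) ^ v ≤ θ ^ 4 :=
            (pow_le_pow_right₀ (by linarith) (by have := Finset.mem_range.mp hv; omega)).trans hn1
          rw [le_div_iff₀ (by positivity), mul_comm]
          exact (hcon v hvn).le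
      _ = ((n : ℝ) + 1) * ((E : ℝ) ^ 2 / θ ^ 4) := by
          rw [Finset.sum_const, Finset.card_range, nsmul_eq_mul]; push_cast; ring
      _ ≤ _ := by gcongr
  have h4 : (B.card : ℝ) ^ 2 ≤ 2 * E ^ 2 / θ ^ 3 := by
    have e1 : 2 * (E : ℝ) ^ 2 / θ ^ 4 = 2 * E ^ 2 / θ ^ 3 * (1 / θ) := by field_simp
    have e2 : θ * ((E : ℝ) ^ 2 / θ ^ 4) = 2 * E ^ 2 / θ ^ 3 * (1 / 2) := by field_simp
    have e3 : 1 / θ ≤ 1 / 2 := one_div_le_one_div_of_le (by norm_num) (by linarith)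
    have e4 : 0 ≤ 2 * (E : ℝ) ^ 2 / θ ^ 3 := by positivity
    nlinarith
  have h5 : (E : ℝ) ^ 2 ≤ 400 * θ ^ 2 * (B.card : ℝ) ^ 2 := by
    calc (E : ℝ) ^ 2 ≤ (20 * θ * B.card) ^ 2 := by gcongr
      _ = _ := by ring
  have h6 : (E : ℝ) ^ 2 * θ ≤ 800 * E ^ 2 := by
    calc (E : ℝ) ^ 2 * θ ≤ 400 * θ ^ 2 * (2 * E ^ 2 / θ ^ 3) * θ := by
          gcongr; exact h5.trans (by gcongr)
      _ = _ := by field_simp; ring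
  have h7 : (0 : ℝ) < (E : ℝ) ^ 2 := by positivity
  nlinarith

end Structure

set_option maxHeartbeats 1000000 in
/-- A dense set of integers contains two rich families of pairs with a common valuation `v` of
differences: long pairs, whose differences are all congruent modulo `p ^ J` to that of a fixed
short pair, and short pairs. -/
theorem exists_structured_pairs {p J : ℕ} (hp : p.Prime) {θ : ℝ} (hθ : 2000 ≤ θ) (E Es : ℕ)
    (hEs : θ ^ 100 ≤ Es) (hE : Es ≤ E) (A : Finset ℤ) (N : ℤ) (hEN : (E : ℤ) ≤ N)
    (hA : ∀ a ∈ A, -N ≤ a ∧ a ≤ 2 * N) (hcard : (N : ℝ) ≤ θ * A.card)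
    (hJ : (p : ℝ) ^ J ≤ θ ^ 200)
    (hJ' : θ ^ 100 < (p : ℝ) ^ J ∨ (J = 0 ∧ θ ^ 100 < (p : ℝ))) :
    ∃ (v : ℕ) (B₁ B₂ Bs : Finset ℤ) (x y : ℤ), v ≤ J ∧ (p : ℝ) ^ v ≤ θ ^ 4 ∧
      B₁ ⊆ A ∧ B₂ ⊆ A ∧ Bs ⊆ A ∧ B₁ ⊆ Finset.Ico x (x + E) ∧ B₂ ⊆ Finset.Ico x (x + E) ∧
      Bs ⊆ Finset.Ico y (y + Es) ∧ (E : ℝ) ^ 2 ≤ θ ^ 403 * (valPairs p v B₁ B₂).card ∧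
      (Es : ℝ) ^ 2 ≤ θ ^ 4 * (valPairs p v Bs Bs).card ∧
      ∃ e ∈ valPairs p v Bs Bs, ∀ z ∈ valPairs p v B₁ B₂,
        (p : ℤ) ^ J ∣ (z.1 - z.2) - (e.1 - e.2) := by
  classical
  have hθ0 : 0 < θ := by linarith
  have hθ1 : 1 ≤ θ := by linarith
  have hEs0 : (0 : ℝ) < Es := lt_of_lt_of_le (by positivity) hEs
  have hEsE : (Es : ℝ) ≤ E := by exact_mod_cast hE
  have hE0 : (0 : ℝ) < E := by linarith
  have hE0' : 0 < E := by exact_mod_cast hE0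
  have hEs0' : 0 < Es := by exact_mod_cast hEs0
  have hENr : (E : ℝ) ≤ N := by exact_mod_cast hEN
  have hA0 : (0 : ℝ) < A.card := by
    by_contra hcon
    push Not at hcon
    nlinarith
  obtain ⟨x, hx⟩ := exists_dense_subinterval A (-N) (3 * N + 1).toNat E hE0' (by
    intro a ha
    have := hA a ha
    rw [Finset.mem_Ico, Int.toNat_of_nonneg (by omega)]
    constructor <;> linarith)
  set B := A.filter (· ∈ Finset.Ico x (x + E)) with hB
  have hBI : B ⊆ Finset.Ico x (x + E) := fun a ha => (Finset.mem_filter.mp ha).2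
  have hBA : B ⊆ A := Finset.filter_subset _ _
  have hT : (((3 * N + 1).toNat : ℕ) : ℝ) = 3 * N + 1 := by
    have : (((3 * N + 1).toNat : ℕ) : ℤ) = 3 * N + 1 := Int.toNat_of_nonneg (by omega)
    exact_mod_cast this
  have hBc : (E : ℝ) ≤ 5 * θ * B.card := by
    have h1 : (A.card : ℝ) * E ≤ B.card * ((((3 * N + 1).toNat : ℕ) : ℝ) + E) := by
      exact_mod_cast hx
    rw [hT] at h1
    have hN1 : (1 : ℝ) ≤ N := by
      have : (1 : ℤ) ≤ N := by omega
      exact_mod_cast this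
    have h2 : (A.card : ℝ) * E ≤ A.card * (5 * θ * B.card) := by
      calc _ ≤ _ := h1
        _ ≤ (B.card : ℝ) * (5 * N) := by gcongr; linarith
        _ ≤ (B.card : ℝ) * (5 * (θ * A.card)) := by gcongr
        _ = _ := by ring
    exact le_of_mul_le_mul_left h2 hA0
  have hB0 : (0 : ℝ) < B.card := by
    by_contra hcon
    push Not at hcon
    nlinarith
  have hP0 : 0 < p ^ J := pow_pos hp.pos _
  have hpop := card_le_two_mul_card_popular B (p ^ J) hP0
  set Bp := B.filter fun a : ℤ => B.card ≤ 2 * p ^ J *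
    (B.filter fun b : ℤ => (b : ZMod (p ^ J)) = (a : ZMod (p ^ J))).card with hBp
  obtain ⟨y, hy⟩ := exists_dense_subinterval Bp x E Es hEs0' ((Finset.filter_subset _ _).trans hBI)
  set Bs := Bp.filter (· ∈ Finset.Ico y (y + Es)) with hBs
  have hBsI : Bs ⊆ Finset.Ico y (y + Es) := fun a ha => (Finset.mem_filter.mp ha).2
  have hBsc : (Es : ℝ) ≤ 20 * θ * Bs.card := by
    have h1 : (Bp.card : ℝ) * Es ≤ Bs.card * ((E : ℝ) + Es) := by exact_mod_cast hy
    have h2 : (B.card : ℝ) ≤ 2 * Bp.card := by exact_mod_cast hpop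
    have h3 : (B.card : ℝ) * Es ≤ B.card * (20 * θ * Bs.card) := by
      calc _ ≤ 2 * (Bp.card : ℝ) * Es := by gcongr
        _ = 2 * (Bp.card * Es) := by ring
        _ ≤ 2 * (Bs.card * ((E : ℝ) + Es)) := by gcongr
        _ ≤ 2 * (Bs.card * ((E : ℝ) + E)) := by gcongr
        _ = 4 * Bs.card * E := by ring
        _ ≤ 4 * Bs.card * (5 * θ * B.card) := by gcongr
        _ = _ := by ring
    exact le_of_mul_le_mul_left h3 hB0
  have h4100 : θ ^ 4 ≤ θ ^ 100 := pow_le_pow_right₀ hθ1 (by norm_num)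
  obtain ⟨v, hv, hvs⟩ := exists_popular_valuation hp hθ Bs y Es hBsI (h4100.trans hEs) hBsc
  have hne : (valPairs p v Bs Bs).Nonempty := by
    rw [← Finset.card_pos]
    by_contra hcon
    have : (valPairs p v Bs Bs).card = 0 := by omega
    rw [this] at hvs
    have : 0 < (Es : ℝ) ^ 2 := by positivity
    simp at hvs
    linarith
  obtain ⟨e, he⟩ := hne
  have hep := Finset.mem_filter.mp he
  obtain ⟨he1, he2⟩ := Finset.mem_product.mp hep.1
  have hpopc : ∀ a ∈ Bs, (B.card : ℝ) ≤ 2 * (p : ℝ) ^ J *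
      (B.filter fun b : ℤ => (b : ZMod (p ^ J)) = (a : ZMod (p ^ J))).card := by
    intro a ha
    have := (Finset.mem_filter.mp (Finset.mem_filter.mp ha).1).2
    exact_mod_cast this
  have h1 := hpopc _ he1
  have h2 := hpopc _ he2
  set B₁ := B.filter fun b : ℤ => (b : ZMod (p ^ J)) = (e.1 : ZMod (p ^ J)) with hB₁
  set B₂ := B.filter fun b : ℤ => (b : ZMod (p ^ J)) = (e.2 : ZMod (p ^ J)) with hB₂
  have hB₁B : B₁ ⊆ B := Finset.filter_subset _ _
  have hB₂B : B₂ ⊆ B := Finset.filter_subset _ _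
  have hcong : ∀ z ∈ B₁ ×ˢ B₂, (p : ℤ) ^ J ∣ (z.1 - z.2) - (e.1 - e.2) := by
    intro z hz
    obtain ⟨hz1, hz2⟩ := Finset.mem_product.mp hz
    have k1 := (Finset.mem_filter.mp hz1).2
    have k2 := (Finset.mem_filter.mp hz2).2
    have : (((e.1 - e.2 : ℤ)) : ZMod (p ^ J)) = ((z.1 - z.2 : ℤ) : ZMod (p ^ J)) := by
      push_cast; rw [k1, k2]
    rw [ZMod.intCast_eq_intCast_iff_dvd_sub] at this
    exact_mod_cast this
  have hBsq : (E : ℝ) ^ 2 ≤ 100 * θ ^ 2 * ((p : ℝ) ^ J) ^ 2 * (B₁.card * B₂.card) := by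
    calc (E : ℝ) ^ 2 ≤ (5 * θ * B.card) ^ 2 := by gcongr
      _ = 25 * θ ^ 2 * (B.card * B.card) := by ring
      _ ≤ 25 * θ ^ 2 * ((2 * (p : ℝ) ^ J * B₁.card) * (2 * (p : ℝ) ^ J * B₂.card)) := by gcongr
      _ = _ := by ring
  have hp1 : (1 : ℝ) ≤ p := by exact_mod_cast hp.one_lt.le
  refine ⟨v, B₁, B₂, Bs, x, y, ?_, hv, hB₁B.trans hBA, hB₂B.trans hBA,
    ((Finset.filter_subset _ _).trans (Finset.filter_subset _ _)).trans hBA, hB₁B.trans hBI,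
    hB₂B.trans hBI, hBsI, ?_, hvs, e, he, fun z hz => hcong z (Finset.mem_filter.mp hz).1⟩
  · rcases hJ' with h | ⟨-, h⟩
    · by_contra hcon
      have : (p : ℝ) ^ J ≤ (p : ℝ) ^ v := pow_le_pow_right₀ hp1 (by omega)
      linarith
    · by_contra hcon
      have : (p : ℝ) ^ 1 ≤ (p : ℝ) ^ v := pow_le_pow_right₀ hp1 (by omega)
      rw [pow_one] at this
      linarith
  · rcases hJ' with h | ⟨rfl, h⟩
    · have hvJ : v < J := by
        by_contra hcon
        have : (p : ℝ) ^ J ≤ (p : ℝ) ^ v := pow_le_pow_right₀ hp1 (by omega)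
        linarith
      have hfull : valPairs p v B₁ B₂ = B₁ ×ˢ B₂ := by
        refine Finset.filter_true_of_mem fun z hz => ?_
        have hd := hcong z hz
        have d1 : (p : ℤ) ^ v ∣ (z.1 - z.2) - (e.1 - e.2) := (pow_dvd_pow _ hvJ.le).trans hd
        have d2 : (p : ℤ) ^ (v + 1) ∣ (z.1 - z.2) - (e.1 - e.2) := (pow_dvd_pow _ hvJ).trans hd
        refine ⟨(dvd_sub_left hep.2.1).mp d1, fun h => hep.2.2 ?_⟩
        exact (dvd_sub_right h).mp d2
      rw [hfull, Finset.card_product]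
      push_cast
      calc _ ≤ _ := hBsq
        _ ≤ θ * θ ^ 2 * (θ ^ 200) ^ 2 * (B₁.card * B₂.card) := by gcongr; linarith
        _ = _ := by ring
    · have hv0 : v = 0 := by
        by_contra hcon
        have : (p : ℝ) ^ 1 ≤ (p : ℝ) ^ v := pow_le_pow_right₀ hp1 (by omega)
        rw [pow_one] at this
        linarith
      subst hv0
      set C := (B ×ˢ B).filter fun z => (z.1 : ZMod p) = (z.2 : ZMod p) with hC
      have hcov : B₁ ×ˢ B₂ ⊆ valPairs p 0 B₁ B₂ ∪ C := by
        intro z hz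
        rw [Finset.mem_union]
        by_cases hd : (p : ℤ) ∣ z.1 - z.2
        · right
          refine Finset.mem_filter.mpr ⟨Finset.product_subset_product hB₁B hB₂B hz, ?_⟩
          rw [eq_comm, ZMod.intCast_eq_intCast_iff_dvd_sub]
          exact hd
        · left
          exact Finset.mem_filter.mpr ⟨hz, by simp, by simpa using hd⟩
      have k1 : (B₁.card : ℝ) * B₂.card ≤ (valPairs p 0 B₁ B₂).card + C.card := by
        have := (Finset.card_le_card hcov).trans (Finset.card_union_le _ _)
        rw [Finset.card_product] at this
        exact_mod_cast this
      have k2 : (C.card : ℝ) ≤ 2 * E ^ 2 / θ ^ 100 := by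
        have k3 := card_coincidences_le B x E p hp.pos hBI
        calc _ ≤ _ := k3
          _ ≤ (E : ℝ) * (E / θ ^ 100 + E / θ ^ 100) := by
              gcongr
              rw [one_le_div (by positivity)]
              linarith
          _ = _ := by ring
      have k3 : 100 * θ ^ 2 * (2 * (E : ℝ) ^ 2 / θ ^ 100) ≤ E ^ 2 / 2 := by
        have k4 : 400 * θ ^ 2 / θ ^ 100 ≤ 1 := by
          rw [div_le_one (by positivity)]
          calc 400 * θ ^ 2 ≤ θ * θ ^ 2 := by gcongr; linarith
            _ = θ ^ 3 := by ring
            _ ≤ _ := pow_le_pow_right₀ hθ1 (by norm_num)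
        calc _ = 400 * θ ^ 2 / θ ^ 100 * (E ^ 2 / 2) := by ring
          _ ≤ 1 * (E ^ 2 / 2) := by gcongr
          _ = _ := one_mul _
      simp only [pow_zero, one_pow, mul_one] at hBsq
      have k5 : (E : ℝ) ^ 2 ≤ 100 * θ ^ 2 * (valPairs p 0 B₁ B₂).card + E ^ 2 / 2 := by
        calc _ ≤ _ := hBsq
          _ ≤ 100 * θ ^ 2 * ((valPairs p 0 B₁ B₂).card + 2 * E ^ 2 / θ ^ 100) := by
              gcongr; exact k1.trans (by gcongr)
          _ ≤ _ := by rw [mul_add]; gcongr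
      have k6 : (200 : ℝ) * θ ^ 2 ≤ θ ^ 403 := by
        calc (200 : ℝ) * θ ^ 2 ≤ θ * θ ^ 2 := by gcongr; linarith
          _ = θ ^ 3 := by ring
          _ ≤ _ := pow_le_pow_right₀ hθ1 (by norm_num)
      calc (E : ℝ) ^ 2 ≤ 200 * θ ^ 2 * (valPairs p 0 B₁ B₂).card := by linarith
        _ ≤ _ := by gcongr

/-! ## Solving the reciprocal congruence -/

section Solve

open ZMod

lemma short_sum_bound {θ δ E n : ℝ} (hθ : 0 < θ) (hδ : θ ^ 8 ≤ δ) (hE : δ ^ 12 ≤ E)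
    (hn : E ^ 2 ≤ θ ^ 4 * n) : 2 * δ ^ 11 * (E * (E / δ ^ 12 + 1)) ≤ 4 / θ ^ 4 * n := by
  have hδ0 : 0 < δ := lt_of_lt_of_le (by positivity) hδ
  have hE0 : 0 < E := lt_of_lt_of_le (by positivity) hE
  calc 2 * δ ^ 11 * (E * (E / δ ^ 12 + 1)) ≤ 2 * δ ^ 11 * (E * (E / δ ^ 12 + E / δ ^ 12)) := by
        gcongr
        rwa [one_le_div (by positivity)]
    _ = 4 * E ^ 2 / δ := by field_simp; ring
    _ ≤ 4 * E ^ 2 / θ ^ 8 := by gcongr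
    _ ≤ 4 * (θ ^ 4 * n) / θ ^ 8 := by gcongr
    _ = _ := by field_simp

lemma long_sum_bound {θ δ E n : ℝ} (hθ : 0 < θ) (hδ : θ ^ 416 ≤ δ) (hE : δ ^ 11 * θ ^ 416 ≤ E)
    (hn : E ^ 2 ≤ θ ^ 403 * n) : 2 * δ ^ 11 * (E * (E / δ ^ 12 + 1)) ≤ 4 / θ ^ 13 * n := by
  have hδ0 : 0 < δ := lt_of_lt_of_le (by positivity) hδ
  have hE0 : 0 < E := lt_of_lt_of_le (by positivity) hE
  have h1 : δ ^ 11 ≤ E / θ ^ 416 := by rwa [le_div_iff₀ (by positivity)]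
  calc 2 * δ ^ 11 * (E * (E / δ ^ 12 + 1)) = 2 * E ^ 2 / δ + 2 * δ ^ 11 * E := by
        field_simp
    _ ≤ 2 * E ^ 2 / θ ^ 416 + 2 * (E / θ ^ 416) * E := by gcongr
    _ = 4 / θ ^ 416 * E ^ 2 := by ring
    _ ≤ 4 / θ ^ 416 * (θ ^ 403 * n) := by gcongr
    _ = 4 / (θ ^ 13 * θ ^ 403) * (θ ^ 403 * n) := by rw [← pow_add]
    _ = _ := by field_simp

lemma card_coincidences_pow_mul_le {p v K : ℕ} (hp : p.Prime) (A : Finset ℤ) {N r : ℤ}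
    (hr : 0 < r) (hN : N = (p : ℤ) ^ K * r) (hA : ∀ a ∈ A, -N ≤ a ∧ a ≤ 2 * N) :
    ((p : ℝ) ^ K) * (((A ×ˢ A).filter fun z =>
      (((p : ℤ) ^ v * z.1 : ℤ) : ZMod (p ^ (K + v))) =
        (((p : ℤ) ^ v * z.2 : ℤ) : ZMod (p ^ (K + v)))).card : ℝ) ≤ 20 * (N : ℝ) ^ 2 := by
  have hpK : (0 : ℤ) < (p : ℤ) ^ K := pow_pos (by exact_mod_cast hp.pos) _
  have hpv : (p : ℤ) ^ v ≠ 0 := pow_ne_zero _ (by exact_mod_cast hp.ne_zero)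
  have hN0 : 0 < N := by rw [hN]; positivity
  have hfilter : ((A ×ˢ A).filter fun z =>
      (((p : ℤ) ^ v * z.1 : ℤ) : ZMod (p ^ (K + v))) =
        (((p : ℤ) ^ v * z.2 : ℤ) : ZMod (p ^ (K + v)))) =
      (A ×ˢ A).filter fun z => (z.1 : ZMod (p ^ K)) = (z.2 : ZMod (p ^ K)) := by
    refine Finset.filter_congr fun z _ => ?_
    rw [intCast_eq_pow_mul_iff hp, Int.mul_ediv_cancel_left _ hpv]
    simp
  rw [hfilter]
  have hT : (((3 * N + 1).toNat : ℕ) : ℤ) = 3 * N + 1 := Int.toNat_of_nonneg (by omega)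
  have h1 := card_coincidences_le A (-N) (3 * N + 1).toNat (p ^ K) (pow_pos hp.pos _) (by
    intro a ha
    have := hA a ha
    rw [Finset.mem_Ico, hT]
    constructor <;> linarith)
  have hTr : (((3 * N + 1).toNat : ℕ) : ℝ) = 3 * N + 1 := by exact_mod_cast hT
  rw [hTr] at h1
  push_cast at h1
  have hNr : (1 : ℝ) ≤ N := by exact_mod_cast hN0
  have hpr : (0 : ℝ) < (p : ℝ) ^ K := by exact_mod_cast hpK
  have hpN : (p : ℝ) ^ K ≤ N := by
    have : (p : ℤ) ^ K ≤ N := by rw [hN]; nlinarith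
    exact_mod_cast this
  calc _ ≤ (p : ℝ) ^ K * ((3 * N + 1) * ((3 * N + 1) / (p : ℝ) ^ K + 1)) := by gcongr
    _ = (3 * N + 1) * ((3 * N + 1) + (p : ℝ) ^ K) := by field_simp
    _ ≤ (4 * N) * (5 * N) := by gcongr <;> linarith
    _ = _ := by ring

theorem exists_reciprocal_solution {p J K v X : ℕ} (hp : p.Prime) {θ : ℝ} (hθ : 2000 ≤ θ)
    {E Es : ℕ} (hEs : θ ^ 4992 ≤ Es) (hX : (p : ℝ) ^ (K + v) ≤ θ ^ (12 * X))
    (hE : θ ^ (11 * X + 416) ≤ E) (hvJ : v ≤ J) (hpv : (p : ℝ) ^ v ≤ θ ^ 4)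
    (hj : θ ^ 96 ≤ (p : ℝ) ^ (J - v + 1)) {A : Finset ℤ} {N r : ℤ}
    (hr : 0 < r) (hN : N = (p : ℤ) ^ K * r) (hA : ∀ a ∈ A, -N ≤ a ∧ a ≤ 2 * N)
    (hcard : (N : ℝ) ≤ θ * A.card) {B₁ B₂ Bs : Finset ℤ} {x y : ℤ}
    (hB₁ : B₁ ⊆ Finset.Ico x (x + E)) (hB₂ : B₂ ⊆ Finset.Ico x (x + E))
    (hBs : Bs ⊆ Finset.Ico y (y + Es))
    (hcard₁ : (E : ℝ) ^ 2 ≤ θ ^ 403 * (valPairs p v B₁ B₂).card)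
    (hcards : (Es : ℝ) ^ 2 ≤ θ ^ 4 * (valPairs p v Bs Bs).card) {e : ℤ × ℤ}
    (he : e ∈ valPairs p v Bs Bs)
    (hcong : ∀ z ∈ valPairs p v B₁ B₂, (p : ℤ) ^ J ∣ (z.1 - z.2) - (e.1 - e.2)) {c : ℤ}
    (hc : (p : ℤ) ^ (J - v) ∣ c) :
    ∃ z ∈ valPairs p v B₁ B₂, ∃ f ∈ valPairs p v Bs Bs, ∃ f' ∈ valPairs p v Bs Bs,
      ∃ a ∈ A, ∃ a' ∈ A, recipDiff p v (K + v) z + recipDiff p v (K + v) f -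
        recipDiff p v (K + v) f' + (((p : ℤ) ^ v * a : ℤ) : ZMod (p ^ (K + v))) -
        (((p : ℤ) ^ v * a' : ℤ) : ZMod (p ^ (K + v))) = c + recipDiff p v (K + v) e := by
  have hθ0 : 0 < θ := by linarith
  have hθ1 : 1 ≤ θ := by linarith
  have hne : NeZero (p ^ (K + v)) := ⟨(pow_pos hp.pos _).ne'⟩
  have hE0 : (0 : ℝ) < E := lt_of_lt_of_le (by positivity) hE
  have hp1 : (1 : ℝ) ≤ p := by exact_mod_cast hp.one_lt.le
  have hpv0 : (p : ℤ) ^ v ≠ 0 := pow_ne_zero _ (by exact_mod_cast hp.ne_zero)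
  refine exists_solution (valPairs p v B₁ B₂) (valPairs p v Bs Bs) A (recipDiff p v (K + v))
    (recipDiff p v (K + v)) (fun a => (((p : ℤ) ^ v * a : ℤ) : ZMod (p ^ (K + v))))
    (c + recipDiff p v (K + v) e) {ξ | ξ * (p : ZMod (p ^ (K + v))) ^ (J - v) = 0} (by simp) ?_
    ⟨e, he⟩ ?_ (ε := 1 / θ ^ 7) (by positivity) ?_ ?_
  · rw [← Finset.card_pos]
    by_contra hcon
    have h0 : (valPairs p v B₁ B₂).card = 0 := by omega
    rw [h0, Nat.cast_zero, mul_zero] at hcard₁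
    have : 0 < (E : ℝ) ^ 2 := by positivity
    linarith
  · intro ξ hξ z hz
    change ξ * (p : ZMod (p ^ (K + v))) ^ (J - v) = 0 at hξ
    obtain ⟨c', hc'⟩ := hc
    obtain ⟨w, hw⟩ := hcong z hz
    have hz1 := mul_recipDiff (m := K + v) hp hz
    have he1 := mul_recipDiff (m := K + v) hp he
    obtain ⟨z', hz'⟩ := (Finset.mem_filter.mp hz).2.1
    obtain ⟨e', he'⟩ := (Finset.mem_filter.mp he).2.1
    rw [hz', Int.mul_ediv_cancel_left _ hpv0] at hz1
    rw [he', Int.mul_ediv_cancel_left _ hpv0] at he1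
    have hdiff : z' - e' = (p : ℤ) ^ (J - v) * w := by
      have h1 : (p : ℤ) ^ J = (p : ℤ) ^ v * (p : ℤ) ^ (J - v) := by
        rw [← pow_add, Nat.add_sub_cancel' hvJ]
      rw [hz', he', ← mul_sub, h1, mul_assoc] at hw
      exact mul_left_cancel₀ hpv0 hw
    have hdiff' : (z' : ZMod (p ^ (K + v))) - e' = (p : ZMod (p ^ (K + v))) ^ (J - v) * w := by
      exact_mod_cast congrArg (Int.cast : ℤ → ZMod (p ^ (K + v))) hdiff
    have hcc : (c : ZMod (p ^ (K + v))) = (p : ZMod (p ^ (K + v))) ^ (J - v) * c' := by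
      rw [hc']; push_cast; rfl
    rw [hcc]
    generalize recipDiff p v (K + v) z = ιz at *
    generalize recipDiff p v (K + v) e = ιe at *
    linear_combination (-(c' : ZMod (p ^ (K + v))) - w * ιz * ιe) * hξ -
      ξ * ιz * ιe * hdiff' - ξ * ιz * he1 + ξ * ιe * hz1
  · intro ξ hξ
    change ¬ ξ * (p : ZMod (p ^ (K + v))) ^ (J - v) = 0 at hξ
    obtain ⟨i, hji, hiM, hbound⟩ := norm_sum_recipDiff_le hp hξ
    set n₁ : ℝ := ((valPairs p v B₁ B₂).card : ℝ)
    set ns : ℝ := ((valPairs p v Bs Bs).card : ℝ)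
    have hn₁ : 0 ≤ n₁ := Nat.cast_nonneg _
    have hns : 0 ≤ ns := Nat.cast_nonneg _
    have htriv : ∀ S : Finset (ℤ × ℤ), ‖∑ z ∈ S, stdAddChar (ξ * recipDiff p v (K + v) z)‖ ≤
        S.card := by
      intro S
      refine (norm_sum_le _ _).trans ?_
      simp
    obtain ⟨δ, hδ0, hδ⟩ : ∃ δ : ℝ, 0 < δ ∧ δ ^ 12 = (p : ℝ) ^ i :=
      ⟨((p : ℝ) ^ i) ^ (((12 : ℕ) : ℝ)⁻¹), by positivity,
        Real.rpow_inv_natCast_pow (by positivity) (by norm_num)⟩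
    by_cases hd : δ ^ 12 ≤ Es
    · have hδ8 : θ ^ 8 ≤ δ := by
        refine le_of_pow_le_pow_left₀ (n := 12) (by norm_num) hδ0.le ?_
        rw [hδ, ← pow_mul]
        exact hj.trans (pow_le_pow_right₀ hp1 hji)
      have h1 := (hbound v Bs Bs y y Es δ hBs hBs hδ0 hδ).trans (short_sum_bound hθ0 hδ8 hd hcards)
      calc _ ≤ n₁ * (4 / θ ^ 4 * ns) ^ 2 := by
            gcongr
            exact htriv _
        _ = 16 / θ * (1 / θ ^ 7 * (n₁ * ns ^ 2)) := by field_simp; ring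
        _ ≤ 1 * (1 / θ ^ 7 * (n₁ * ns ^ 2)) := by
            gcongr
            rw [div_le_one hθ0]; linarith
        _ = _ := one_mul _
    · push Not at hd
      have hδ416 : θ ^ 416 ≤ δ := by
        refine le_of_pow_le_pow_left₀ (n := 12) (by norm_num) hδ0.le ?_
        rw [← pow_mul]
        exact hEs.trans hd.le
      have hδX : δ ≤ θ ^ X := by
        refine le_of_pow_le_pow_left₀ (n := 12) (by norm_num) (by positivity) ?_
        rw [hδ, ← pow_mul, mul_comm X]
        exact (pow_le_pow_right₀ hp1 hiM).trans hX
      have hδE : δ ^ 11 * θ ^ 416 ≤ E := by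
        calc δ ^ 11 * θ ^ 416 ≤ (θ ^ X) ^ 11 * θ ^ 416 := by gcongr
          _ = θ ^ (11 * X + 416) := by rw [← pow_mul, ← pow_add, mul_comm X]
          _ ≤ E := hE
      have h1 := (hbound v B₁ B₂ x x E δ hB₁ hB₂ hδ0 hδ).trans
        (long_sum_bound hθ0 hδ416 hδE hcard₁)
      calc _ ≤ (4 / θ ^ 13 * n₁) * ns ^ 2 := by
            gcongr
            exact htriv _
        _ = 4 / θ ^ 6 * (1 / θ ^ 7 * (n₁ * ns ^ 2)) := by field_simp
        _ ≤ 1 * (1 / θ ^ 7 * (n₁ * ns ^ 2)) := by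
            gcongr
            rw [div_le_one (by positivity)]
            have : θ ^ 1 ≤ θ ^ 6 := pow_le_pow_right₀ hθ1 (by norm_num)
            linarith
        _ = _ := one_mul _
  · have h1 := card_coincidences_pow_mul_le (v := v) hp A hr hN hA
    set n := (((A ×ˢ A).filter fun z => (((p : ℤ) ^ v * z.1 : ℤ) : ZMod (p ^ (K + v))) =
        (((p : ℤ) ^ v * z.2 : ℤ) : ZMod (p ^ (K + v)))).card : ℝ)
    have hN0 : (0 : ℝ) < N := by
      have : 0 < N := by
        rw [hN]
        have := hp.pos
        positivity
      exact_mod_cast this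
    have hA0 : (0 : ℝ) < A.card := by
      by_contra hcon
      push Not at hcon
      nlinarith
    push_cast
    calc 1 / θ ^ 7 * ((p : ℝ) ^ (K + v) * n) = 1 / θ ^ 7 * ((p : ℝ) ^ v * ((p : ℝ) ^ K * n)) := by
          rw [pow_add]; ring
      _ ≤ 1 / θ ^ 7 * (θ ^ 4 * (20 * (θ * A.card) ^ 2)) := by
          exact mul_le_mul_of_nonneg_left
            (mul_le_mul hpv (h1.trans (by gcongr)) (by positivity) (by positivity)) (by positivity)
      _ = 20 / θ * (A.card : ℝ) ^ 2 := by field_simp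
      _ < 1 * (A.card : ℝ) ^ 2 := by
          gcongr
          rw [div_lt_one hθ0]; linarith
      _ = _ := one_mul _

end Solve

/-! ## Splitting off a fraction with smaller denominator -/

section Split

lemma exists_eq_intCast_div_of_zmod {m : ℕ} {b q s g r a a' D₁ D₂ D₃ D₄ : ℤ}
    (hm : (m : ℤ) = q * s * g) (hm0 : m ≠ 0) (hr : r ≠ 0)
    (hD₁ : D₁ ≠ 0) (hD₂ : D₂ ≠ 0) (hD₃ : D₃ ≠ 0) (hD₄ : D₄ ≠ 0) {i₁ i₂ i₃ i₄ : ZMod m}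
    (h₁ : (D₁ : ZMod m) * i₁ = 1) (h₂ : (D₂ : ZMod m) * i₂ = 1) (h₃ : (D₃ : ZMod m) * i₃ = 1)
    (h₄ : (D₄ : ZMod m) * i₄ = 1)
    (h : i₁ + i₂ - i₃ + ((g * a : ℤ) : ZMod m) - ((g * a' : ℤ) : ZMod m) =
      ((g * s * b * r : ℤ) : ZMod m) + i₄) :
    ∃ w : ℤ, (b : ℚ) / q - (1 / ((q * s * r : ℚ) * (g * D₁)) + 1 / ((q * s * r : ℚ) * (g * D₂)) -
      1 / ((q * s * r : ℚ) * (g * D₃)) - 1 / ((q * s * r : ℚ) * (g * D₄)) +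
      (a / (q * s * r : ℚ) - a' / (q * s * r : ℚ))) = w / ((r * D₁ * D₂ * D₃ * D₄ : ℤ) : ℚ) := by
  have hdvd : (m : ℤ) ∣ b * r * s * g * (D₁ * D₂ * D₃ * D₄) - (D₂ * D₃ * D₄ + D₁ * D₃ * D₄ -
      D₁ * D₂ * D₄ - D₁ * D₂ * D₃) - g * (a - a') * (D₁ * D₂ * D₃ * D₄) := by
    rw [← ZMod.intCast_zmod_eq_zero_iff_dvd]
    push_cast at h ⊢
    linear_combination (-(D₁ * D₂ * D₃ * D₄ : ZMod m)) * h + (D₂ * D₃ * D₄ : ZMod m) * h₁ +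
      (D₁ * D₃ * D₄ : ZMod m) * h₂ - (D₁ * D₂ * D₄ : ZMod m) * h₃ - (D₁ * D₂ * D₃ : ZMod m) * h₄
  obtain ⟨w, hw⟩ := hdvd
  have hqsg : q * s * g ≠ 0 := by rw [← hm]; exact_mod_cast hm0
  have hg : (g : ℚ) ≠ 0 := by exact_mod_cast right_ne_zero_of_mul hqsg
  have hq : (q : ℚ) ≠ 0 := by exact_mod_cast left_ne_zero_of_mul (left_ne_zero_of_mul hqsg)
  have hs : (s : ℚ) ≠ 0 := by exact_mod_cast right_ne_zero_of_mul (left_ne_zero_of_mul hqsg)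
  refine ⟨w, ?_⟩
  rw [hm] at hw
  have hw' := congrArg (Int.cast : ℤ → ℚ) hw
  push_cast at hw' ⊢
  have hr' : (r : ℚ) ≠ 0 := by exact_mod_cast hr
  have hD₁' : (D₁ : ℚ) ≠ 0 := by exact_mod_cast hD₁
  have hD₂' : (D₂ : ℚ) ≠ 0 := by exact_mod_cast hD₂
  have hD₃' : (D₃ : ℚ) ≠ 0 := by exact_mod_cast hD₃
  have hD₄' : (D₄ : ℚ) ≠ 0 := by exact_mod_cast hD₄
  rw [eq_div_iff (by positivity), ← mul_right_inj' (mul_ne_zero (mul_ne_zero hq hs) hg), ← hw']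
  field_simp
  ring

lemma exists_quotient_of_mem_valPairs {p v m : ℕ} (hp : p.Prime) {B₁ B₂ : Finset ℤ} {x : ℤ} {E : ℕ}
    (hB₁ : B₁ ⊆ Finset.Ico x (x + E)) (hB₂ : B₂ ⊆ Finset.Ico x (x + E)) {z : ℤ × ℤ}
    (hz : z ∈ valPairs p v B₁ B₂) :
    ∃ D : ℤ, D ≠ 0 ∧ |D| ≤ E ∧ z.1 - z.2 = (p : ℤ) ^ v * D ∧
      (D : ZMod (p ^ m)) * recipDiff p v m z = 1 := by
  have h := mul_recipDiff (m := m) hp hz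
  have hpos : (0 : ℤ) < (p : ℤ) ^ v := pow_pos (by exact_mod_cast hp.pos) _
  obtain ⟨hzB, ⟨D, hD⟩, hnd⟩ := Finset.mem_filter.mp hz
  rw [hD, Int.mul_ediv_cancel_left _ hpos.ne'] at h
  refine ⟨D, ?_, ?_, hD, h⟩
  · rintro rfl
    exact hnd (by rw [hD, mul_zero]; exact dvd_zero _)
  · rw [Finset.mem_product] at hzB
    have h1 := Finset.mem_Ico.mp (hB₁ hzB.1)
    have h2 := Finset.mem_Ico.mp (hB₂ hzB.2)
    have h3 : |z.1 - z.2| ≤ E := by rw [abs_le]; constructor <;> linarith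
    rw [hD, abs_mul, abs_of_pos hpos] at h3
    nlinarith [abs_nonneg D]

lemma modCost_one_div_of_mem_valPairs {p v L : ℕ} {A B₁ B₂ : Finset ℤ} {N : ℤ} (hN : N ≠ 0)
    (hA : ∀ a ∈ A, IsCheapNumerator L N a) (hB₁ : B₁ ⊆ A) (hB₂ : B₂ ⊆ A) {z : ℤ × ℤ}
    (hz : z ∈ valPairs p v B₁ B₂) : ModCost (1 / ((N : ℚ) * (z.1 - z.2))) (6 * L + 2) := by
  obtain ⟨hzB, -, hnd⟩ := Finset.mem_filter.mp hz
  rw [Finset.mem_product] at hzB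
  refine (hA _ (hB₁ hzB.1)).modCost_one_div (hA _ (hB₂ hzB.2)) hN fun h => hnd ?_
  rw [h, sub_self]
  exact dvd_zero _

theorem exists_split_of_cheap_numerators {p J K k X L : ℕ} (hp : p.Prime) {θ : ℝ} (hθ : 2000 ≤ θ)
    {E Es : ℕ} (hEs : θ ^ 4992 ≤ Es) (hEsE : Es ≤ E) (hX : (p : ℝ) ^ K * θ ^ 4 ≤ θ ^ (12 * X))
    (hE : θ ^ (11 * X + 416) ≤ E) (hJ : (p : ℝ) ^ J ≤ θ ^ 200)
    (hJ' : θ ^ 100 < (p : ℝ) ^ J ∨ (J = 0 ∧ θ ^ 100 < (p : ℝ))) (hK : k + J ≤ K)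
    {A : Finset ℤ} {N r : ℤ} (hr : 0 < r) (hN : N = (p : ℤ) ^ K * r) (hEN : (E : ℤ) ≤ N)
    (hA : ∀ a ∈ A, -N ≤ a ∧ a ≤ 2 * N) (hcheap : ∀ a ∈ A, IsCheapNumerator L N a)
    (hcard : (N : ℝ) ≤ θ * A.card) (b : ℤ) :
    ∃ x y : ℚ, (b : ℚ) / (p : ℚ) ^ k = x + y ∧ ModCost x (28 * (L + 1)) ∧
      (y.den : ℝ) ≤ r * E * (Es : ℝ) ^ 3 := by
  have hθ0 : 0 < θ := by linarith
  have hθ1 : 1 ≤ θ := by linarith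
  have hp1 : (1 : ℝ) ≤ p := by exact_mod_cast hp.one_lt.le
  have hp0 : (p : ℤ) ≠ 0 := by exact_mod_cast hp.ne_zero
  obtain ⟨v, B₁, B₂, Bs, x, y, hvJ, hpv, hB₁A, hB₂A, hBsA, hB₁, hB₂, hBs, hc₁, hcs, e, he, hcong⟩ :=
    exists_structured_pairs hp hθ E Es
      ((pow_le_pow_right₀ hθ1 (by norm_num)).trans hEs) hEsE A N hEN hA hcard hJ hJ'
  have hj : θ ^ 96 ≤ (p : ℝ) ^ (J - v + 1) := by
    rcases hJ' with h | ⟨rfl, h⟩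
    · have h1 : θ ^ 96 * θ ^ 4 ≤ (p : ℝ) ^ (J - v) * θ ^ 4 := by
        calc θ ^ 96 * θ ^ 4 = θ ^ 100 := by rw [← pow_add]
          _ ≤ (p : ℝ) ^ J := h.le
          _ = (p : ℝ) ^ (J - v) * (p : ℝ) ^ v := by rw [← pow_add, Nat.sub_add_cancel hvJ]
          _ ≤ _ := by gcongr
      exact (le_of_mul_le_mul_right h1 (by positivity)).trans
        (pow_le_pow_right₀ hp1 (Nat.le_succ _))
    · rw [Nat.zero_sub, zero_add, pow_one]
      exact (pow_le_pow_right₀ hθ1 (by norm_num)).trans h.le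
  have hKv : (p : ℝ) ^ (K + v) ≤ θ ^ (12 * X) := by
    refine le_trans ?_ hX
    rw [pow_add]
    gcongr
  have hN0 : N ≠ 0 := by
    rw [hN]
    exact mul_ne_zero (pow_ne_zero _ hp0) hr.ne'
  obtain ⟨z, hz, f, hf, f', hf', a, ha, a', ha', heq⟩ :=
    exists_reciprocal_solution (c := (p : ℤ) ^ v * (p : ℤ) ^ (K - k) * b * r) hp hθ hEs hKv hE hvJ
      hpv hj hr hN hA hcard hB₁ hB₂ hBs hc₁ hcs he hcong
      (Dvd.dvd.mul_right (Dvd.dvd.mul_right (Dvd.dvd.mul_left (pow_dvd_pow _ (by omega)) _) _) _)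
  obtain ⟨D₁, hD₁, hD₁E, hD₁z, hD₁i⟩ := exists_quotient_of_mem_valPairs (m := K + v) hp hB₁ hB₂ hz
  obtain ⟨D₂, hD₂, hD₂E, hD₂z, hD₂i⟩ := exists_quotient_of_mem_valPairs (m := K + v) hp hBs hBs hf
  obtain ⟨D₃, hD₃, hD₃E, hD₃z, hD₃i⟩ := exists_quotient_of_mem_valPairs (m := K + v) hp hBs hBs hf'
  obtain ⟨D₄, hD₄, hD₄E, hD₄z, hD₄i⟩ := exists_quotient_of_mem_valPairs (m := K + v) hp hBs hBs he
  have hK' : (p : ℤ) ^ K = (p : ℤ) ^ k * (p : ℤ) ^ (K - k) := by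
    rw [← pow_add, Nat.add_sub_cancel' (by omega)]
  obtain ⟨w, hw⟩ := exists_eq_intCast_div_of_zmod (q := (p : ℤ) ^ k)
    (by push_cast; rw [pow_add, hK']) (pow_ne_zero _ hp.ne_zero) hr.ne' hD₁ hD₂ hD₃ hD₄
    hD₁i hD₂i hD₃i hD₄i heq
  have hNq : (N : ℚ) = (((p : ℤ) ^ k : ℤ) : ℚ) * (((p : ℤ) ^ (K - k) : ℤ) : ℚ) * (r : ℚ) := by
    rw [hN, hK']; push_cast; rfl
  have hcast : ∀ {u : ℤ × ℤ} {D : ℤ}, u.1 - u.2 = (p : ℤ) ^ v * D →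
      (((p : ℤ) ^ v : ℤ) : ℚ) * (D : ℚ) = (u.1 : ℚ) - u.2 := by
    intro u D h
    exact_mod_cast h.symm
  rw [hcast hD₁z, hcast hD₂z, hcast hD₃z, hcast hD₄z, ← hNq] at hw
  have hcost := ((((modCost_one_div_of_mem_valPairs hN0 hcheap hB₁A hB₂A hz).add
    (modCost_one_div_of_mem_valPairs hN0 hcheap hBsA hBsA hf)).sub
    (modCost_one_div_of_mem_valPairs hN0 hcheap hBsA hBsA hf')).sub
    (modCost_one_div_of_mem_valPairs hN0 hcheap hBsA hBsA he)).add
    ((hcheap a ha).modCost_div.sub (hcheap a' ha').modCost_div)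
  refine ⟨_, (w : ℚ) / ((r * D₁ * D₂ * D₃ * D₄ : ℤ) : ℚ), ?_, hcost.mono (by omega), ?_⟩
  · rw [← hw]
    push_cast
    ring
  · have hdvd := Rat.den_dvd w (r * D₁ * D₂ * D₃ * D₄)
    have hne : r * D₁ * D₂ * D₃ * D₄ ≠ 0 := by positivity
    rw [Rat.divInt_eq_div] at hdvd
    have h1 := Int.le_of_dvd (abs_pos.mpr hne) ((dvd_abs _ _).mpr hdvd)
    rw [abs_mul, abs_mul, abs_mul, abs_mul, abs_of_pos hr] at h1
    have h2 : r * |D₁| * |D₂| * |D₃| * |D₄| ≤ r * E * Es * Es * Es := by gcongr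
    calc _ ≤ (r : ℝ) * E * Es * Es * Es := by exact_mod_cast h1.trans h2
      _ = _ := by ring

lemma exists_pow_between {p : ℕ} (hp : p.Prime) {θ : ℝ} (hθ : 1 ≤ θ) :
    ∃ J : ℕ, (p : ℝ) ^ J ≤ θ ^ 200 ∧ (θ ^ 100 < (p : ℝ) ^ J ∨ (J = 0 ∧ θ ^ 100 < (p : ℝ))) := by
  rcases lt_or_ge (θ ^ 100) (p : ℝ) with h | h
  · exact ⟨0, by simpa using one_le_pow₀ hθ, Or.inr ⟨rfl, h⟩⟩
  · obtain ⟨n, hn, hn'⟩ := exists_nat_pow_near (one_le_pow₀ hθ : 1 ≤ θ ^ 100)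
      (by exact_mod_cast hp.one_lt : (1 : ℝ) < p)
    refine ⟨n + 1, ?_, Or.inl hn'⟩
    calc (p : ℝ) ^ (n + 1) = (p : ℝ) ^ n * p := pow_succ _ _
      _ ≤ θ ^ 100 * θ ^ 100 := by gcongr
      _ = θ ^ 200 := by rw [← pow_add]

lemma exists_nat_between_pow {θ : ℝ} (hθ : 1 ≤ θ) (n : ℕ) :
    ∃ E : ℕ, θ ^ n ≤ E ∧ (E : ℝ) ≤ 2 * θ ^ n := by
  have h1 : 1 ≤ θ ^ n := one_le_pow₀ hθ
  have h2 := Nat.ceil_lt_add_one (a := θ ^ n) (by positivity)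
  exact ⟨⌈θ ^ n⌉₊, Nat.le_ceil _, by linarith⟩

lemma exists_split_of_root {H : ℕ} (hH : H = 1000000) {C : ℝ} (hC : 1 ≤ C)
    (hdense : ∀ p κ : ℕ, p.Prime → 16 ≤ p ^ κ →
      ∃ (G : ℝ) (N : ℤ) (L : ℕ) (A : Finset ℤ), 1 ≤ G ∧ G ^ (16 * H) ≤ 4 * (p : ℝ) ^ κ ∧ 0 < N ∧
        (p : ℤ) ^ κ ∣ N ∧ (N : ℝ) ≤ C * G * (p : ℝ) ^ κ ∧ (p : ℝ) ^ κ ≤ C * G * A.card ∧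
        (L : ℝ) ≤ C * (Real.log ((p : ℝ) ^ κ) + 1) ∧
        ∀ a ∈ A, -N ≤ a ∧ a ≤ 2 * N ∧ IsCheapNumerator L N a)
    {p k : ℕ} (hp : p.Prime) {θ : ℝ} (hθ : 2000 ≤ θ) (hCθ : C ^ 4 ≤ θ) (hq : θ ^ H = (p : ℝ) ^ k)
    (b : ℤ) :
    ∃ (x y : ℚ) (n : ℕ), (b : ℚ) / (p : ℚ) ^ k = x + y ∧ ModCost x n ∧
      (n : ℝ) ≤ 112 * C * Real.log ((p : ℝ) ^ k) ∧ (y.den : ℝ) ^ 100 ≤ ((p : ℝ) ^ k) ^ 99 := by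
  have hθ0 : 0 < θ := by linarith
  have hθ1 : 1 ≤ θ := by linarith
  have hp1 : (1 : ℝ) ≤ p := by exact_mod_cast hp.one_lt.le
  have hqθ : θ ≤ (p : ℝ) ^ k := by
    rw [← hq]
    exact le_self_pow₀ hθ1 (by omega)
  obtain ⟨J, hJ, hJ'⟩ := exists_pow_between hp hθ1
  have hQ : (p : ℝ) ^ (k + J) ≤ θ ^ (H + 200) := by
    rw [pow_add, ← hq, pow_add]
    gcongr
  have hqQ : (p : ℝ) ^ k ≤ (p : ℝ) ^ (k + J) := pow_le_pow_right₀ hp1 (by omega)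
  obtain ⟨G, N, L, A, hG, hGQ, hN0, ⟨r, hr⟩, hNle, hAle, hL, hA⟩ := hdense p (k + J) hp (by
    have : (16 : ℝ) ≤ (p : ℝ) ^ (k + J) := by linarith
    exact_mod_cast this)
  have hpQ : (0 : ℤ) < (p : ℤ) ^ (k + J) := pow_pos (by exact_mod_cast hp.pos) _
  have hpQr : (0 : ℝ) < (p : ℝ) ^ (k + J) := by exact_mod_cast hpQ
  have hr0 : 0 < r := by
    by_contra hcon
    push Not at hcon
    have := mul_nonpos_of_nonneg_of_nonpos hpQ.le hcon
    omega
  have hG4 : G ^ 4 ≤ θ := by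
    refine le_of_pow_le_pow_left₀ (n := 4 * H) (by omega) hθ0.le ?_
    calc (G ^ 4) ^ (4 * H) = G ^ (16 * H) := by rw [← pow_mul]; congr 1; ring
      _ ≤ 4 * (p : ℝ) ^ (k + J) := hGQ
      _ ≤ θ * θ ^ (H + 200) := by gcongr; linarith
      _ = θ ^ (H + 200 + 1) := by rw [pow_succ]; ring
      _ ≤ θ ^ (4 * H) := pow_le_pow_right₀ hθ1 (by omega)
  have hCG : (C * G) ^ 2 ≤ θ := by
    refine le_of_pow_le_pow_left₀ (n := 2) (by omega) hθ0.le ?_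
    calc ((C * G) ^ 2) ^ 2 = C ^ 4 * G ^ 4 := by ring
      _ ≤ θ * θ := by gcongr
      _ = θ ^ 2 := by ring
  have hCG1 : 1 ≤ C * G := by nlinarith
  have hCGθ : C * G ≤ θ := by nlinarith
  have hNθ : (N : ℝ) ≤ θ * (p : ℝ) ^ (k + J) := hNle.trans (by gcongr)
  have hcard : (N : ℝ) ≤ θ * A.card := by
    calc (N : ℝ) ≤ C * G * (p : ℝ) ^ (k + J) := hNle
      _ ≤ C * G * (C * G * A.card) := by gcongr
      _ = (C * G) ^ 2 * A.card := by ring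
      _ ≤ _ := by gcongr
  have hrθ : (r : ℝ) ≤ θ := by
    have h1 : (N : ℝ) = (p : ℝ) ^ (k + J) * r := by rw [hr]; push_cast; rfl
    rw [h1, mul_comm θ] at hNθ
    exact le_of_mul_le_mul_left hNθ hpQr
  obtain ⟨D, hD⟩ : ∃ n : ℕ, n = 960000 := ⟨_, rfl⟩
  obtain ⟨F, hF⟩ : ∃ n : ℕ, n = 5000 := ⟨_, rfl⟩
  obtain ⟨X, hXe⟩ : ∃ n : ℕ, n = 83351 := ⟨_, rfl⟩
  obtain ⟨E, hE, hE'⟩ := exists_nat_between_pow hθ1 D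
  obtain ⟨Es, hEs, hEs'⟩ := exists_nat_between_pow hθ1 F
  have hEsE : Es ≤ E := by
    have : (Es : ℝ) ≤ E := by
      calc (Es : ℝ) ≤ 2 * θ ^ F := hEs'
        _ ≤ θ * θ ^ F := by gcongr; linarith
        _ = θ ^ (F + 1) := by rw [pow_succ]; ring
        _ ≤ θ ^ D := pow_le_pow_right₀ hθ1 (by omega)
        _ ≤ E := hE
    exact_mod_cast this
  have hEN : (E : ℤ) ≤ N := by
    have h1 : (E : ℝ) ≤ (p : ℝ) ^ (k + J) := by
      calc (E : ℝ) ≤ 2 * θ ^ D := hE'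
        _ ≤ θ * θ ^ D := by gcongr; linarith
        _ = θ ^ (D + 1) := by rw [pow_succ]; ring
        _ ≤ θ ^ H := pow_le_pow_right₀ hθ1 (by omega)
        _ ≤ _ := hq.le.trans hqQ
    have h2 : (E : ℤ) ≤ (p : ℤ) ^ (k + J) := by exact_mod_cast h1
    rw [hr]
    nlinarith
  obtain ⟨x, y, hxy, hx, hy⟩ := exists_split_of_cheap_numerators (X := X) hp hθ
    ((pow_le_pow_right₀ hθ1 (by omega)).trans hEs) hEsE (by
      calc (p : ℝ) ^ (k + J) * θ ^ 4 ≤ θ ^ (H + 200) * θ ^ 4 := by gcongr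
        _ = θ ^ (H + 200 + 4) := by rw [pow_add θ (H + 200)]
        _ ≤ _ := pow_le_pow_right₀ hθ1 (by omega))
    ((pow_le_pow_right₀ hθ1 (by omega)).trans hE) hJ hJ' le_rfl hr0 hr hEN
    (fun a ha => ⟨(hA a ha).1, (hA a ha).2.1⟩) (fun a ha => (hA a ha).2.2) hcard b
  refine ⟨x, y, _, hxy, hx, ?_, ?_⟩
  · have hlog1 : 1 ≤ Real.log ((p : ℝ) ^ k) := by
      rw [Real.le_log_iff_exp_le (by positivity)]
      linarith [Real.exp_one_lt_d9]
    have hlogQ : Real.log ((p : ℝ) ^ (k + J)) ≤ 2 * Real.log ((p : ℝ) ^ k) := by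
      rw [← Nat.cast_two, ← Real.log_pow]
      refine Real.log_le_log hpQr (hQ.trans ?_)
      rw [← hq, ← pow_mul]
      exact pow_le_pow_right₀ hθ1 (by omega)
    push_cast
    nlinarith
  · have h1 : (y.den : ℝ) ≤ θ ^ (D + F * 3 + 2) := by
      calc (y.den : ℝ) ≤ r * E * (Es : ℝ) ^ 3 := hy
        _ ≤ θ * (2 * θ ^ D) * (2 * θ ^ F) ^ 3 := by
          have : (0 : ℝ) < r := by exact_mod_cast hr0
          gcongr
        _ = 16 * (θ * θ ^ D * (θ ^ F) ^ 3) := by ring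
        _ = 16 * θ ^ (D + F * 3 + 1) := by
          rw [← pow_mul]; ring
        _ ≤ θ * θ ^ (D + F * 3 + 1) := by gcongr; linarith
        _ = _ := by rw [← pow_succ']
    calc (y.den : ℝ) ^ 100 ≤ (θ ^ (D + F * 3 + 2)) ^ 100 := by gcongr
      _ = θ ^ ((D + F * 3 + 2) * 100) := by rw [← pow_mul]
      _ ≤ θ ^ (H * 99) := pow_le_pow_right₀ hθ1 (by omega)
      _ = _ := by rw [pow_mul, hq]

/-- A fraction whose denominator is a large prime power is the sum of a cheap rational and a
rational with a substantially smaller denominator. -/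
theorem exists_split : ∃ (C : ℝ) (q₀ : ℕ), 1 ≤ C ∧ 3 ≤ q₀ ∧ ∀ p k : ℕ, p.Prime → q₀ ≤ p ^ k →
    ∀ b : ℤ, ∃ (x y : ℚ) (n : ℕ), (b : ℚ) / (p : ℚ) ^ k = x + y ∧ ModCost x n ∧
      (n : ℝ) ≤ C * Real.log ((p : ℝ) ^ k) ∧ (y.den : ℝ) ^ 100 ≤ ((p : ℝ) ^ k) ^ 99 := by
  obtain ⟨H, hH⟩ : ∃ n : ℕ, n = 1000000 := ⟨_, rfl⟩
  obtain ⟨C, hC, hdense⟩ := exists_dense_cheap_numerators (16 * H)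
  refine ⟨112 * C, ⌈(max 2000 (C ^ 4)) ^ H⌉₊ + 3, by linarith, by omega, fun p k hp hk b => ?_⟩
  have hm : (max 2000 (C ^ 4)) ^ H ≤ (p : ℝ) ^ k := by
    refine (Nat.le_ceil _).trans ?_
    exact_mod_cast (Nat.le_add_right _ _).trans hk
  have hroot : (((p : ℝ) ^ k) ^ ((H : ℝ)⁻¹)) ^ H = (p : ℝ) ^ k :=
    Real.rpow_inv_natCast_pow (by positivity) (by omega)
  have hmax : max 2000 (C ^ 4) ≤ ((p : ℝ) ^ k) ^ ((H : ℝ)⁻¹) := by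
    refine le_of_pow_le_pow_left₀ (n := H) (by omega) (by positivity) ?_
    rwa [hroot]
  exact exists_split_of_root hH hC hdense hp ((le_max_left _ _).trans hmax)
    ((le_max_right _ _).trans hmax) hroot b

end Split

/-! ## Logarithmic cost modulo the integers -/

section LogarithmicCost

lemma exists_modCost_bound (q₀ : ℕ) : ∃ M : ℕ, ∀ q : ℕ, 0 < q → q < q₀ → ∀ b : ℤ,
    ModCost ((b : ℚ) / q) M := by
  refine ⟨(Finset.range q₀).sup fun q => (Finset.range q).sup fun b =>
    S (Int.fract ((b : ℚ) / q)), fun q hq hq₀ b => ?_⟩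
  have hqz : (q : ℤ) ≠ 0 := by exact_mod_cast hq.ne'
  have hqq : (q : ℚ) ≠ 0 := by exact_mod_cast hq.ne'
  have hmod : (((b % q).toNat : ℕ) : ℤ) = b % q := Int.toNat_of_nonneg (Int.emod_nonneg _ hqz)
  have hlt : (b % q).toNat < q := by
    have := Int.emod_lt_of_pos b (by exact_mod_cast hq : (0 : ℤ) < q)
    omega
  have hb : (b : ℚ) / q = ((b / q : ℤ) : ℚ) + (((b % q).toNat : ℕ) : ℚ) / q := by
    rw [← Int.cast_natCast (b % q).toNat, hmod]
    field_simp
    exact_mod_cast (Int.mul_ediv_add_emod b q).symm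
  rw [hb]
  refine ((modCost_intCast _ 0).add (modCost_S_fract _)).mono ?_
  rw [zero_add]
  exact (Finset.le_sup (f := fun b : ℕ => S (Int.fract ((b : ℚ) / q)))
    (Finset.mem_range.mpr hlt)).trans (Finset.le_sup (f := fun q : ℕ =>
      (Finset.range q).sup fun b => S (Int.fract ((b : ℚ) / q))) (Finset.mem_range.mpr hq₀))

lemma exists_coprime_mul_of_not_isPrimePow {q : ℕ} (hq : 1 < q) (h : ¬ IsPrimePow q) :
    ∃ m n : ℕ, 1 < m ∧ 1 < n ∧ m.Coprime n ∧ q = m * n := by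
  have hp := Nat.minFac_prime hq.ne'
  obtain ⟨a, n, hn, hqn⟩ := Nat.exists_eq_pow_mul_and_not_dvd (by omega : q ≠ 0) q.minFac hp.ne_one
  have ha : a ≠ 0 := by
    rintro rfl
    rw [pow_zero, one_mul] at hqn
    exact hn (hqn ▸ Nat.minFac_dvd q)
  refine ⟨q.minFac ^ a, n, Nat.one_lt_pow ha hp.one_lt, ?_,
    ((Nat.Prime.coprime_iff_not_dvd hp).mpr hn).pow_left a, hqn⟩
  have hn0 : n ≠ 0 := by
    rintro rfl
    exact hn (dvd_zero _)
  have hn1 : n ≠ 1 := by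
    rintro rfl
    rw [mul_one] at hqn
    exact h (hqn ▸ hp.isPrimePow.pow ha)
  omega

/-- Every fraction with denominator `q` is, modulo the integers, of cost `O(log q)`. -/
theorem exists_modCost_le_log : ∃ C : ℝ, 0 < C ∧ ∀ q : ℕ, 0 < q → ∀ b : ℤ, ∃ n : ℕ,
    ModCost ((b : ℚ) / q) n ∧ (n : ℝ) ≤ C * Real.log q := by
  obtain ⟨C, q₀, hC, hq₀, hsplit⟩ := exists_split
  obtain ⟨M, hM⟩ := exists_modCost_bound q₀
  refine ⟨100 * C + 2 * M, by positivity, fun q => ?_⟩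
  induction q using Nat.strong_induction_on with
  | _ q ih =>
  intro hq b
  obtain rfl | hq1 : q = 1 ∨ 1 < q := by omega
  · refine ⟨0, ?_, by simp⟩
    rw [Nat.cast_one, div_one]
    exact modCost_intCast b 0
  have hlog : 1 / 2 ≤ Real.log q := by
    have h1 := Real.log_two_gt_d9
    have h2 := Real.log_le_log (by norm_num) (by exact_mod_cast hq1 : (2 : ℝ) ≤ q)
    linarith
  have hM0 : (0 : ℝ) ≤ M := Nat.cast_nonneg M
  by_cases hlt : q < q₀
  · exact ⟨M, hM q hq hlt b, by nlinarith⟩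
  by_cases hpp : IsPrimePow q
  · obtain ⟨p, k, hp, -, rfl⟩ := (isPrimePow_nat_iff q).mp hpp
    push Not at hlt
    push_cast at hlog ⊢
    obtain ⟨x, y, n, hxy, hx, hn, hy⟩ := hsplit p k hp hlt b
    set Q : ℝ := (p : ℝ) ^ k with hQ
    have hQ1 : 1 < Q := by rw [hQ]; exact_mod_cast hq1
    have hyQ : (y.den : ℝ) < Q := by
      refine lt_of_pow_lt_pow_left₀ 100 (by positivity) (hy.trans_lt ?_)
      exact pow_lt_pow_right₀ hQ1 (by norm_num)
    obtain ⟨m, hm, hm'⟩ := ih y.den (by rw [hQ] at hyQ; exact_mod_cast hyQ) y.den_pos y.num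
    rw [Rat.num_div_den] at hm
    refine ⟨n + m, by rw [hxy]; exact hx.add hm, ?_⟩
    have hlogy : 100 * Real.log y.den ≤ 99 * Real.log Q := by
      have := Real.log_le_log (by have := y.den_pos; positivity) hy
      rwa [Real.log_pow, Real.log_pow, Nat.cast_ofNat, Nat.cast_ofNat] at this
    push_cast
    nlinarith
  · obtain ⟨m, n, hm, hn, hmn, rfl⟩ := exists_coprime_mul_of_not_isPrimePow hq1 hpp
    have hbez := Nat.gcd_eq_gcd_ab m n
    rw [hmn.gcd_eq_one] at hbez
    obtain ⟨i, hi, hi'⟩ := ih m (by nlinarith) (by omega) (b * m.gcdB n)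
    obtain ⟨j, hj, hj'⟩ := ih n (by nlinarith) (by omega) (b * m.gcdA n)
    have hm0 : (m : ℚ) ≠ 0 := by positivity
    have hn0 : (n : ℚ) ≠ 0 := by positivity
    refine ⟨i + j, ?_, ?_⟩
    · convert hi.add hj using 1
      have hbez' : (1 : ℚ) = m * m.gcdA n + n * m.gcdB n := by exact_mod_cast hbez
      push_cast
      field_simp
      linear_combination (b : ℚ) * hbez'
    · push_cast
      rw [Real.log_mul (by positivity) (by positivity)]
      linarith

end LogarithmicCost

/-- the splitting (3.1)–(3.3) from the paper. There is an absolute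
constant `C > 0` such that for all sufficiently large `q` and every `b ∈ ℤ_+` with
`b < q` and `gcd(b,q) = 1`, one can write `b/q = b'/q' + b''/q''` (lowest terms) with
`Ĉ(b'/q') ≤ C log q` and `q'' < √q`. -/
theorem statement7 :
    ∃ C : ℝ, 0 < C ∧
      ∀ᶠ q : ℕ in Filter.atTop,
        ∀ b : ℕ, 0 < b → b < q → Nat.Coprime b q →
          ∃ x y : ℚ, (b : ℚ) / q = x + y ∧
            CostLE x (C * Real.log q) ∧ (y.den : ℝ) < Real.sqrt q := by
  obtain ⟨C, hC, hcost⟩ := exists_modCost_le_log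
  refine ⟨C, hC, ?_⟩
  filter_upwards [Filter.eventually_gt_atTop 1] with q hq b _ _ _
  obtain ⟨n, ⟨z, k, hkn, hk⟩, hn⟩ := hcost q (by omega) b
  refine ⟨(b : ℚ) / q - z, z, by ring, ⟨k, ?_, ?_⟩, ?_⟩
  · simpa using hk
  · exact (Nat.cast_le.mpr hkn).trans hn
  · rw [Rat.den_intCast, Nat.cast_one, Real.lt_sqrt zero_le_one]
    exact_mod_cast (by omega : 1 ^ 2 < q)
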